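/- For every T > 0 and every λ ≥ 1 there exist smooth functions θ, ψ : ℝ² × [0,T] → ℝ, 2π-periodic in both space variables, with ∫_{[0,2π]²} θ(x,y,t) dx dy = 0 for all t, satisfying Δψ(·,t) = θ(·,t) and ∂_t θ = ∂_x θ · ∂_y ψ − ∂_y θ · ∂_x ψ on ℝ² × [0,T], such that ‖θ(·,0)‖_∞ < 2, ‖∇θ(·,0)‖_∞ > 0, and max_{t ∈ [0,T]} ‖∇θ(·,t)‖_∞ > λ^{e^T − 1} · ‖∇θ(·,0)‖_∞. -/

import Mathlib

open Real MeasureTheory Set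

/-- Spatial partial derivative in `x` of a function of `(x, y, t)`. -/
noncomputable def pX (f : ℝ → ℝ → ℝ → ℝ) (x y t : ℝ) : ℝ := deriv (fun x' => f x' y t) x

/-- Spatial partial derivative in `y` of a function of `(x, y, t)`. -/
noncomputable def pY (f : ℝ → ℝ → ℝ → ℝ) (x y t : ℝ) : ℝ := deriv (fun y' => f x y' t) y

/-- Second spatial partial derivative in `x`. -/
noncomputable def pXX (f : ℝ → ℝ → ℝ → ℝ) (x y t : ℝ) : ℝ := deriv (fun x' => pX f x' y t) x

/-- Second spatial partial derivative in `y`. -/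
noncomputable def pYY (f : ℝ → ℝ → ℝ → ℝ) (x y t : ℝ) : ℝ := deriv (fun y' => pY f x y' t) y

/-- Sup norm over `ℝ²` of a function of two variables. -/
noncomputable def supNorm (f : ℝ → ℝ → ℝ) : ℝ := ⨆ p : ℝ × ℝ, |f p.1 p.2|

/-- Sup norm over `ℝ²` of the (Euclidean) spatial gradient of `f(·,·,t)`. -/
noncomputable def gradSupNorm (f : ℝ → ℝ → ℝ → ℝ) (t : ℝ) : ℝ :=
  ⨆ p : ℝ × ℝ, Real.sqrt ((pX f p.1 p.2 t) ^ 2 + (pY f p.1 p.2 t) ^ 2)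

/-- `θ, ψ` form a smooth, `2π`-periodic (in both space variables) solution of the
2D Euler equation in vorticity form on the torus, on the time interval `[0, T]`:
`Δψ(·,t) = θ(·,t)`, `θ(·,t)` has zero average and
`∂ₜθ = ∂ₓθ ∂_yψ − ∂_yθ ∂ₓψ`. -/
def IsEulerOnTorus (T : ℝ) (θ ψ : ℝ → ℝ → ℝ → ℝ) : Prop :=
  ContDiffOn ℝ (⊤ : ℕ∞) (fun p : ℝ × ℝ × ℝ => θ p.1 p.2.1 p.2.2) {p : ℝ × ℝ × ℝ | p.2.2 ∈ Icc 0 T} ∧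
  ContDiffOn ℝ (⊤ : ℕ∞) (fun p : ℝ × ℝ × ℝ => ψ p.1 p.2.1 p.2.2) {p : ℝ × ℝ × ℝ | p.2.2 ∈ Icc 0 T} ∧
  (∀ x y t, θ (x + 2 * π) y t = θ x y t ∧ θ x (y + 2 * π) t = θ x y t) ∧
  (∀ x y t, ψ (x + 2 * π) y t = ψ x y t ∧ ψ x (y + 2 * π) t = ψ x y t) ∧
  (∀ t ∈ Icc 0 T, ∫ x in (0:ℝ)..(2 * π), ∫ y in (0:ℝ)..(2 * π), θ x y t = 0) ∧
  (∀ x y : ℝ, ∀ t ∈ Icc 0 T, pXX ψ x y t + pYY ψ x y t = θ x y t) ∧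
  (∀ x y : ℝ, ∀ t ∈ Icc 0 T,
    derivWithin (fun s => θ x y s) (Icc 0 T) t
      = pX θ x y t * pY ψ x y t - pY θ x y t * pX ψ x y t)

section
open Real MeasureTheory Set

namespace EU

/-- The weight `1 + |k₁| + |k₂|`. -/
noncomputable def br (k : ℤ × ℤ) : ℝ := 1 + |(k.1 : ℝ)| + |(k.2 : ℝ)|

/-- The squared Euclidean length. -/
noncomputable def nsq (k : ℤ × ℤ) : ℝ := (k.1 : ℝ) ^ 2 + (k.2 : ℝ) ^ 2

/-- The kernel of the nonlinearity. -/
noncomputable def ker (j k : ℤ × ℤ) : ℝ := ((j.2 : ℝ) * k.1 - (j.1 : ℝ) * k.2) / nsq j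

/-- The bilinear form. -/
noncomputable def bil (c d : ℤ × ℤ → ℝ) (k : ℤ × ℤ) : ℝ := ∑' j, ker j k * c j * d (k - j)

/-- The nonlinearity. -/
noncomputable def nl (c : ℤ × ℤ → ℝ) (k : ℤ × ℤ) : ℝ := bil c c k

/-- Rapid decay. -/
def Rapid (c : ℤ × ℤ → ℝ) : Prop := ∀ s : ℕ, ∃ A : ℝ, ∀ k, |c k| * br k ^ s ≤ A

/-- Odd in each of the two indices. -/
def Sym (c : ℤ × ℤ → ℝ) : Prop :=
  ∀ k1 k2 : ℤ, c (-k1, k2) = - c (k1, k2) ∧ c (k1, -k2) = - c (k1, k2)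

lemma br_one (k) : 1 ≤ br k := by
  unfold br; linarith [abs_nonneg (k.1:ℝ), abs_nonneg (k.2:ℝ)]
lemma br_pos (k) : 0 < br k := lt_of_lt_of_le one_pos (br_one k)
lemma br_neg (k) : br (-k) = br k := by simp [br]
lemma br_add (j l : ℤ × ℤ) : br (j + l) ≤ br j + br l := by
  simp only [br, Prod.fst_add, Prod.snd_add, Int.cast_add]
  have := abs_add_le (j.1 : ℝ) l.1
  have := abs_add_le (j.2 : ℝ) l.2
  linarith
lemma br_add_mul (j l : ℤ × ℤ) : br (j + l) ≤ br j * br l := by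
  simp only [br, Prod.fst_add, Prod.snd_add, Int.cast_add]
  have := abs_add_le (j.1 : ℝ) l.1
  have := abs_add_le (j.2 : ℝ) l.2
  have h1 := abs_nonneg (j.1 : ℝ)
  have h2 := abs_nonneg (j.2 : ℝ)
  have h3 := abs_nonneg (l.1 : ℝ)
  have h4 := abs_nonneg (l.2 : ℝ)
  nlinarith [mul_nonneg h1 h3, mul_nonneg h1 h4, mul_nonneg h2 h3, mul_nonneg h2 h4]

lemma br_sub_mul (k j : ℤ × ℤ) : br k ≤ br j * br (k - j) := by
  have := br_add_mul j (k - j)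
  simpa using this

lemma br_abs_sub (j l : ℤ × ℤ) : |br (j + l) - br l| ≤ |(j.1 : ℝ)| + |(j.2 : ℝ)| := by
  simp only [br, Prod.fst_add, Prod.snd_add, Int.cast_add]
  have h1 := abs_abs_sub_abs_le ((j.1 : ℝ) + l.1) l.1
  have h2 := abs_abs_sub_abs_le ((j.2 : ℝ) + l.2) l.2
  simp only [add_sub_cancel_right] at h1 h2
  rw [abs_le] at *
  constructor <;> linarith [h1.1, h1.2, h2.1, h2.2]

lemma nsq_nonneg (k) : 0 ≤ nsq k := by unfold nsq; positivity

lemma nsq_one {k : ℤ × ℤ} (hk : k ≠ 0) : 1 ≤ nsq k := by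
  unfold nsq
  have : (1 : ℤ) ≤ k.1 ^ 2 + k.2 ^ 2 := by
    by_contra h
    have h1 : k.1 = 0 := by nlinarith [sq_nonneg k.1, sq_nonneg k.2]
    have h2 : k.2 = 0 := by nlinarith [sq_nonneg k.1, sq_nonneg k.2]
    exact hk (Prod.ext h1 h2)
  exact_mod_cast this

lemma br_sq_le {k : ℤ × ℤ} (hk : k ≠ 0) : br k ^ 2 ≤ 8 * nsq k := by
  have h := nsq_one hk
  unfold br nsq at *
  have e1 := sq_abs (k.1 : ℝ)
  have e2 := sq_abs (k.2 : ℝ)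
  nlinarith [sq_nonneg (|(k.1:ℝ)| - |(k.2:ℝ)|), sq_nonneg (|(k.1:ℝ)| - 1), sq_nonneg (|(k.2:ℝ)| - 1)]

lemma nsq_le_br (k : ℤ × ℤ) : nsq k ≤ br k ^ 2 := by
  unfold br nsq
  have e1 := sq_abs (k.1 : ℝ)
  have e2 := sq_abs (k.2 : ℝ)
  have := abs_nonneg (k.1 : ℝ)
  have := abs_nonneg (k.2 : ℝ)
  nlinarith [mul_nonneg (abs_nonneg (k.1 : ℝ)) (abs_nonneg (k.2 : ℝ))]

lemma ker_add (j l : ℤ × ℤ) : ker j (j + l) = ker j l := by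
  simp only [ker, Prod.fst_add, Prod.snd_add, Int.cast_add]; ring

lemma ker_neg (j l : ℤ × ℤ) : ker (-j) l = - ker j l := by
  simp only [ker, nsq, Prod.fst_neg, Prod.snd_neg, Int.cast_neg]; ring

lemma ker_neg' (j l : ℤ × ℤ) : ker j (-l) = - ker j l := by
  simp only [ker, nsq, Prod.fst_neg, Prod.snd_neg, Int.cast_neg]; ring

lemma ker_bound (j l : ℤ × ℤ) : |ker j l| * (|(j.1 : ℝ)| + |(j.2 : ℝ)|) ≤ 2 * br l := by
  unfold ker
  rw [abs_div, abs_of_nonneg (nsq_nonneg j)]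
  by_cases hj : j = 0
  · subst hj; simp [(br_pos l).le]
  have h1 := nsq_one hj
  rw [div_mul_eq_mul_div, div_le_iff₀ (by linarith)]
  have h2 : |(j.2 : ℝ) * l.1 - (j.1 : ℝ) * l.2| ≤ |(j.2:ℝ)| * |(l.1:ℝ)| + |(j.1:ℝ)| * |(l.2:ℝ)| := by
    rw [← abs_mul, ← abs_mul]; exact abs_sub _ _
  have e1 := sq_abs (j.1 : ℝ)
  have e2 := sq_abs (j.2 : ℝ)
  unfold br nsq at *
  have := abs_nonneg (j.2:ℝ)
  set a := |(j.1:ℝ)|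
  set b := |(j.2:ℝ)|
  set x := |(l.1:ℝ)|
  set y := |(l.2:ℝ)|
  have ha : 0 ≤ a := abs_nonneg _
  have hb : 0 ≤ b := abs_nonneg _
  have hx : 0 ≤ x := abs_nonneg _
  have hy : 0 ≤ y := abs_nonneg _
  rw [← e1, ← e2]
  calc _ ≤ (b * x + a * y) * (a + b) := by gcongr
    _ ≤ 2 * (x + y) * (a ^ 2 + b ^ 2) := by
      nlinarith [mul_nonneg hx (sq_nonneg (a - b)), mul_nonneg hy (sq_nonneg (a-b)), mul_nonneg hx (sq_nonneg a),
        mul_nonneg hx (sq_nonneg b), mul_nonneg hy (sq_nonneg a), mul_nonneg hy (sq_nonneg b)]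
    _ ≤ _ := by nlinarith [sq_nonneg a, sq_nonneg b]

lemma ker_le (j l : ℤ × ℤ) : |ker j l| ≤ 2 * br l := by
  by_cases hj : j = 0
  · subst hj; simp [ker, (br_pos l).le]
  have h := ker_bound j l
  have h1 : (1:ℝ) ≤ |(j.1 : ℝ)| + |(j.2 : ℝ)| := by
    have : (1:ℤ) ≤ |j.1| + |j.2| := by
      by_contra h
      have a1 := abs_nonneg j.1
      have a2 := abs_nonneg j.2
      have h1 : |j.1| = 0 := by omega
      have h2 : |j.2| = 0 := by omega
      exact hj (Prod.ext (abs_eq_zero.1 h1) (abs_eq_zero.1 h2))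
    exact_mod_cast this
  nlinarith [abs_nonneg (ker j l)]

lemma ker_sub (j k : ℤ × ℤ) : ker j (k - j) = ker j k := by
  have := ker_add j (k - j)
  simpa using this.symm

lemma ker_le' (j k : ℤ × ℤ) : |ker j k| ≤ 2 * br (k - j) := by
  rw [← ker_sub]; exact ker_le _ _

lemma summable_br4 : Summable fun k : ℤ × ℤ => (br k ^ 4)⁻¹ := by
  have h1 : Summable fun n : ℤ => ((1 + |(n:ℝ)|) ^ 2)⁻¹ := by
    have h0 : Summable fun n : ℕ => ((1 + |(n:ℝ)|) ^ 2)⁻¹ := by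
      have := (summable_nat_add_iff 1).2 (Real.summable_nat_pow_inv.2 (by norm_num : 1 < 2))
      refine this.congr fun n => ?_
      rw [abs_of_nonneg (by positivity)]; push_cast; ring_nf
    refine Summable.of_nat_of_neg ?_ ?_
    · simpa using h0
    · simpa using h0
  have h2 := h1.mul_of_nonneg h1 (fun _ => by positivity) (fun _ => by positivity)
  refine Summable.of_nonneg_of_le (fun k => by have := br_pos k; positivity) (fun k => ?_) h2
  rw [← mul_inv]
  apply inv_anti₀ (by positivity)
  rw [← mul_pow, show (4:ℕ) = 2 * 2 by norm_num, pow_mul]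
  apply pow_le_pow_left₀ (by positivity)
  unfold br
  nlinarith [abs_nonneg (k.1:ℝ), abs_nonneg (k.2:ℝ), mul_nonneg (abs_nonneg (k.1:ℝ)) (abs_nonneg (k.2:ℝ))]

/-- the constant `Σ ⟨k⟩⁻⁴` -/
noncomputable def S4 : ℝ := ∑' k : ℤ × ℤ, (br k ^ 4)⁻¹

lemma S4_nonneg : 0 ≤ S4 := tsum_nonneg fun k => by have := br_pos k; positivity

lemma summable_of_bd {f : ℤ × ℤ → ℝ} {A : ℝ} (h : ∀ k, |f k| * br k ^ 4 ≤ A) : Summable f := by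
  refine Summable.of_norm_bounded (summable_br4.mul_left A) fun k => ?_
  rw [Real.norm_eq_abs, ← div_eq_mul_inv, le_div_iff₀ (pow_pos (br_pos k) _)]
  exact h k

lemma tsum_le_of_bd {f : ℤ × ℤ → ℝ} {A : ℝ} (h : ∀ k, |f k| * br k ^ 4 ≤ A) : ∑' k, |f k| ≤ A * S4 := by
  rw [S4, ← tsum_mul_left]
  refine Summable.tsum_le_tsum (fun k => ?_) (summable_of_bd h).abs (summable_br4.mul_left A)
  rw [← div_eq_mul_inv, le_div_iff₀ (pow_pos (br_pos k) _)]
  exact h k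

lemma Rapid.summable {c : ℤ × ℤ → ℝ} (hc : Rapid c) : Summable c := by
  obtain ⟨A, hA⟩ := hc 4
  exact summable_of_bd hA

lemma Rapid.mul_wt {c : ℤ × ℤ → ℝ} (hc : Rapid c) {w : ℤ × ℤ → ℝ} {m : ℕ} {C : ℝ}
    (hw : ∀ k, |w k| ≤ C * br k ^ m) : Rapid fun k => w k * c k := by
  intro s
  obtain ⟨A, hA⟩ := hc (s + m)
  have hC : 0 ≤ C := by
    have := (abs_nonneg _).trans (hw 0)
    exact nonneg_of_mul_nonneg_left this (pow_pos (br_pos 0) _)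
  refine ⟨C * A, fun k => ?_⟩
  rw [abs_mul]
  calc |w k| * |c k| * br k ^ s ≤ (C * br k ^ m) * |c k| * br k ^ s := by
        have := br_pos k
        gcongr; exact hw k
    _ = C * (|c k| * br k ^ (s + m)) := by ring
    _ ≤ _ := by gcongr; exact hA k

lemma Rapid.br_mul {c : ℤ × ℤ → ℝ} (hc : Rapid c) (s : ℕ) : Rapid fun k => br k ^ s * c k :=
  hc.mul_wt (C := 1) (m := s) fun k => by
    rw [abs_of_nonneg (pow_pos (br_pos k) _).le]; simp

lemma Rapid.abs {c : ℤ × ℤ → ℝ} (hc : Rapid c) : Rapid fun k => |c k| := by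
  intro s; simpa using hc s

lemma Rapid.bounded {c : ℤ × ℤ → ℝ} (hc : Rapid c) : ∃ A, ∀ k, |c k| ≤ A := by
  simpa using hc 0

lemma Rapid.mul_bd {c d : ℤ × ℤ → ℝ} (hc : Rapid c) {A : ℝ} (hd : ∀ k, |d k| ≤ A) : Rapid fun k => d k * c k :=
  hc.mul_wt (C := A) (m := 0) fun k => by simpa using hd k

lemma Rapid.mul {c d : ℤ × ℤ → ℝ} (hc : Rapid c) (hd : Rapid d) : Rapid fun k => d k * c k := by
  obtain ⟨A, hA⟩ := hd.bounded
  exact hc.mul_bd hA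

lemma Rapid.add {c d : ℤ × ℤ → ℝ} (hc : Rapid c) (hd : Rapid d) : Rapid fun k => c k + d k := by
  intro s
  obtain ⟨A, hA⟩ := hc s
  obtain ⟨B, hB⟩ := hd s
  refine ⟨A + B, fun k => ?_⟩
  have := hA k; have := hB k
  have h3 := abs_add_le (c k) (d k)
  have := pow_pos (br_pos k) s
  nlinarith

lemma Rapid.sq_summable {c : ℤ × ℤ → ℝ} (hc : Rapid c) (s : ℕ) : Summable fun k => br k ^ s * c k ^ 2 := by
  refine ((hc.mul hc).br_mul s).summable.congr fun k => ?_
  ring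

/-- change of variables `(k,j) ↦ (k - j, -j)` -/
def eqv1 : (ℤ × ℤ) × (ℤ × ℤ) ≃ (ℤ × ℤ) × (ℤ × ℤ) where
  toFun p := (p.1 - p.2, -p.2)
  invFun p := (p.1 - p.2, -p.2)
  left_inv p := by simp
  right_inv p := by simp

/-- change of variables `(k,j) ↦ (k, k - j)` -/
def eqv2 : (ℤ × ℤ) × (ℤ × ℤ) ≃ (ℤ × ℤ) × (ℤ × ℤ) where
  toFun p := (p.1, p.1 - p.2)
  invFun p := (p.1, p.1 - p.2)
  left_inv p := by simp
  right_inv p := by simp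

/-- change of variables `(j,l) ↦ (j + l, j)` -/
def eqv3 : (ℤ × ℤ) × (ℤ × ℤ) ≃ (ℤ × ℤ) × (ℤ × ℤ) where
  toFun p := (p.1 + p.2, p.1)
  invFun p := (p.2, p.1 - p.2)
  left_inv p := by simp
  right_inv p := by simp

/-- summability of double sums over `(k,j)` with `c j`, `d (k-j)` weights -/
lemma summable_conv {f : (ℤ × ℤ) × (ℤ × ℤ) → ℝ} {c d : ℤ × ℤ → ℝ} (hc : Summable c) (hd : Summable d)
    (h : ∀ k j, |f (k, j)| ≤ c j * d (k - j)) : Summable f := by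
  rw [← eqv3.summable_iff]
  have h2 : Summable fun p : (ℤ × ℤ) × (ℤ × ℤ) => ‖c p.1‖ * ‖d p.2‖ :=
    hc.norm.mul_of_nonneg hd.norm (fun _ => norm_nonneg _) (fun _ => norm_nonneg _)
  refine Summable.of_norm_bounded h2 fun p => ?_
  have := h (p.1 + p.2) p.1
  simp only [Function.comp, eqv3, Equiv.coe_fn_mk, Real.norm_eq_abs] at *
  rw [← abs_mul]
  refine this.trans ?_
  simpa using le_abs_self (c p.1 * d p.2)

lemma young {α γ : ℤ × ℤ → ℝ} (hα : ∀ k, 0 ≤ α k) (hγ : ∀ k, 0 ≤ γ k) (sα : Summable α) (sγ : Summable γ)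
    (sγ2 : Summable fun k => γ k ^ 2) :
    Summable (fun p : (ℤ × ℤ) × (ℤ × ℤ) => γ p.1 * α p.2 * γ (p.1 - p.2)) ∧
    ∑' p : (ℤ × ℤ) × (ℤ × ℤ), γ p.1 * α p.2 * γ (p.1 - p.2) ≤ (∑' k, α k) * ∑' k, γ k ^ 2 := by
  obtain ⟨G, hG⟩ : ∃ G, ∀ k, γ k ≤ G := ⟨∑' k, γ k, fun k => sγ.le_tsum k (fun i _ => hγ i)⟩
  have hG0 : 0 ≤ G := (hγ 0).trans (hG 0)
  have hs : Summable (fun p : (ℤ × ℤ) × (ℤ × ℤ) => γ p.1 * α p.2 * γ (p.1 - p.2)) := by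
    refine summable_conv (sα.mul_left G) sγ fun k j => ?_
    rw [abs_of_nonneg (by have := hα j; have := hγ k; have := hγ (k-j); positivity)]
    have := hα j; have := hγ (k - j)
    gcongr
    exact hG k
  refine ⟨hs, ?_⟩
  have hs' := hs.prod_symm
  have e1 : ∑' p : (ℤ × ℤ) × (ℤ × ℤ), γ p.1 * α p.2 * γ (p.1 - p.2)
      = ∑' j, ∑' k, γ k * α j * γ (k - j) := by
    rw [← (Equiv.prodComm _ _).tsum_eq]
    exact hs'.tsum_prod
  rw [e1, ← tsum_mul_right]
  refine Summable.tsum_le_tsum (fun j => ?_) hs'.prod (sα.mul_right _)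
  have t1 : Summable fun k => γ (k - j) ^ 2 := (Equiv.subRight j).summable_iff.2 sγ2
  have t2 : ∑' k, γ (k - j) ^ 2 = ∑' k, γ k ^ 2 := (Equiv.subRight j).tsum_eq (fun k => γ k ^ 2)
  have : ∑' k, γ k * α j * γ (k - j) ≤ ∑' k, α j * ((γ k ^ 2 + γ (k - j) ^ 2) / 2) := by
    refine Summable.tsum_le_tsum (fun k => ?_) (hs'.prod_factor j) (((sγ2.add t1).div_const 2).mul_left _)
    have := hα j
    nlinarith [mul_nonneg this (sq_nonneg (γ k - γ (k - j)))]
  refine this.trans_eq ?_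
  rw [tsum_mul_left, tsum_div_const, Summable.tsum_add sγ2 t1, t2]
  ring

end EU

end

section
open Real MeasureTheory Set

namespace EU

lemma abs_tsum_le {ι : Type*} {f : ι → ℝ} (h : Summable fun i => |f i|) : |∑' i, f i| ≤ ∑' i, |f i| := by
  have h1 : Summable fun i => ‖f i‖ := by simpa only [Real.norm_eq_abs] using h
  have h2 := norm_tsum_le_tsum_norm h1
  simpa only [Real.norm_eq_abs] using h2

lemma Sym.even {c : ℤ × ℤ → ℝ} (h : Sym c) (k) : c (-k) = c k := by
  have h1 := (h k.1 (-k.2)).1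
  have h2 := (h k.1 k.2).2
  simp only [Prod.mk.eta] at h2
  rw [show -k = (-k.1, -k.2) from rfl, h1, h2]; simp

lemma Sym.zero1 {c : ℤ × ℤ → ℝ} (h : Sym c) (n) : c (0, n) = 0 := by
  have h1 := (h 0 n).1
  simp at h1; linarith

lemma Sym.zero2 {c : ℤ × ℤ → ℝ} (h : Sym c) (n) : c (n, 0) = 0 := by
  have h1 := (h n 0).2
  simp at h1; linarith

lemma Sym.zero {c : ℤ × ℤ → ℝ} (h : Sym c) : c 0 = 0 := h.zero1 0

lemma bil_term_bd {c d : ℤ × ℤ → ℝ} (k j : ℤ × ℤ) (s : ℕ) :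
    |ker j k * c j * d (k - j)| * br k ^ s ≤ 2 * ((|c j| * br j ^ s) * (|d (k - j)| * br (k - j) ^ (s + 1))) := by
  rw [abs_mul, abs_mul]
  have h1 := ker_le' j k
  have h2 := pow_le_pow_left₀ (br_pos k).le (br_sub_mul k j) s
  have h3 := br_pos j
  have h4 := br_pos (k - j)
  calc |ker j k| * |c j| * |d (k - j)| * br k ^ s
      ≤ (2 * br (k - j)) * |c j| * |d (k - j)| * (br j * br (k - j)) ^ s := by gcongr; exact (pow_pos (br_pos k) s).le
    _ = _ := by rw [mul_pow]; ring

lemma bil_sum {c d : ℤ × ℤ → ℝ} {s : ℕ} {A B : ℝ} (hc : ∀ k, |c k| * br k ^ (s + 4) ≤ A)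
    (hd : ∀ k, |d k| * br k ^ (s + 1) ≤ B) (k : ℤ × ℤ) (j : ℤ × ℤ) :
    |ker j k * c j * d (k - j)| * br k ^ s ≤ 2 * A * B * (br j ^ 4)⁻¹ := by
  refine (bil_term_bd k j s).trans ?_
  have h1 : |c j| * br j ^ s ≤ A * (br j ^ 4)⁻¹ := by
    rw [← div_eq_mul_inv, le_div_iff₀ (pow_pos (br_pos j) _)]
    refine le_trans (le_of_eq ?_) (hc j); ring
  have h2 := hd (k - j)
  have h3 : 0 ≤ |c j| * br j ^ s := by have := br_pos j; positivity
  have h4 : 0 ≤ |d (k-j)| * br (k-j) ^ (s+1) := by have := br_pos (k-j); positivity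
  calc _ ≤ 2 * ((A * (br j ^ 4)⁻¹) * B) := by
        apply mul_le_mul_of_nonneg_left _ (by norm_num)
        exact mul_le_mul h1 h2 h4 (h3.trans h1)
    _ = _ := by ring

lemma bil_summable {c d : ℤ × ℤ → ℝ} {A B : ℝ} (hc : ∀ k, |c k| * br k ^ 4 ≤ A)
    (hd : ∀ k, |d k| * br k ≤ B) (k : ℤ × ℤ) :
    Summable fun j => ker j k * c j * d (k - j) := by
  refine Summable.of_norm_bounded (summable_br4.mul_left (2 * A * B)) fun j => ?_
  have := bil_sum (s := 0) (A := A) (B := B) (by simpa using hc) (by simpa using hd) k j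
  simpa using this

lemma bil_bd {c d : ℤ × ℤ → ℝ} {s : ℕ} {A B : ℝ} (hc : ∀ k, |c k| * br k ^ (s + 4) ≤ A)
    (hd : ∀ k, |d k| * br k ^ (s + 1) ≤ B) (k : ℤ × ℤ) : |bil c d k| * br k ^ s ≤ 2 * A * B * S4 := by
  have hs : Summable fun j => |ker j k * c j * d (k - j)| * br k ^ s :=
    Summable.of_nonneg_of_le (fun j => mul_nonneg (abs_nonneg _) (pow_pos (br_pos k) _).le)
      (bil_sum hc hd k) (summable_br4.mul_left _)
  have hs' : Summable fun j => |ker j k * c j * d (k - j)| := by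
    have := hs.mul_right ((br k ^ s)⁻¹)
    refine this.congr fun j => ?_
    rw [mul_assoc, mul_inv_cancel₀ (pow_pos (br_pos k) _).ne', mul_one]
  calc |bil c d k| * br k ^ s ≤ (∑' j, |ker j k * c j * d (k - j)|) * br k ^ s := by
        apply mul_le_mul_of_nonneg_right _ (pow_pos (br_pos k) _).le
        exact abs_tsum_le hs'
    _ = ∑' j, |ker j k * c j * d (k - j)| * br k ^ s := tsum_mul_right.symm
    _ ≤ ∑' j, 2 * A * B * (br j ^ 4)⁻¹ := Summable.tsum_le_tsum (bil_sum hc hd k) hs (summable_br4.mul_left _)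
    _ = _ := by rw [tsum_mul_left, S4]

lemma Rapid.bil {c d : ℤ × ℤ → ℝ} (hc : Rapid c) (hd : Rapid d) : Rapid (bil c d) := by
  intro s
  obtain ⟨A, hA⟩ := hc (s + 4)
  obtain ⟨B, hB⟩ := hd (s + 1)
  exact ⟨_, bil_bd hA hB⟩

lemma Rapid.bil_summable {c d : ℤ × ℤ → ℝ} (hc : Rapid c) (hd : Rapid d) (k : ℤ × ℤ) :
    Summable fun j => ker j k * c j * d (k - j) := by
  obtain ⟨A, hA⟩ := hc 4
  obtain ⟨B, hB⟩ := hd 1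
  exact EU.bil_summable hA (by simpa using hB) k

lemma Rapid.nl {c : ℤ × ℤ → ℝ} (hc : Rapid c) : Rapid (nl c) := hc.bil hc

/-- sign flips -/
def fl1 : ℤ × ℤ ≃ ℤ × ℤ := (Equiv.neg ℤ).prodCongr (Equiv.refl ℤ)
/-- sign flips -/
def fl2 : ℤ × ℤ ≃ ℤ × ℤ := (Equiv.refl ℤ).prodCongr (Equiv.neg ℤ)

lemma fl1_apply (k : ℤ × ℤ) : fl1 k = (-k.1, k.2) := rfl
lemma fl2_apply (k : ℤ × ℤ) : fl2 k = (k.1, -k.2) := rfl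

lemma Sym.f1 {c : ℤ × ℤ → ℝ} (h : Sym c) (k : ℤ × ℤ) : c (fl1 k) = - c k := (h k.1 k.2).1
lemma Sym.f2 {c : ℤ × ℤ → ℝ} (h : Sym c) (k : ℤ × ℤ) : c (fl2 k) = - c k := (h k.1 k.2).2

lemma ker_fl1 (j k : ℤ × ℤ) : ker (fl1 j) (fl1 k) = - ker j k := by
  simp only [ker, nsq, fl1_apply, Int.cast_neg]; ring
lemma ker_fl2 (j k : ℤ × ℤ) : ker (fl2 j) (fl2 k) = - ker j k := by
  simp only [ker, nsq, fl2_apply, Int.cast_neg]; ring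
lemma fl1_sub (j k : ℤ × ℤ) : fl1 k - fl1 j = fl1 (k - j) := by
  ext <;> simp [fl1_apply]; ring
lemma fl2_sub (j k : ℤ × ℤ) : fl2 k - fl2 j = fl2 (k - j) := by
  ext <;> simp [fl2_apply]; ring

lemma Sym.nl {c : ℤ × ℤ → ℝ} (h : Sym c) : Sym (nl c) := by
  intro k1 k2
  constructor
  · change EU.nl c (fl1 (k1, k2)) = _
    rw [EU.nl, EU.bil, ← fl1.tsum_eq, EU.nl, EU.bil, ← tsum_neg]
    congr 1; ext j
    rw [ker_fl1, fl1_sub, h.f1, h.f1]; ring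
  · change EU.nl c (fl2 (k1, k2)) = _
    rw [EU.nl, EU.bil, ← fl2.tsum_eq, EU.nl, EU.bil, ← tsum_neg]
    congr 1; ext j
    rw [ker_fl2, fl2_sub, h.f2, h.f2]; ring

/-- weighted square sums -/
noncomputable def En (s : ℕ) (c : ℤ × ℤ → ℝ) : ℝ := ∑' k, br k ^ (2 * s) * c k ^ 2

lemma br_pow_diff (j l : ℤ × ℤ) (s : ℕ) :
    |br (j + l) ^ s - br l ^ s| * |ker j l| ≤ s * 2 ^ (s + 1) * (br j ^ s + br l ^ s) := by
  rcases s with _ | s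
  · simp
  have h1 := abs_pow_sub_pow_le (br (j + l)) (br l) (s + 1)
  have h2 : max |br (j + l)| |br l| ≤ br j + br l := by
    rw [abs_of_pos (br_pos _), abs_of_pos (br_pos _)]
    exact max_le (br_add _ _) (by linarith [br_pos j])
  have h3 := br_abs_sub j l
  have h4 := ker_bound j l
  have h5 := br_pos j
  have h6 := br_pos l
  have h7 : (br j + br l) ^ (s + 1) ≤ 2 ^ s * (br j ^ (s + 1) + br l ^ (s + 1)) := by
    simpa using add_pow_le h5.le h6.le (s + 1)
  calc _ ≤ (|br (j + l) - br l| * ↑(s + 1) * max |br (j + l)| |br l| ^ (s + 1 - 1)) * |ker j l| := by gcongr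
    _ ≤ ((|(j.1:ℝ)| + |(j.2:ℝ)|) * ↑(s + 1) * (br j + br l) ^ s) * |ker j l| := by
      simp only [Nat.add_sub_cancel]; gcongr
    _ = (|ker j l| * (|(j.1:ℝ)| + |(j.2:ℝ)|)) * (↑(s + 1) * (br j + br l) ^ s) := by ring
    _ ≤ (2 * br l) * (↑(s + 1) * (br j + br l) ^ s) := by gcongr
    _ ≤ (2 * (br j + br l)) * (↑(s + 1) * (br j + br l) ^ s) := by gcongr; linarith
    _ = 2 * ↑(s + 1) * (br j + br l) ^ (s + 1) := by ring
    _ ≤ 2 * ↑(s + 1) * (2 ^ s * (br j ^ (s + 1) + br l ^ (s + 1))) := by gcongr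
    _ ≤ 2 * ↑(s + 1) * (2 ^ s * (br j ^ (s + 1) + br l ^ (s + 1))) * 2 := by
      have : 0 ≤ 2 * ((s + 1 : ℕ):ℝ) * (2 ^ s * (br j ^ (s + 1) + br l ^ (s + 1))) := by positivity
      linarith
    _ = _ := by ring

lemma energy {c : ℤ × ℤ → ℝ} (hc : Rapid c) (he : ∀ k, c (-k) = c k) (s : ℕ) :
    |∑' k, br k ^ (2 * s) * (c k * nl c k)| ≤ s * 2 ^ (s + 2) * (∑' k, |c k|) * En s c := by
  set γ : ℤ × ℤ → ℝ := fun k => br k ^ s * |c k| with hγ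
  have rγ : Rapid γ := hc.abs.br_mul s
  have γ0 : ∀ k, 0 ≤ γ k := fun k => by have := br_pos k; positivity
  have sγ2 : Summable fun k => γ k ^ 2 := by
    refine (hc.sq_summable (2 * s)).congr fun k => ?_
    simp only [hγ]; rw [mul_pow, sq_abs]; ring
  have eγ : ∑' k, γ k ^ 2 = En s c := by
    unfold En; congr 1; ext k; simp only [hγ]; rw [mul_pow, sq_abs]; ring
  obtain ⟨y1, y2⟩ := young (α := fun k => |c k|) (γ := γ) (fun k => abs_nonneg _) γ0 hc.abs.summable rγ.summable sγ2
  set F : (ℤ × ℤ) × (ℤ × ℤ) → ℝ := fun p => br p.1 ^ (2 * s) * (c p.1 * (ker p.2 p.1 * c p.2 * c (p.1 - p.2))) with hF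
  set G : (ℤ × ℤ) × (ℤ × ℤ) → ℝ := fun p => br p.1 ^ s * br (p.1 - p.2) ^ s * (c p.1 * (ker p.2 p.1 * c p.2 * c (p.1 - p.2))) with hG
  obtain ⟨D, hD⟩ := (hc.br_mul (2 * s)).abs.bounded
  have D0 : 0 ≤ D := (abs_nonneg _).trans (hD 0)
  have sF : Summable F := by
    refine summable_conv (c := fun j => D * (2 * |c j|)) (d := fun l => br l ^ 1 * |c l|)
      ((hc.abs.summable.mul_left 2).mul_left D) (hc.abs.br_mul 1).summable fun k j => ?_
    have h1 := hD k
    simp only [abs_abs] at h1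
    have h2 := ker_le' j k
    simp only [hF]
    rw [← mul_assoc, abs_mul, abs_mul (ker j k * c j), abs_mul (ker j k)]
    calc _ ≤ D * (2 * br (k - j) * |c j| * |c (k - j)|) := by gcongr
      _ = _ := by ring
  have sG : Summable G := by
    obtain ⟨D1, hD1⟩ := (hc.br_mul s).abs.bounded
    have D10 : 0 ≤ D1 := (abs_nonneg _).trans (hD1 0)
    refine summable_conv (c := fun j => D1 * (2 * |c j|)) (d := fun l => br l ^ (s + 1) * |c l|)
      ((hc.abs.summable.mul_left 2).mul_left D1) (hc.abs.br_mul (s + 1)).summable fun k j => ?_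
    have h1 := hD1 k
    simp only [abs_abs] at h1
    have h2 := ker_le' j k
    have h3 := br_pos (k - j)
    simp only [hG]
    rw [show br k ^ s * br (k - j) ^ s * (c k * (ker j k * c j * c (k - j)))
      = (br k ^ s * c k) * (ker j k * c j * c (k - j) * br (k - j) ^ s) by ring]
    rw [abs_mul, abs_mul (ker j k * c j * c (k - j)), abs_mul (ker j k * c j), abs_mul (ker j k), abs_of_pos (pow_pos h3 s)]
    calc _ ≤ D1 * (2 * br (k - j) * |c j| * |c (k - j)| * br (k - j) ^ s) := by gcongr
      _ = _ := by ring
  have G0 : ∑' p, G p = 0 := by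
    have h1 : ∑' p, G (eqv1 p) = ∑' p, G p := eqv1.tsum_eq G
    have h2 : ∀ p, G (eqv1 p) = - G p := by
      rintro ⟨k, j⟩
      simp only [hG, eqv1, Equiv.coe_fn_mk]
      rw [he, ker_neg, show k - j - -j = k by abel, ker_sub]
      ring
    simp only [h2] at h1
    rw [tsum_neg] at h1
    linarith
  have eF : ∑' k, br k ^ (2 * s) * (c k * nl c k) = ∑' p, F p := by
    rw [sF.tsum_prod]
    congr 1; ext k
    simp only [hF, nl, bil]
    rw [tsum_mul_left, tsum_mul_left]
  have y3 : Summable (fun p : (ℤ × ℤ) × (ℤ × ℤ) => γ p.1 * γ p.2 * |c (p.1 - p.2)|) := by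
    rw [← eqv2.summable_iff]
    refine y1.congr fun p => ?_
    simp [eqv2]; ring
  have y4 : ∑' p : (ℤ × ℤ) × (ℤ × ℤ), γ p.1 * γ p.2 * |c (p.1 - p.2)|
      = ∑' p : (ℤ × ℤ) × (ℤ × ℤ), γ p.1 * |c p.2| * γ (p.1 - p.2) := by
    rw [← eqv2.tsum_eq]
    congr 1; ext p
    simp [eqv2]; ring
  have key : ∀ p, |F p - G p| ≤ s * 2 ^ (s + 1) * (γ p.1 * γ p.2 * |c (p.1 - p.2)| + γ p.1 * |c p.2| * γ (p.1 - p.2)) := by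
    rintro ⟨k, j⟩
    have h1 := br_pow_diff j (k - j) s
    rw [add_sub_cancel, ker_sub] at h1
    simp only [hF, hG]
    have h2 : br k ^ (2 * s) * (c k * (ker j k * c j * c (k - j))) - br k ^ s * br (k - j) ^ s * (c k * (ker j k * c j * c (k - j)))
      = (br k ^ s * c k) * ((br k ^ s - br (k - j) ^ s) * ker j k) * (c j * c (k - j)) := by
      rw [two_mul, pow_add]; ring
    rw [h2, abs_mul, abs_mul, abs_mul (br k ^ s), abs_mul (_ - _), abs_mul (c j), abs_of_pos (pow_pos (br_pos k) s)]
    have h3 := γ0 k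
    calc _ ≤ (br k ^ s * |c k|) * (s * 2 ^ (s + 1) * (br j ^ s + br (k - j) ^ s)) * (|c j| * |c (k - j)|) := by
          gcongr
      _ = _ := by simp only [hγ]; ring
  rw [eF]
  have : ∑' p, F p = ∑' p, (F p - G p) := by rw [sF.tsum_sub sG, G0, sub_zero]
  rw [this]
  have sS := (y3.add y1).mul_left ((s:ℝ) * 2 ^ (s + 1))
  calc |∑' p, (F p - G p)| ≤ ∑' p, |F p - G p| := abs_tsum_le (sF.sub sG).abs
    _ ≤ ∑' p : (ℤ × ℤ) × (ℤ × ℤ), (s:ℝ) * 2 ^ (s + 1) * (γ p.1 * γ p.2 * |c (p.1 - p.2)| + γ p.1 * |c p.2| * γ (p.1 - p.2)) :=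
      Summable.tsum_le_tsum key (sF.sub sG).abs sS
    _ = s * 2 ^ (s + 1) * (2 * ∑' p : (ℤ × ℤ) × (ℤ × ℤ), γ p.1 * |c p.2| * γ (p.1 - p.2)) := by
      rw [tsum_mul_left, y3.tsum_add y1, y4]; ring
    _ ≤ s * 2 ^ (s + 1) * (2 * ((∑' k, |c k|) * ∑' k, γ k ^ 2)) := by gcongr
    _ = _ := by rw [eγ]; ring

end EU

end

section
open Real MeasureTheory Set

namespace EU

lemma const_of_deriv_zero {f : ℝ → ℝ} {a b : ℝ} (h : ∀ t ∈ Icc a b, HasDerivWithinAt f 0 (Icc a b) t) :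
    ∀ t ∈ Icc a b, f t = f a := by
  intro t ht
  rcases eq_or_lt_of_le (ht.1.trans ht.2) with hab | hab
  · have : t = a := le_antisymm (hab ▸ ht.2) ht.1
    rw [this]
  · exact constant_of_derivWithin_zero (fun x hx => (h x hx).differentiableWithinAt)
      (fun x hx => (h x (Ico_subset_Icc_self hx)).derivWithin (uniqueDiffOn_Icc hab x (Ico_subset_Icc_self hx))) t ht

/-- the box -/
noncomputable def Bx (n : ℕ) : Finset (ℤ × ℤ) := Finset.Icc (-(n:ℤ)) n ×ˢ Finset.Icc (-(n:ℤ)) n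

lemma mem_Bx {n : ℕ} {k : ℤ × ℤ} : k ∈ Bx n ↔ (-(n:ℤ) ≤ k.1 ∧ k.1 ≤ n) ∧ (-(n:ℤ) ≤ k.2 ∧ k.2 ≤ n) := by
  simp [Bx]

lemma fl1_mem {n : ℕ} {k : ℤ × ℤ} : fl1 k ∈ Bx n ↔ k ∈ Bx n := by
  simp only [mem_Bx, fl1_apply]; omega
lemma fl2_mem {n : ℕ} {k : ℤ × ℤ} : fl2 k ∈ Bx n ↔ k ∈ Bx n := by
  simp only [mem_Bx, fl2_apply]; omega

/-- truncation -/
noncomputable def tr (n : ℕ) (c : ℤ × ℤ → ℝ) (k : ℤ × ℤ) : ℝ := if k ∈ Bx n then c k else 0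

lemma tr_sym {n : ℕ} {c : ℤ × ℤ → ℝ} (h : Sym c) : Sym (tr n c) := by
  intro k1 k2
  constructor
  · change tr n c (fl1 (k1, k2)) = _
    simp only [tr, fl1_mem, h.f1]; split_ifs <;> simp
  · change tr n c (fl2 (k1, k2)) = _
    simp only [tr, fl2_mem, h.f2]; split_ifs <;> simp

lemma rapid_of_supp {n : ℕ} {c : ℤ × ℤ → ℝ} (h : ∀ k, k ∉ Bx n → c k = 0) : Rapid c := by
  intro s
  refine ⟨∑ k ∈ Bx n, |c k| * br k ^ s, fun k => ?_⟩
  by_cases hk : k ∈ Bx n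
  · exact Finset.single_le_sum (f := fun k => |c k| * br k ^ s)
      (fun i _ => mul_nonneg (abs_nonneg _) (pow_pos (br_pos i) s).le) hk
  · rw [h k hk]; simp
    exact Finset.sum_nonneg fun i _ => mul_nonneg (abs_nonneg _) (pow_pos (br_pos i) s).le

/-- extension by zero -/
noncomputable def ex (n : ℕ) (x : Bx n → ℝ) (k : ℤ × ℤ) : ℝ := if h : k ∈ Bx n then x ⟨k, h⟩ else 0

/-- symmetrization -/
noncomputable def sy (c : ℤ × ℤ → ℝ) (k : ℤ × ℤ) : ℝ := (c k - c (fl1 k) - c (fl2 k) + c (fl1 (fl2 k))) / 4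

lemma fl1_fl1 (k) : fl1 (fl1 k) = k := by simp [fl1_apply]
lemma fl2_fl2 (k) : fl2 (fl2 k) = k := by simp [fl2_apply]
lemma fl1_fl2 (k) : fl2 (fl1 k) = fl1 (fl2 k) := by simp [fl2_apply, fl1_apply]

lemma sy_sym (c) : Sym (sy c) := by
  intro k1 k2
  constructor
  · change sy c (fl1 (k1, k2)) = _
    simp only [sy, fl1_fl1, fl1_fl2]; ring
  · change sy c (fl2 (k1, k2)) = _
    simp only [sy, fl2_fl2, ← fl1_fl2]; ring

lemma sy_of_sym {c} (h : Sym c) : sy c = c := by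
  ext k; simp only [sy, h.f1, h.f2]; ring

lemma sy_supp {n c} (h : ∀ k, k ∉ Bx n → c k = 0) : ∀ k, k ∉ Bx n → sy c k = 0 := by
  intro k hk
  simp only [sy]
  rw [h k hk, h _ (mt fl1_mem.1 hk), h _ (mt fl2_mem.1 hk), h _ (mt fl1_mem.1 (mt fl2_mem.1 hk))]; simp

lemma ex_supp {n} (x : Bx n → ℝ) : ∀ k, k ∉ Bx n → ex n x k = 0 := by
  intro k hk; simp [ex, hk]

lemma ex_contDiff (n k) : ContDiff ℝ 1 (fun x : Bx n → ℝ => ex n x k) := by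
  unfold ex
  split_ifs with h
  · fun_prop
  · fun_prop

lemma sy_ex_contDiff (n k) : ContDiff ℝ 1 (fun x : Bx n → ℝ => sy (ex n x) k) := by
  unfold sy
  have h1 := ex_contDiff n k
  have h2 := ex_contDiff n (fl1 k)
  have h3 := ex_contDiff n (fl2 k)
  have h4 := ex_contDiff n (fl1 (fl2 k))
  fun_prop

lemma nl_of_supp {n c} (h : ∀ k, k ∉ Bx n → c k = 0) (k) : nl c k = ∑ j ∈ Bx n, ker j k * c j * c (k - j) := by
  unfold nl bil
  apply tsum_eq_sum
  intro j hj; rw [h j hj]; simp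

lemma tsum_supp {n} {c g : ℤ × ℤ → ℝ} (h : ∀ k, k ∉ Bx n → c k = 0) :
    ∑' k, c k * g k = ∑ k ∈ Bx n, c k * g k := by
  apply tsum_eq_sum
  intro j hj; rw [h j hj]; simp

lemma galerkin (n : ℕ) {c0 : ℤ × ℤ → ℝ} (h0 : Sym c0) :
    ∃ c : ℝ → ℤ × ℤ → ℝ, c 0 = tr n c0 ∧ ∀ t ∈ Icc (0:ℝ) 1, Sym (c t) ∧ (∀ k, k ∉ Bx n → c t k = 0) ∧
      ∀ k, HasDerivWithinAt (fun u => c u k) (tr n (nl (c t)) k) (Icc 0 1) t := by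
  set v : (Bx n → ℝ) → (Bx n → ℝ) := fun x k => nl (sy (ex n x)) k with hv
  have vC : ContDiff ℝ 1 v := by
    rw [contDiff_pi]
    intro k
    have : (fun x => v x k) = fun x => ∑ j ∈ Bx n, ker j k * sy (ex n x) j * sy (ex n x) (k - j) := by
      ext x; exact nl_of_supp (sy_supp (ex_supp x)) k
    rw [this]
    refine ContDiff.sum fun j _ => ?_
    have h1 := sy_ex_contDiff n j
    have h2 := sy_ex_contDiff n (k - j)
    fun_prop
  set Q : (Bx n → ℝ) → ℝ := fun x => ∑ k, x k ^ 2 with hQ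
  have QC : ContDiff ℝ 1 Q := by fun_prop
  set x0 : Bx n → ℝ := fun k => c0 k with hx0
  have Q0 : 0 ≤ Q x0 := Finset.sum_nonneg fun i _ => sq_nonneg _
  let χ : ContDiffBump (0:ℝ) := ⟨Q x0 + 1, Q x0 + 2, by linarith, by linarith⟩
  set f : (Bx n → ℝ) → (Bx n → ℝ) := fun x => χ (Q x) • v x with hf
  have fC : ContDiff ℝ 1 f := (χ.contDiff.comp QC).smul vC
  have fS : HasCompactSupport f := by
    apply HasCompactSupport.intro (isCompact_closedBall (0 : Bx n → ℝ) (Q x0 + 3))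
    intro x hx
    have : χ (Q x) = 0 := by
      apply χ.zero_of_le_dist
      simp only [mem_closedBall_iff_norm, sub_zero, not_le] at hx
      rw [Real.dist_eq, sub_zero]
      change Q x0 + 2 ≤ _
      by_contra hcon
      push Not at hcon
      have : ‖x‖ ≤ Q x0 + 3 := by
        rw [pi_norm_le_iff_of_nonneg (by linarith)]
        intro k
        have h1 : x k ^ 2 ≤ Q x := Finset.single_le_sum (f := fun k => x k ^ 2) (fun i _ => sq_nonneg _) (Finset.mem_univ k)
        have h2 := le_abs_self (Q x)
        rw [Real.norm_eq_abs]
        apply abs_le_of_sq_le_sq _ (by linarith)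
        nlinarith
      linarith
    simp [hf, this]
  obtain ⟨K, hK⟩ := fC.lipschitzWith_of_hasCompactSupport fS (by norm_num)
  obtain ⟨L, hL⟩ := fS.exists_bound_of_continuous fC.continuous
  have L0 : 0 ≤ L := (norm_nonneg _).trans (hL 0)
  have PL : IsPicardLindelof (fun _ => f) (⟨0, by simp⟩ : Icc (0:ℝ) 1) x0 ⟨L, L0⟩ 0 ⟨L, L0⟩ K :=
    { lipschitzOnWith := fun t _ => hK.lipschitzOnWith
      continuousOn := fun x _ => continuousOn_const
      norm_le := fun t _ x _ => hL x
      mul_max_le := by simp }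
  obtain ⟨α, hα0, hα⟩ := PL.exists_eq_forall_mem_Icc_hasDerivWithinAt₀
  simp only at hα0 hα
  have hαk : ∀ t ∈ Icc (0:ℝ) 1, ∀ k, HasDerivWithinAt (fun u => ex n (α u) k) (χ (Q (α t)) * tr n (nl (sy (ex n (α t)))) k) (Icc 0 1) t := by
    intro t ht k
    have h1 := hasDerivWithinAt_pi.1 (hα t ht)
    by_cases hk : k ∈ Bx n
    · simpa [ex, hk, tr, hf, hv] using h1 ⟨k, hk⟩
    · simpa [ex, hk, tr] using hasDerivWithinAt_const t _ (0:ℝ)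
  have e0 : ex n (α 0) = tr n c0 := by
    ext k; rw [hα0]; simp only [ex, tr, hx0]; split_ifs <;> rfl
  have hsym : ∀ t ∈ Icc (0:ℝ) 1, Sym (ex n (α t)) := by
    have sn : ∀ t, Sym (tr n (nl (sy (ex n (α t))))) := fun t => tr_sym (sy_sym _).nl
    have s0 := tr_sym (n := n) h0
    intro t ht k1 k2
    constructor
    · have := const_of_deriv_zero (f := fun u => ex n (α u) (-k1, k2) + ex n (α u) (k1, k2)) (a := 0) (b := 1)
        (fun u hu => by
          refine ((hαk u hu (-k1, k2)).fun_add (hαk u hu (k1, k2))).congr_deriv ?_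
          rw [(sn u k1 k2).1]; ring) t ht
      simp only [e0, (s0 k1 k2).1] at this
      linarith
    · have := const_of_deriv_zero (f := fun u => ex n (α u) (k1, -k2) + ex n (α u) (k1, k2)) (a := 0) (b := 1)
        (fun u hu => by
          refine ((hαk u hu (k1, -k2)).fun_add (hαk u hu (k1, k2))).congr_deriv ?_
          rw [(sn u k1 k2).2]; ring) t ht
      simp only [e0, (s0 k1 k2).2] at this
      linarith
  have hQx : ∀ x : Bx n → ℝ, Q x = ∑ k ∈ Bx n, ex n x k ^ 2 := by
    intro x
    rw [← Finset.sum_coe_sort]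
    simp [hQ, ex]
  have hQc : ∀ t ∈ Icc (0:ℝ) 1, Q (α t) = Q (α 0) := by
    apply const_of_deriv_zero
    intro t ht
    simp only [hQx]
    have h1 : HasDerivWithinAt (fun u => ∑ k ∈ Bx n, ex n (α u) k ^ 2)
      (∑ k ∈ Bx n, 2 * ex n (α t) k * (χ (Q (α t)) * tr n (nl (sy (ex n (α t)))) k)) (Icc 0 1) t := by
      refine HasDerivWithinAt.fun_sum fun k _ => ?_
      simpa using (hαk t ht k).fun_pow 2
    refine h1.congr_deriv (Eq.symm ?_)
    rw [sy_of_sym (hsym t ht)]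
    have h2 := energy (rapid_of_supp (ex_supp (α t))) (hsym t ht).even 0
    simp only [mul_zero, pow_zero, one_mul, CharP.cast_eq_zero, zero_mul] at h2
    rw [tsum_supp (ex_supp (α t))] at h2
    have h3 := abs_eq_zero.1 (le_antisymm h2 (abs_nonneg _))
    calc (0:ℝ) = 2 * χ (Q (α t)) * ∑ k ∈ Bx n, ex n (α t) k * nl (ex n (α t)) k := by rw [h3]; simp
      _ = _ := by
        rw [Finset.mul_sum]
        refine Finset.sum_congr rfl fun k hk => ?_
        simp only [tr, hk, if_true]; ring
  refine ⟨fun t => ex n (α t), e0, fun t ht => ⟨hsym t ht, ex_supp _, fun k => ?_⟩⟩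
  have h1 := hαk t ht k
  rw [sy_of_sym (hsym t ht), hQc t ht, hα0, χ.one_of_mem_closedBall, one_mul] at h1
  · exact h1
  · rw [mem_closedBall_iff_norm, sub_zero, Real.norm_eq_abs, abs_of_nonneg Q0]
    change Q x0 ≤ Q x0 + 1
    linarith

end EU

end

section
open Real MeasureTheory Set Filter Topology

namespace EU

lemma mono_Icc {f f' : ℝ → ℝ} {a b : ℝ} (hc : ContinuousOn f (Icc a b))
    (hd : ∀ t ∈ Ioo a b, HasDerivAt f (f' t) t) (h0 : ∀ t ∈ Ioo a b, 0 ≤ f' t) : MonotoneOn f (Icc a b) := by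
  refine monotoneOn_of_deriv_nonneg (convex_Icc a b) hc ?_ ?_ <;> rw [interior_Icc]
  · exact fun t ht => (hd t ht).differentiableAt.differentiableWithinAt
  · intro t ht; rw [(hd t ht).deriv]; exact h0 t ht

lemma gronw {f f' : ℝ → ℝ} {b K : ℝ} (hc : ContinuousOn f (Icc 0 b))
    (hd : ∀ t ∈ Ioo 0 b, HasDerivAt f (f' t) t) (h0 : ∀ t ∈ Ioo 0 b, f' t ≤ K * f t) :
    ∀ t ∈ Icc 0 b, f t ≤ f 0 * exp (K * t) := by
  intro t ht
  have h1 := mono_Icc (f := fun t => - (f t * exp (-(K * t)))) (f' := fun t => - (f' t * exp (-(K * t)) + f t * (exp (-(K * t)) * (-(K * 1)))))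
    (a := 0) (b := b) (by fun_prop) (fun t ht => by
      have h2 : HasDerivAt (fun t => exp (-(K * t))) (exp (-(K * t)) * (-(K * 1))) t :=
        (((hasDerivAt_id t).const_mul K).neg).exp
      exact ((hd t ht).mul h2).neg) (fun t ht => by
      have := h0 t ht
      have h3 := exp_pos (-(K * t))
      nlinarith [mul_nonneg h3.le (sub_nonneg.2 this)])
  have h4 := h1 (left_mem_Icc.2 (ht.1.trans ht.2)) ht ht.1
  simp only [mul_zero, neg_zero, exp_zero, mul_one, neg_le_neg_iff] at h4
  rw [exp_neg, ← div_eq_mul_inv, div_le_iff₀ (exp_pos _)] at h4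
  exact h4

lemma cs {ι : Type*} {f g : ι → ℝ} (hf : Summable fun i => f i ^ 2) (hg : Summable fun i => g i ^ 2) :
    Summable (fun i => f i * g i) ∧ (∑' i, f i * g i) ^ 2 ≤ (∑' i, f i ^ 2) * ∑' i, g i ^ 2 := by
  have hs : Summable fun i => f i * g i := by
    refine Summable.of_norm_bounded (hf.add hg) fun i => ?_
    rw [Real.norm_eq_abs, abs_le]
    constructor <;> nlinarith [sq_nonneg (f i - g i), sq_nonneg (f i + g i), sq_nonneg (f i), sq_nonneg (g i)]
  refine ⟨hs, ?_⟩
  refine le_of_tendsto_of_tendsto (hs.hasSum.pow 2) (Tendsto.mul hf.hasSum hg.hasSum) ?_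
  exact Eventually.of_forall fun s => Finset.sum_mul_sq_le_sq_mul_sq s f g

lemma En_nonneg (s c) : 0 ≤ En s c := tsum_nonneg fun k => by have := br_pos k; positivity

lemma En_ge {s : ℕ} {c} (hc : Rapid c) (k) : (|c k| * br k ^ s) ^ 2 ≤ En s c := by
  have := (hc.sq_summable (2 * s)).le_tsum k (fun k _ => by have := br_pos k; positivity)
  refine le_trans (le_of_eq ?_) this
  rw [mul_pow, sq_abs]; ring

lemma N1_le {c} (hc : Rapid c) : (∑' k, |c k|) ^ 2 ≤ S4 * En 2 c := by
  have h1 : Summable fun k : ℤ × ℤ => ((br k ^ 2)⁻¹) ^ 2 := summable_br4.congr fun k => by rw [inv_pow, ← pow_mul]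
  have h2 : Summable fun k : ℤ × ℤ => (br k ^ 2 * |c k|) ^ 2 := (hc.sq_summable 4).congr fun k => by
    rw [mul_pow, sq_abs]; ring
  obtain ⟨h3, h4⟩ := cs h1 h2
  convert h4 using 2
  · congr 1; ext k; rw [inv_mul_cancel_left₀ (pow_pos (br_pos k) _).ne']
  · unfold S4; congr 1; ext k;  rw [inv_pow, ← pow_mul]
  · unfold En; congr 1; ext k; rw [mul_pow, sq_abs]; ring

lemma blow {E E' : ℝ → ℝ} {b C R : ℝ} (hC : 0 ≤ C) (hb : C * √(R + 1) * b ≤ 1) (h0 : E 0 ≤ R) (hE : ∀ t ∈ Icc 0 b, 0 ≤ E t)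
    (hc : ContinuousOn E (Icc 0 b)) (hd : ∀ t ∈ Ioo 0 b, HasDerivAt E (E' t) t)
    (hbd : ∀ t ∈ Ioo 0 b, E' t ≤ C * √(E t) * E t) : ∀ t ∈ Icc 0 b, E t ≤ 4 * (R + 1) := by
  intro t ht
  have hb0 : (0:ℝ) ≤ b := ht.1.trans ht.2
  have hE0 := hE 0 (left_mem_Icc.2 hb0)
  have h1 := mono_Icc (f := fun t => (√(E t + 1))⁻¹ + C / 2 * t) (a := 0) (b := b)
    (f' := fun t => - (E' t / (2 * √(E t + 1))) / (√(E t + 1)) ^ 2 + C / 2 * 1)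
    (by
      refine ContinuousOn.add (ContinuousOn.inv₀ (by fun_prop) fun t ht => ?_) (by fun_prop)
      have := hE t ht; positivity)
    (fun t ht => by
      have h2 := hE t (Ioo_subset_Icc_self ht)
      have h3 : √(E t + 1) ≠ 0 := by positivity
      refine HasDerivAt.add ?_ ((hasDerivAt_id t).const_mul _)
      exact (((hd t ht).add_const 1).sqrt (by positivity)).inv h3)
    (fun t ht => by
      have h2 := hE t (Ioo_subset_Icc_self ht)
      have h4 := hbd t ht
      have h3 : 0 < √(E t + 1) := by positivity
      have h5 : √(E t) ≤ √(E t + 1) := Real.sqrt_le_sqrt (by linarith)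
      have h6 : √(E t + 1) ^ 2 = E t + 1 := Real.sq_sqrt (by linarith)
      have h7 : E' t ≤ C * √(E t + 1) * (√(E t + 1)) ^ 2 := by
        refine h4.trans ?_
        gcongr; linarith
      have h8 : E' t / (2 * √(E t + 1)) / √(E t + 1) ^ 2 ≤ C / 2 := by
        rw [div_div, div_le_iff₀ (by positivity)]
        linarith
      rw [neg_div]; linarith)
  have h2 := h1 (left_mem_Icc.2 hb0) ht ht.1
  simp only [mul_zero, add_zero] at h2
  have h3 : (√(R + 1))⁻¹ ≤ (√(E 0 + 1))⁻¹ := inv_anti₀ (by positivity) (Real.sqrt_le_sqrt (by linarith))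
  have hR : 0 < √(R + 1) := Real.sqrt_pos.2 (by linarith)
  have h4 : C / 2 * t ≤ (√(R + 1))⁻¹ / 2 := by
    have : C * b ≤ (√(R + 1))⁻¹ := by
      rw [← one_div, le_div_iff₀ hR]; linarith
    nlinarith [ht.2]
  have h5 : (√(R + 1))⁻¹ / 2 ≤ (√(E t + 1))⁻¹ := by linarith
  have hEt := hE t ht
  have h6 : √(E t + 1) ≤ 2 * √(R + 1) := by
    have := inv_anti₀ (by positivity) h5
    rw [inv_inv] at this
    refine this.trans (le_of_eq ?_)
    field_simp
  have h7 := pow_le_pow_left₀ (by positivity) h6 2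
  rw [mul_pow, Real.sq_sqrt (by linarith), Real.sq_sqrt (by linarith)] at h7
  linarith

/-- uniform rapid decay on a set of times -/
def UB (I : Set ℝ) (d : ℝ → ℤ × ℤ → ℝ) : Prop := ∀ s : ℕ, ∃ A : ℝ, ∀ t ∈ I, ∀ k, |d t k| * br k ^ s ≤ A

/-- solutions on `[0,b]` in Fourier space -/
structure Sol (b : ℝ) (c : ℝ → ℤ × ℤ → ℝ) : Prop where
  sym : ∀ t ∈ Icc 0 b, Sym (c t)
  ub : UB (Icc 0 b) c
  der : ∀ t ∈ Icc 0 b, ∀ k, HasDerivWithinAt (fun u => c u k) (nl (c t) k) (Icc 0 b) t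

lemma UB.rapid {I d} (h : UB I d) {t} (ht : t ∈ I) : Rapid (d t) := fun s => by
  obtain ⟨A, hA⟩ := h s; exact ⟨A, hA t ht⟩

lemma UB.mono {I J d} (h : UB I d) (hJ : J ⊆ I) : UB J d := fun s => by
  obtain ⟨A, hA⟩ := h s; exact ⟨A, fun t ht => hA t (hJ ht)⟩

lemma UB.bil {I c d} (hc : UB I c) (hd : UB I d) : UB I (fun t => bil (c t) (d t)) := fun s => by
  obtain ⟨A, hA⟩ := hc (s + 4)
  obtain ⟨B, hB⟩ := hd (s + 1)
  exact ⟨_, fun t ht => bil_bd (hA t ht) (hB t ht)⟩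

lemma UB.pos {I d} (h : UB I d) (s : ℕ) : ∃ A : ℝ, 0 ≤ A ∧ ∀ t ∈ I, ∀ k, |d t k| * br k ^ s ≤ A := by
  obtain ⟨A, hA⟩ := h s
  exact ⟨max A 0, le_max_right _ _, fun t ht k => (hA t ht k).trans (le_max_left _ _)⟩

lemma ulim {u : ℕ → ℝ} {A : ℝ} (h : ∀ n, |u n| ≤ A) : ∃ x, Tendsto u (hyperfilter ℕ : Filter ℕ) (𝓝 x) := by
  have hc : IsCompact (Icc (-A) A) := isCompact_Icc
  have := hc.ultrafilter_le_nhds ((hyperfilter ℕ).map u) (by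
    rw [le_principal_iff]
    exact Filter.mem_map.2 (Filter.Eventually.of_forall fun n => abs_le.1 (h n)))
  obtain ⟨x, -, hx⟩ := this
  exact ⟨x, hx⟩

lemma bil_sub {c d : ℤ × ℤ → ℝ} (hc : Rapid c) (hd : Rapid d) (k) :
    nl c k - nl d k = bil (fun j => c j - d j) c k + bil d (fun j => c j - d j) k := by
  have hm : Rapid fun k => -1 * d k := hd.mul_bd (d := fun _ => -1) (A := 1) (by simp)
  have hcd : Rapid fun j => c j - d j := by
    simpa [sub_eq_add_neg] using hc.add hm
  unfold nl bil
  rw [← (hc.bil_summable hc k).tsum_sub (hd.bil_summable hd k), ← (hcd.bil_summable hc k).tsum_add (hd.bil_summable hcd k)]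
  congr 1; ext j; ring

lemma taylor2 {f v : ℝ → ℝ} {I : Set ℝ} (hI : Convex ℝ I) {A : ℝ} (hf : ∀ t ∈ I, HasDerivWithinAt f (v t) I t)
    (hv : ∀ s ∈ I, ∀ t ∈ I, |v t - v s| ≤ A * |t - s|) {s t : ℝ} (hs : s ∈ I) (ht : t ∈ I) :
    |f t - f s - (t - s) * v s| ≤ A * |t - s| ^ 2 := by
  rcases eq_or_ne t s with rfl | hts
  · simp
  have hA : 0 ≤ A := by
    have := (abs_nonneg _).trans (hv s hs t ht)
    exact nonneg_of_mul_nonneg_left this (abs_pos.2 (sub_ne_zero.2 hts))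
  have hsub : uIcc s t ⊆ I := by rw [← segment_eq_uIcc]; exact hI.segment_subset hs ht
  have h1 := (convex_uIcc s t).norm_image_sub_le_of_norm_hasDerivWithin_le
    (f := fun u => f u - u * v s) (f' := fun u => v u - 1 * v s) (C := A * |t - s|) (x := s) (y := t)
    (fun u hu => ((hf u (hsub hu)).mono hsub).fun_sub ((hasDerivWithinAt_id u _).mul_const (v s)))
    (fun u hu => by
      rw [one_mul, Real.norm_eq_abs]
      refine (hv s hs u (hsub hu)).trans ?_
      exact mul_le_mul_of_nonneg_left (abs_sub_left_of_mem_uIcc hu) hA) left_mem_uIcc right_mem_uIcc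
  simp only [Real.norm_eq_abs] at h1
  calc _ = |f t - t * v s - (f s - s * v s)| := by congr 1; ring
    _ ≤ _ := h1
    _ = _ := by ring

lemma hasDerivWithin_of_taylor {f : ℝ → ℝ} {I : Set ℝ} {A v s : ℝ}
    (h : ∀ t ∈ I, |f t - f s - (t - s) * v| ≤ A * |t - s| ^ 2) : HasDerivWithinAt f v I s := by
  rw [hasDerivWithinAt_iff_isLittleO]
  have h1 : (fun t => f t - f s - (t - s) • v) =O[𝓝[I] s] fun t => |t - s| ^ 2 := by
    apply Asymptotics.IsBigO.of_bound A
    filter_upwards [self_mem_nhdsWithin] with t ht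
    have := h t ht
    simpa using this
  refine h1.trans_isLittleO ?_
  have h2 : (fun t => |t - s| ^ 2) = fun t => (t - s) * (t - s) := by ext t; rw [sq_abs]; ring
  rw [h2]
  have h3 : (fun t => t - s) =o[𝓝[I] s] (fun _ => (1:ℝ)) := by
    rw [Asymptotics.isLittleO_one_iff]
    apply tendsto_nhdsWithin_of_tendsto_nhds
    have : Continuous fun t => t - s := by fun_prop
    simpa using this.tendsto s
  simpa using h3.mul_isBigO (Asymptotics.isBigO_refl (fun t => t - s) _)

end EU

end

section
open Real MeasureTheory Set Filter Topology

namespace EU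

/-- The constant in the blow-up time. -/
noncomputable def CE : ℝ := 64 * √S4

lemma En_supp {n s} {c : ℤ × ℤ → ℝ} (h : ∀ k, k ∉ Bx n → c k = 0) : En s c = ∑ k ∈ Bx n, br k ^ (2 * s) * c k ^ 2 := by
  unfold En
  apply tsum_eq_sum
  intro j hj; rw [h j hj]; simp

lemma En_tr {n s} {c : ℤ × ℤ → ℝ} (hc : Rapid c) : En s (tr n c) ≤ En s c := by
  have h : ∀ k, k ∉ Bx n → tr n c k = 0 := fun k hk => by simp [tr, hk]
  refine Summable.tsum_le_tsum (fun k => ?_) ((rapid_of_supp h).sq_summable _) (hc.sq_summable _)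
  have := br_pos k
  unfold tr
  split_ifs <;> [rfl; (simp; positivity)]

lemma N1_sqrt {c} (hc : Rapid c) : ∑' k, |c k| ≤ √S4 * √(En 2 c) := by
  rw [← Real.sqrt_mul S4_nonneg]
  exact Real.le_sqrt_of_sq_le (N1_le hc)

lemma galerkin_bounds {n : ℕ} {c : ℝ → ℤ × ℤ → ℝ} {b R : ℝ} (hb1 : b ≤ 1)
    (hb : CE * √(R + 1) * b ≤ 1)
    (h : ∀ t ∈ Icc (0:ℝ) 1, Sym (c t) ∧ (∀ k, k ∉ Bx n → c t k = 0) ∧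
      ∀ k, HasDerivWithinAt (fun u => c u k) (tr n (nl (c t)) k) (Icc 0 1) t) (h0 : En 2 (c 0) ≤ R) (s : ℕ) :
    ∀ t ∈ Icc (0:ℝ) b, En s (c t) ≤ En s (c 0) * exp (s * 2 ^ (s + 3) * (√S4 * √(4 * (R + 1))) * t) := by
  have hI : Icc (0:ℝ) b ⊆ Icc 0 1 := Icc_subset_Icc_right hb1
  have hrap : ∀ t ∈ Icc (0:ℝ) b, Rapid (c t) := fun t ht => rapid_of_supp (h t (hI ht)).2.1
  have der : ∀ s : ℕ, ∀ t ∈ Icc (0:ℝ) b, HasDerivWithinAt (fun u => En s (c u)) (2 * ∑' k, br k ^ (2 * s) * (c t k * nl (c t) k)) (Icc 0 b) t := by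
    intro s t ht
    have h1 : HasDerivWithinAt (fun u => ∑ k ∈ Bx n, br k ^ (2 * s) * c u k ^ 2)
      (∑ k ∈ Bx n, br k ^ (2 * s) * (2 * c t k * tr n (nl (c t)) k)) (Icc 0 b) t := by
      refine HasDerivWithinAt.fun_sum fun k _ => HasDerivWithinAt.const_mul _ ?_
      simpa using (((h t (hI ht)).2.2 k).mono hI).fun_pow 2
    refine (h1.congr (fun u hu => En_supp (h u (hI hu)).2.1) (En_supp (h t (hI ht)).2.1)).congr_deriv ?_
    have h2 := tsum_supp (g := fun k => br k ^ (2 * s) * nl (c t) k) (h t (hI ht)).2.1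
    calc _ = 2 * ∑ k ∈ Bx n, c t k * (br k ^ (2 * s) * nl (c t) k) := by
          rw [Finset.mul_sum]
          refine Finset.sum_congr rfl fun k hk => ?_
          simp only [tr, hk, if_true]; ring
      _ = _ := by rw [← h2]; congr 2; ext k; ring
  have bd : ∀ s : ℕ, ∀ t ∈ Icc (0:ℝ) b, 2 * ∑' k, br k ^ (2 * s) * (c t k * nl (c t) k) ≤ s * 2 ^ (s + 3) * (√S4 * √(En 2 (c t))) * En s (c t) := by
    intro s t ht
    have h1 := energy (hrap t ht) (h t (hI ht)).1.even s
    have h2 := N1_sqrt (hrap t ht)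
    have h3 := En_nonneg s (c t)
    calc _ ≤ 2 * (s * 2 ^ (s + 2) * (∑' k, |c t k|) * En s (c t)) := by
          linarith [le_abs_self (∑' k, br k ^ (2 * s) * (c t k * nl (c t) k))]
      _ ≤ 2 * (s * 2 ^ (s + 2) * (√S4 * √(En 2 (c t))) * En s (c t)) := by gcongr
      _ = _ := by ring
  have hder : ∀ s : ℕ, ∀ t ∈ Ioo (0:ℝ) b, HasDerivAt (fun u => En s (c u)) (2 * ∑' k, br k ^ (2 * s) * (c t k * nl (c t) k)) t :=
    fun s t ht => (der s t (Ioo_subset_Icc_self ht)).hasDerivAt (Icc_mem_nhds ht.1 ht.2)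
  have hcont : ∀ s : ℕ, ContinuousOn (fun u => En s (c u)) (Icc 0 b) := fun s t ht => (der s t ht).continuousWithinAt
  have hE2 : ∀ t ∈ Icc (0:ℝ) b, En 2 (c t) ≤ 4 * (R + 1) := by
    refine blow (E := fun u => En 2 (c u)) (C := CE) (by unfold CE; positivity) hb h0 (fun t _ => En_nonneg _ _) (hcont 2) (hder 2) fun t ht => ?_
    have := bd 2 t (Ioo_subset_Icc_self ht)
    refine this.trans (le_of_eq ?_)
    unfold CE; push_cast; ring
  refine gronw (hcont s) (hder s) fun t ht => (bd s t (Ioo_subset_Icc_self ht)).trans ?_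
  have h3 := En_nonneg s (c t)
  have := hE2 t (Ioo_subset_Icc_self ht)
  gcongr

lemma tendsto_nl {ι : Type*} {F : Filter ι} {c : ι → ℤ × ℤ → ℝ} {d : ℤ × ℤ → ℝ}
    (hb : ∀ s : ℕ, ∃ A : ℝ, ∀ n k, |c n k| * br k ^ s ≤ A) (hl : ∀ k, Tendsto (fun n => c n k) F (𝓝 (d k))) (k) :
    Tendsto (fun n => nl (c n) k) F (𝓝 (nl d k)) := by
  obtain ⟨A, hA⟩ := hb 4
  obtain ⟨B, hB⟩ := hb 1
  unfold nl bil
  refine tendsto_tsum_of_dominated_convergence (summable_br4.mul_left (2 * A * B)) (fun j => ?_) (Eventually.of_forall fun n j => ?_)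
  · exact ((hl j).const_mul _).mul (hl (k - j))
  · have := bil_sum (s := 0) (by simpa using hA n) (by simpa using hB n) k j
    simpa using this

lemma local_exist (R : ℝ) (hR : 0 ≤ R) : ∃ τ > 0, ∀ c0 : ℤ × ℤ → ℝ, Sym c0 → Rapid c0 → En 2 c0 ≤ R →
    ∃ c, Sol τ c ∧ c 0 = c0 := by
  have hCE : 0 ≤ CE := by unfold CE; positivity
  refine ⟨1 / (CE * √(R + 1) + 1), by positivity, fun c0 hs hr hE => ?_⟩
  set b := 1 / (CE * √(R + 1) + 1) with hbdef
  have hb0 : 0 < b := by positivity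
  have hb1 : b ≤ 1 := by
    rw [hbdef, div_le_one (by positivity)]
    have : 0 ≤ CE * √(R + 1) := by positivity
    linarith
  have hb : CE * √(R + 1) * b ≤ 1 := by
    rw [hbdef, mul_one_div, div_le_one (by positivity)]; linarith
  have hI : Icc (0:ℝ) b ⊆ Icc 0 1 := Icc_subset_Icc_right hb1
  choose c hc0 hc using fun n => galerkin n hs
  -- uniform bounds
  have ub : ∀ s : ℕ, ∃ A : ℝ, 0 ≤ A ∧ ∀ n, ∀ t ∈ Icc 0 b, ∀ k, |c n t k| * br k ^ s ≤ A := by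
    intro s
    refine ⟨√(En s c0 * exp (s * 2 ^ (s + 3) * (√S4 * √(4 * (R + 1))) * b)), Real.sqrt_nonneg _, fun n t ht k => ?_⟩
    apply Real.le_sqrt_of_sq_le
    refine (En_ge (rapid_of_supp (hc n t (hI ht)).2.1) k).trans ?_
    have h1 := galerkin_bounds hb1 hb (hc n) (by rw [hc0]; exact (En_tr hr).trans hE) s t ht
    refine h1.trans ?_
    have h2 := En_tr (n := n) (s := s) hr
    rw [hc0]
    have h3 := En_nonneg s c0
    have h4 := ht.2
    have h5 := ht.1
    gcongr
  have hrap : ∀ n, ∀ t ∈ Icc 0 b, Rapid (c n t) := fun n t ht => rapid_of_supp (hc n t (hI ht)).2.1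
  set v : ℕ → ℝ → ℤ × ℤ → ℝ := fun n t => tr n (nl (c n t)) with hv
  have vb : ∀ s : ℕ, ∃ A : ℝ, 0 ≤ A ∧ ∀ n, ∀ t ∈ Icc 0 b, ∀ k, |v n t k| * br k ^ s ≤ A := by
    intro s
    obtain ⟨A, hA0, hA⟩ := ub (s + 4)
    obtain ⟨B, hB0, hB⟩ := ub (s + 1)
    refine ⟨2 * A * B * S4, by have := S4_nonneg; positivity, fun n t ht k => ?_⟩
    have := bil_bd (hA n t ht) (hB n t ht) k
    simp only [hv, tr]
    split_ifs
    · exact this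
    · have := S4_nonneg; simp; positivity
  have der : ∀ n k, ∀ t ∈ Icc 0 b, HasDerivWithinAt (fun u => c n u k) (v n t k) (Icc 0 b) t :=
    fun n k t ht => ((hc n t (hI ht)).2.2 k).mono hI
  have lip : ∀ s : ℕ, ∃ A : ℝ, 0 ≤ A ∧ ∀ n, ∀ t ∈ Icc 0 b, ∀ u ∈ Icc 0 b, ∀ k, |c n t k - c n u k| * br k ^ s ≤ A * |t - u| := by
    intro s
    obtain ⟨A, hA0, hA⟩ := vb s
    refine ⟨A, hA0, fun n t ht u hu k => ?_⟩
    have hp := pow_pos (br_pos k) s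
    have h1 := (convex_Icc (0:ℝ) b).norm_image_sub_le_of_norm_hasDerivWithin_le (f := fun u => c n u k)
      (C := A / br k ^ s) (der n k) (fun x hx => by
        rw [le_div_iff₀ hp]; exact hA n x hx k) hu ht
    simp only [Real.norm_eq_abs] at h1
    calc _ ≤ A / br k ^ s * |t - u| * br k ^ s := by gcongr
      _ = _ := by field_simp
  have vlip : ∃ A : ℝ, 0 ≤ A ∧ ∀ n k, ∀ u ∈ Icc 0 b, ∀ t ∈ Icc 0 b, |v n t k - v n u k| ≤ A * |t - u| := by
    obtain ⟨A, hA0, hA⟩ := ub 4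
    obtain ⟨B, hB0, hB⟩ := ub 1
    obtain ⟨A', hA'0, hA'⟩ := lip 4
    obtain ⟨B', hB'0, hB'⟩ := lip 1
    have hS := S4_nonneg
    refine ⟨2 * A' * B * S4 + 2 * A * B' * S4, by positivity, fun n k u hu t ht => ?_⟩
    simp only [hv, tr]
    split_ifs
    · rw [bil_sub (hrap n t ht) (hrap n u hu)]
      have h1 := bil_bd (s := 0) (c := fun j => c n t j - c n u j) (d := c n t) (hA' n t ht u hu) (hB n t ht) k
      have h2 := bil_bd (s := 0) (d := fun j => c n t j - c n u j) (c := c n u) (hA n u hu) (hB' n t ht u hu) k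
      simp only [pow_zero, mul_one] at h1 h2
      refine (abs_add_le _ _).trans ?_
      linarith
    · simp; positivity
  obtain ⟨K, hK0, hK⟩ := vlip
  have tay : ∀ n k, ∀ u ∈ Icc 0 b, ∀ t ∈ Icc 0 b, |c n t k - c n u k - (t - u) * v n u k| ≤ K * |t - u| ^ 2 := by
    intro n k u hu t ht
    exact taylor2 (f := fun u => c n u k) (v := fun u => v n u k) (convex_Icc 0 b) (der n k) (hK n k) hu ht
  -- the limit
  have lim : ∀ t k, ∃ x, t ∈ Icc 0 b → Tendsto (fun n => c n t k) (hyperfilter ℕ : Filter ℕ) (𝓝 x) := by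
    intro t k
    by_cases ht : t ∈ Icc 0 b
    · obtain ⟨A, hA0, hA⟩ := ub 0
      obtain ⟨x, hx⟩ := ulim (u := fun n => c n t k) (A := A) fun n => by simpa using hA n t ht k
      exact ⟨x, fun _ => hx⟩
    · exact ⟨0, fun h => absurd h ht⟩
  choose d hd using lim
  have evB : ∀ k, ∀ᶠ n in (hyperfilter ℕ : Filter ℕ), k ∈ Bx n := by
    intro k
    have h1 : ∀ᶠ n : ℕ in atTop, k ∈ Bx n := by
      filter_upwards [eventually_ge_atTop (k.1.natAbs + k.2.natAbs)] with n hn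
      rw [mem_Bx]; omega
    rw [← Nat.cofinite_eq_atTop] at h1
    exact hyperfilter_le_cofinite h1
  have vlim : ∀ t ∈ Icc 0 b, ∀ k, Tendsto (fun n => v n t k) (hyperfilter ℕ : Filter ℕ) (𝓝 (nl (d t) k)) := by
    intro t ht k
    have h1 := tendsto_nl (c := fun n => c n t) (fun s => by
      obtain ⟨A, _, hA⟩ := ub s
      exact ⟨A, fun n => hA n t ht⟩) (fun k => hd t k ht) k
    refine h1.congr' ?_
    filter_upwards [evB k] with n hn
    simp [hv, tr, hn]
  refine ⟨d, ⟨?_, ?_, ?_⟩, ?_⟩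
  · intro t ht k1 k2
    constructor
    · refine tendsto_nhds_unique (hd t (-k1, k2) ht) ?_
      refine (hd t (k1, k2) ht).neg.congr fun n => ?_
      exact ((hc n t (hI ht)).1 k1 k2).1.symm
    · refine tendsto_nhds_unique (hd t (k1, -k2) ht) ?_
      refine (hd t (k1, k2) ht).neg.congr fun n => ?_
      exact ((hc n t (hI ht)).1 k1 k2).2.symm
  · intro s
    obtain ⟨A, _, hA⟩ := ub s
    exact ⟨A, fun t ht k => le_of_tendsto ((hd t k ht).abs.mul_const _) (Eventually.of_forall fun n => hA n t ht k)⟩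
  · intro t ht k
    refine hasDerivWithin_of_taylor (A := K) fun u hu => ?_
    exact le_of_tendsto ((((hd u k hu).sub (hd t k ht)).sub ((vlim t ht k).const_mul (u - t))).abs)
      (Eventually.of_forall fun n => tay n k t ht u hu)
  · ext k
    have h00 : (0:ℝ) ∈ Icc 0 b := ⟨le_rfl, hb0.le⟩
    refine tendsto_nhds_unique (hd 0 k h00) ?_
    refine tendsto_const_nhds.congr' ?_
    filter_upwards [evB k] with n hn
    rw [hc0]; simp [tr, hn]

lemma Sol.mono {a b c} (h : Sol b c) (hab : a ≤ b) : Sol a c := by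
  have hI : Icc (0:ℝ) a ⊆ Icc 0 b := Icc_subset_Icc_right hab
  exact ⟨fun t ht => h.sym t (hI ht), h.ub.mono hI, fun t ht k => (h.der t (hI ht) k).mono hI⟩

lemma Sol.glue {a b : ℝ} {c d} (ha : 0 ≤ a) (hb : 0 ≤ b) (hc : Sol a c) (hd : Sol b d) (h0 : d 0 = c a) :
    Sol (a + b) (fun t => if t ≤ a then c t else d (t - a)) := by
  set e : ℝ → ℤ × ℤ → ℝ := fun t => if t ≤ a then c t else d (t - a) with he
  have e1 : ∀ t, t ≤ a → e t = c t := fun t ht => by simp [he, ht]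
  have e2 : ∀ t, a ≤ t → e t = d (t - a) := fun t ht => by
    rcases eq_or_lt_of_le ht with rfl | h
    · simp [he, h0]
    · simp [he, not_le.2 h]
  have cov : ∀ t ∈ Icc 0 (a + b), (t ∈ Icc 0 a) ∨ (a ≤ t ∧ t - a ∈ Icc 0 b) := fun t ht => by
    rcases le_total t a with h | h
    · exact Or.inl ⟨ht.1, h⟩
    · exact Or.inr ⟨h, by linarith, by linarith [ht.2]⟩
  refine ⟨fun t ht => ?_, fun s => ?_, fun t ht k => ?_⟩
  · rcases cov t ht with h | ⟨h, h'⟩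
    · rw [e1 t h.2]; exact hc.sym t h
    · rw [e2 t h]; exact hd.sym _ h'
  · obtain ⟨A, hA⟩ := hc.ub s
    obtain ⟨B, hB⟩ := hd.ub s
    refine ⟨max A B, fun t ht k => ?_⟩
    rcases cov t ht with h | ⟨h, h'⟩
    · rw [e1 t h.2]; exact (hA t h k).trans (le_max_left _ _)
    · rw [e2 t h]; exact (hB _ h' k).trans (le_max_right _ _)
  · have hun : Icc 0 (a + b) = Icc 0 a ∪ Icc a (a + b) := (Icc_union_Icc_eq_Icc ha (by linarith)).symm
    rw [hun]
    apply HasDerivWithinAt.union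
    · by_cases h : t ≤ a
      · have h1 := hc.der t ⟨ht.1, h⟩ k
        rw [e1 t h]
        exact h1.congr (fun u hu => by rw [e1 u hu.2]) (by rw [e1 t h])
      · refine HasFDerivWithinAt.of_notMem_closure ?_
        rw [closure_Icc]; exact fun h' => h h'.2
    · by_cases h : a ≤ t
      · have h1 := hd.der (t - a) ⟨by linarith, by linarith [ht.2]⟩ k
        rw [e2 t h]
        have h2 : HasDerivWithinAt (fun u => d (u - a) k) (nl (d (t - a)) k * 1) (Icc a (a + b)) t := by
          refine HasDerivWithinAt.comp t h1 ((hasDerivWithinAt_id t _).sub_const a) ?_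
          intro u hu
          exact ⟨by simp; linarith [hu.1], by simp; linarith [hu.2]⟩
        rw [mul_one] at h2
        exact h2.congr (fun u hu => by rw [e2 u hu.1]) (by rw [e2 t h])
      · refine HasFDerivWithinAt.of_notMem_closure ?_
        rw [closure_Icc]; exact fun h' => h h'.1

end EU

end

section
open Real MeasureTheory Set Filter Topology

namespace EU

/-- Fourier (cosine) series with a phase -/
noncomputable def Fs (φ : ℝ) (d : ℤ × ℤ → ℝ) (x y : ℝ) : ℝ := ∑' k : ℤ × ℤ, d k * cos (k.1 * x + k.2 * y + φ)

lemma Rapid.k1 {d} (h : Rapid d) : Rapid fun k => (k.1 : ℝ) * d k :=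
  h.mul_wt (C := 1) (m := 1) fun k => by
    unfold br; simp only [pow_one, one_mul]; linarith [abs_nonneg (k.1:ℝ), abs_nonneg (k.2:ℝ)]

lemma Rapid.k2 {d} (h : Rapid d) : Rapid fun k => (k.2 : ℝ) * d k :=
  h.mul_wt (C := 1) (m := 1) fun k => by
    unfold br; simp only [pow_one, one_mul]; linarith [abs_nonneg (k.1:ℝ), abs_nonneg (k.2:ℝ)]

lemma nsq_inv_le (k) : |(nsq k)⁻¹| ≤ 1 := by
  by_cases hk : k = 0
  · subst hk; simp [nsq]
  · have := nsq_one hk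
    rw [abs_of_nonneg (by positivity)]
    exact inv_le_one_of_one_le₀ this

lemma Rapid.psi {d} (h : Rapid d) : Rapid fun k => -(nsq k)⁻¹ * d k :=
  h.mul_bd (A := 1) fun k => by rw [abs_neg]; exact nsq_inv_le k

lemma Rapid.Fs_summable {d} (h : Rapid d) (φ x y : ℝ) :
    Summable fun k : ℤ × ℤ => d k * cos (k.1 * x + k.2 * y + φ) := by
  refine Summable.of_norm_bounded h.abs.summable fun k => ?_
  rw [norm_mul]
  have := Real.abs_cos_le_one (k.1 * x + k.2 * y + φ)
  calc _ ≤ |d k| * 1 := by gcongr <;> simp [this]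
    _ = _ := mul_one _

lemma Rapid.Fs_le {d} (h : Rapid d) (φ x y : ℝ) : |Fs φ d x y| ≤ ∑' k, |d k| := by
  unfold Fs
  refine (abs_tsum_le (h.Fs_summable φ x y).abs).trans ?_
  refine Summable.tsum_le_tsum (fun k => ?_) (h.Fs_summable φ x y).abs h.abs.summable
  rw [abs_mul]
  exact mul_le_of_le_one_right (abs_nonneg _) (Real.abs_cos_le_one _)

lemma cos_term_dx (k : ℤ × ℤ) (a φ x y : ℝ) :
    HasDerivAt (fun x => a * cos (k.1 * x + k.2 * y + φ)) ((k.1 * a) * cos (k.1 * x + k.2 * y + (φ + π / 2))) x := by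
  have h : HasDerivAt (fun x : ℝ => (k.1 : ℝ) * x + k.2 * y + φ) ((k.1 : ℝ) * 1) x :=
    (((hasDerivAt_id x).const_mul _).add_const _).add_const _
  refine (h.cos.const_mul a).congr_deriv ?_
  rw [← add_assoc, Real.cos_add_pi_div_two]; ring

lemma cos_term_dy (k : ℤ × ℤ) (a φ x y : ℝ) :
    HasDerivAt (fun y => a * cos (k.1 * x + k.2 * y + φ)) ((k.2 * a) * cos (k.1 * x + k.2 * y + (φ + π / 2))) y := by
  have h : HasDerivAt (fun y : ℝ => (k.1 : ℝ) * x + k.2 * y + φ) ((k.2 : ℝ) * 1) y :=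
    (((hasDerivAt_id y).const_mul _).const_add _).add_const _
  refine (h.cos.const_mul a).congr_deriv ?_
  rw [← add_assoc, Real.cos_add_pi_div_two]; ring

lemma norm_mul_cos_le (a z : ℝ) : ‖a * cos z‖ ≤ |a| := by
  rw [norm_mul, Real.norm_eq_abs]
  exact mul_le_of_le_one_right (abs_nonneg _) (Real.abs_cos_le_one _)

lemma Rapid.dx {d} (h : Rapid d) (φ x y : ℝ) :
    HasDerivAt (fun x => Fs φ d x y) (Fs (φ + π / 2) (fun k => k.1 * d k) x y) x :=
  hasDerivAt_tsum h.k1.abs.summable (fun k x => cos_term_dx k (d k) φ x y)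
    (fun _ _ => norm_mul_cos_le _ _) (h.Fs_summable φ 0 y) x

lemma Rapid.dy {d} (h : Rapid d) (φ x y : ℝ) :
    HasDerivAt (fun y => Fs φ d x y) (Fs (φ + π / 2) (fun k => k.2 * d k) x y) y :=
  hasDerivAt_tsum h.k2.abs.summable (fun k y => cos_term_dy k (d k) φ x y)
    (fun _ _ => norm_mul_cos_le _ _) (h.Fs_summable φ x 0) y

lemma Fs_per (φ d x y) : Fs φ d (x + 2 * π) y = Fs φ d x y ∧ Fs φ d x (y + 2 * π) = Fs φ d x y := by
  unfold Fs
  constructor <;> congr 1 <;> ext k <;> congr 1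
  · rw [show (k.1:ℝ) * (x + 2 * π) + k.2 * y + φ = k.1 * x + k.2 * y + φ + k.1 * (2 * π) by ring, Real.cos_add_int_mul_two_pi]
  · rw [show (k.1:ℝ) * x + k.2 * (y + 2 * π) + φ = k.1 * x + k.2 * y + φ + k.2 * (2 * π) by ring, Real.cos_add_int_mul_two_pi]

lemma Sym.Fs_odd_y {d} (h : Sym d) (x y : ℝ) : Fs 0 d x (-y) = - Fs 0 d x y := by
  unfold Fs
  rw [← fl2.tsum_eq, ← tsum_neg]
  congr 1; ext k
  rw [h.f2]; simp [fl2_apply]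

lemma Sym.Fs_odd_x {d} (h : Sym d) (x y : ℝ) : Fs 0 d (-x) y = - Fs 0 d x y := by
  unfold Fs
  rw [← fl1.tsum_eq, ← tsum_neg]
  congr 1; ext k
  rw [h.f1]; simp [fl1_apply]

lemma Sym.Fs_zero_y {d} (h : Sym d) (x : ℝ) : Fs 0 d x 0 = 0 := by
  have := h.Fs_odd_y x 0
  simp at this; linarith

lemma Sym.mean {d} (h : Sym d) (x : ℝ) : ∫ y in (0:ℝ)..(2 * π), Fs 0 d x y = 0 := by
  have h1 := intervalIntegral.integral_comp_sub_left (fun y => Fs 0 d x y) (2 * π) (a := 0) (b := 2 * π)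
  have h2 : ∀ y, Fs 0 d x (2 * π - y) = - Fs 0 d x y := fun y => by
    rw [show 2 * π - y = -y + 2 * π by ring, (Fs_per 0 d x (-y)).2, h.Fs_odd_y]
  simp only [h2, sub_self, sub_zero] at h1
  rw [intervalIntegral.integral_neg] at h1
  linarith

lemma Sym.wt {d} (h : Sym d) {w : ℤ × ℤ → ℝ} (h1 : ∀ k, w (fl1 k) = w k) (h2 : ∀ k, w (fl2 k) = w k) :
    Sym fun k => w k * d k := by
  intro k1 k2
  have a := h1 (k1, k2); have b := h2 (k1, k2)
  simp only [fl1_apply, fl2_apply] at a b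
  constructor
  · simp only [a, (h k1 k2).1]; ring
  · simp only [b, (h k1 k2).2]; ring

lemma Sym.psi {d} (h : Sym d) : Sym fun k => -(nsq k)⁻¹ * d k := by
  apply h.wt <;> intro k <;> simp [nsq, fl1_apply, fl2_apply]

lemma Fs_pi (φ d x y) : Fs (φ + π / 2 + π / 2) d x y = - Fs φ d x y := by
  unfold Fs
  rw [← tsum_neg]; congr 1; ext k
  rw [show (k.1:ℝ) * x + k.2 * y + (φ + π / 2 + π / 2) = k.1 * x + k.2 * y + φ + π by ring, Real.cos_add_pi]; ring

/-- the product formula -/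
lemma Fs_nl {c} (hc : Rapid c) (he : ∀ k, c (-k) = c k) (x y : ℝ) :
    Fs 0 (nl c) x y = Fs (0 + π / 2) (fun k => k.1 * c k) x y * Fs (0 + π / 2) (fun k => k.2 * (-(nsq k)⁻¹ * c k)) x y
      - Fs (0 + π / 2) (fun k => k.2 * c k) x y * Fs (0 + π / 2) (fun k => k.1 * (-(nsq k)⁻¹ * c k)) x y := by
  set z : ℤ × ℤ → ℝ := fun k => k.1 * x + k.2 * y with hz
  have zadd : ∀ j l, z (j + l) = z j + z l := fun j l => by simp [hz]; ring
  have zneg : ∀ j, z (-j) = - z j := fun j => by simp [hz]; ring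
  set F : (ℤ × ℤ) × (ℤ × ℤ) → ℝ := fun p => ker p.2 p.1 * c p.2 * c (p.1 - p.2) * cos (z p.1) with hF
  have sF : Summable F := by
    refine summable_conv (c := fun j => 2 * |c j|) (d := fun l => br l ^ 1 * |c l|)
      (hc.abs.summable.mul_left 2) (hc.abs.br_mul 1).summable fun k j => ?_
    simp only [hF]
    refine (norm_mul_cos_le _ _).trans ?_
    have := ker_le' j k
    rw [abs_mul, abs_mul]
    calc _ ≤ 2 * br (k - j) * |c j| * |c (k - j)| := by gcongr
      _ = _ := by ring
  have eL : Fs 0 (nl c) x y = ∑' p, F p := by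
    rw [sF.tsum_prod]
    unfold Fs; congr 1; ext k
    simp only [hF, nl, bil, add_zero]
    rw [tsum_mul_right]
  have eL2 : ∑' p, F p = ∑' p, F (eqv3 p) := (eqv3.tsum_eq F).symm
  have sc : ∀ {f : (ℤ × ℤ) × (ℤ × ℤ) → ℝ}, (∀ p, |f p| ≤ (2 * |c p.1|) * (br p.2 ^ 1 * |c p.2|)) → Summable f := by
    intro f hf
    refine Summable.of_norm_bounded ((hc.abs.summable.mul_left 2).mul_of_nonneg (hc.abs.br_mul 1).summable
      (fun _ => by positivity) (fun k => by have := br_pos k; positivity)) hf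
  have kb : ∀ (p : (ℤ × ℤ) × (ℤ × ℤ)) (u v : ℝ), |u| ≤ 1 → |v| ≤ 1 →
      |ker p.1 p.2 * c p.1 * c p.2 * (u * v)| ≤ (2 * |c p.1|) * (br p.2 ^ 1 * |c p.2|) := by
    intro p u v hu hv
    have h1 := ker_le p.1 p.2
    have h2 := br_pos p.2
    rw [abs_mul, abs_mul, abs_mul, abs_mul]
    calc _ ≤ 2 * br p.2 * |c p.1| * |c p.2| * (1 * 1) := by gcongr
      _ = _ := by ring
  set H : (ℤ × ℤ) × (ℤ × ℤ) → ℝ := fun p => ker p.1 p.2 * c p.1 * c p.2 * (cos (z p.1) * cos (z p.2)) with hH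
  set G : (ℤ × ℤ) × (ℤ × ℤ) → ℝ := fun p => ker p.1 p.2 * c p.1 * c p.2 * (sin (z p.1) * sin (z p.2)) with hG
  have sH : Summable H := sc fun p => kb p _ _ (Real.abs_cos_le_one _) (Real.abs_cos_le_one _)
  have sG : Summable G := sc fun p => kb p _ _ (Real.abs_sin_le_one _) (Real.abs_sin_le_one _)
  have eF : ∀ p, F (eqv3 p) = H p - G p := by
    intro p
    simp only [hF, hH, hG, eqv3, Equiv.coe_fn_mk]
    rw [ker_add, add_sub_cancel_left, zadd, Real.cos_add]; ring
  have H0 : ∑' p, H p = 0 := by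
    have h1 : ∑' p, H (((Equiv.neg (ℤ × ℤ)).prodCongr (Equiv.refl (ℤ × ℤ))) p) = ∑' p, H p := Equiv.tsum_eq _ H
    have h2 : ∀ p, H (((Equiv.neg (ℤ × ℤ)).prodCongr (Equiv.refl (ℤ × ℤ))) p) = - H p := by
      intro p
      simp only [hH, Equiv.prodCongr_apply, Prod.map, Equiv.neg_apply, Equiv.refl_apply]
      rw [ker_neg, he, zneg, Real.cos_neg]; ring
    simp only [h2] at h1
    rw [tsum_neg] at h1
    linarith
  have fsum : ∀ {d}, Rapid d → Summable fun k : ℤ × ℤ => ‖d k * cos (k.1 * x + k.2 * y + (0 + π / 2))‖ := by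
    intro d hd; exact (hd.Fs_summable _ _ _).norm
  have P1 := tsum_mul_tsum_of_summable_norm (fsum hc.psi.k2) (fsum hc.k1)
  have P2 := tsum_mul_tsum_of_summable_norm (fsum hc.psi.k1) (fsum hc.k2)
  have S1 := summable_mul_of_summable_norm (fsum hc.psi.k2) (fsum hc.k1)
  have S2 := summable_mul_of_summable_norm (fsum hc.psi.k1) (fsum hc.k2)
  rw [eL, eL2, tsum_congr eF, sH.tsum_sub sG, H0, zero_sub, mul_comm, mul_comm (Fs (0 + π / 2) (fun k => k.2 * c k) x y)]
  unfold Fs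
  rw [P1, P2, ← S1.tsum_sub S2, ← tsum_neg]
  congr 1; ext p
  have e1 : ∀ k : ℤ × ℤ, cos ((k.1:ℝ) * x + k.2 * y + (0 + π / 2)) = - sin (z k) := by
    intro k; rw [zero_add, Real.cos_add_pi_div_two]
  rw [e1, e1]
  simp only [hG, ker]
  rw [div_eq_mul_inv]
  ring

end EU

end

section
open Real MeasureTheory Set Filter Topology

namespace EU

/-- classes of smooth families -/
def Sm (I : Set ℝ) : ℕ → (ℝ → ℤ × ℤ → ℝ) → Prop
  | 0, d => UB I d ∧ ∀ k, ContinuousOn (fun t => d t k) I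
  | n + 1, d => UB I d ∧ ∃ d', Sm I n d' ∧ ∀ t ∈ I, ∀ k, HasDerivAt (fun u => d u k) (d' t k) t

lemma Sm.ub {I n d} (h : Sm I n d) : UB I d := by
  cases n with
  | zero => exact h.1
  | succ n => exact h.1

lemma Sm.cont {I n d} (h : Sm I n d) : ∀ k, ContinuousOn (fun t => d t k) I := by
  cases n with
  | zero => exact h.2
  | succ n =>
    obtain ⟨_, d', _, h2⟩ := h
    exact fun k t ht => (h2 t ht k).continuousAt.continuousWithinAt

lemma Sm.pred {I n d} (h : Sm I (n + 1) d) : Sm I n d := by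
  induction n generalizing d with
  | zero => exact ⟨h.ub, h.cont⟩
  | succ n ih =>
    obtain ⟨h1, d', h2, h3⟩ := h
    exact ⟨h1, d', ih h2, h3⟩

lemma UB.wt {I d} (h : UB I d) {w : ℤ × ℤ → ℝ} {m : ℕ} {C : ℝ} (hw : ∀ k, |w k| ≤ C * br k ^ m) :
    UB I (fun t k => w k * d t k) := by
  intro s
  obtain ⟨A, hA⟩ := h (s + m)
  have hC : 0 ≤ C := by
    have := (abs_nonneg _).trans (hw 0)
    exact nonneg_of_mul_nonneg_left this (pow_pos (br_pos 0) _)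
  refine ⟨C * A, fun t ht k => ?_⟩
  rw [abs_mul]
  calc |w k| * |d t k| * br k ^ s ≤ (C * br k ^ m) * |d t k| * br k ^ s := by
        have := br_pos k
        gcongr; exact hw k
    _ = C * (|d t k| * br k ^ (s + m)) := by ring
    _ ≤ _ := by gcongr; exact hA t ht k

lemma UB.add {I c d} (hc : UB I c) (hd : UB I d) : UB I (fun t k => c t k + d t k) := by
  intro s
  obtain ⟨A, hA⟩ := hc s
  obtain ⟨B, hB⟩ := hd s
  refine ⟨A + B, fun t ht k => ?_⟩
  have := hA t ht k; have := hB t ht k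
  have h3 := abs_add_le (c t k) (d t k)
  have := pow_pos (br_pos k) s
  nlinarith

lemma Sm.wt {I n d} (h : Sm I n d) {w : ℤ × ℤ → ℝ} {m : ℕ} {C : ℝ} (hw : ∀ k, |w k| ≤ C * br k ^ m) :
    Sm I n (fun t k => w k * d t k) := by
  induction n generalizing d with
  | zero => exact ⟨h.1.wt hw, fun k => (h.2 k).const_mul (w k)⟩
  | succ n ih =>
    obtain ⟨h1, d', h2, h3⟩ := h
    exact ⟨h1.wt hw, _, ih h2, fun t ht k => (h3 t ht k).const_mul (w k)⟩

lemma Sm.add {I n c d} (hc : Sm I n c) (hd : Sm I n d) : Sm I n (fun t k => c t k + d t k) := by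
  induction n generalizing c d with
  | zero => exact ⟨hc.1.add hd.1, fun k => (hc.2 k).add (hd.2 k)⟩
  | succ n ih =>
    obtain ⟨h1, c', h2, h3⟩ := hc
    obtain ⟨g1, d', g2, g3⟩ := hd
    exact ⟨h1.add g1, _, ih h2 g2, fun t ht k => (h3 t ht k).add (g3 t ht k)⟩

lemma Sm.bil {I : Set ℝ} (hI : IsOpen I) (hI' : IsPreconnected I) {n c d} (hc : Sm I n c) (hd : Sm I n d) :
    Sm I n (fun t => bil (c t) (d t)) := by
  induction n generalizing c d with
  | zero =>
    refine ⟨hc.ub.bil hd.ub, fun k => ?_⟩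
    obtain ⟨A, hA⟩ := hc.ub 4
    obtain ⟨B, hB⟩ := hd.ub 1
    unfold EU.bil
    refine continuousOn_tsum (fun j => ((hc.2 j).const_mul _).mul (hd.2 (k - j))) (summable_br4.mul_left (2 * A * B)) fun j t ht => ?_
    have := bil_sum (s := 0) (by simpa using hA t ht) (by simpa using hB t ht) k j
    simpa using this
  | succ n ih =>
    have hc0 := hc.pred
    have hd0 := hd.pred
    obtain ⟨h1, c', h2, h3⟩ := hc
    obtain ⟨g1, d', g2, g3⟩ := hd
    refine ⟨h1.bil g1, _, (ih h2 hd0).add (ih hc0 g2), fun t ht k => ?_⟩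
    obtain ⟨A, hA⟩ := h1 4
    obtain ⟨B, hB⟩ := g1 1
    obtain ⟨A', hA'⟩ := h2.ub 4
    obtain ⟨B', hB'⟩ := g2.ub 1
    have s1 := (h2.ub.rapid ht).bil_summable (g1.rapid ht) k
    have s2 := (h1.rapid ht).bil_summable (g2.ub.rapid ht) k
    unfold EU.bil
    rw [← s1.tsum_add s2]
    refine hasDerivAt_tsum_of_isPreconnected (u := fun j => 2 * A' * B * (br j ^ 4)⁻¹ + 2 * A * B' * (br j ^ 4)⁻¹) (t := I)
      (g' := fun j t => ker j k * c' t j * d t (k - j) + ker j k * c t j * d' t (k - j)) ?_ hI hI' ?_ ?_ ht ?_ ht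
    · exact (summable_br4.mul_left _).add (summable_br4.mul_left _)
    · intro j t ht
      exact ((h3 t ht j).const_mul (ker j k)).mul (g3 t ht (k - j))
    · intro j t ht
      have e1 := bil_sum (s := 0) (by simpa using hA' t ht) (by simpa using hB t ht) k j
      have e2 := bil_sum (s := 0) (by simpa using hA t ht) (by simpa using hB' t ht) k j
      simp only [pow_zero, mul_one] at e1 e2
      exact (norm_add_le _ _).trans (add_le_add e1 e2)
    · exact (h1.rapid ht).bil_summable (g1.rapid ht) k

lemma Sol.hasDerivAt {b c} (h : Sol b c) {t} (ht : t ∈ Ioo 0 b) (k) : HasDerivAt (fun u => c u k) (nl (c t) k) t :=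
  (h.der t (Ioo_subset_Icc_self ht) k).hasDerivAt (Icc_mem_nhds ht.1 ht.2)

lemma Sol.sm {b c} (h : Sol b c) (n : ℕ) : Sm (Ioo 0 b) n c := by
  induction n with
  | zero => exact ⟨h.ub.mono Ioo_subset_Icc_self, fun k t ht => (h.hasDerivAt ht k).continuousAt.continuousWithinAt⟩
  | succ n ih => exact ⟨h.ub.mono Ioo_subset_Icc_self, _, ih.bil isOpen_Ioo isPreconnected_Ioo ih, fun t ht k => h.hasDerivAt ht k⟩

lemma k1_le (k : ℤ × ℤ) : |(k.1:ℝ)| ≤ 1 * br k ^ 1 := by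
  unfold br; simp only [pow_one, one_mul]; linarith [abs_nonneg (k.1:ℝ), abs_nonneg (k.2:ℝ)]
lemma k2_le (k : ℤ × ℤ) : |(k.2:ℝ)| ≤ 1 * br k ^ 1 := by
  unfold br; simp only [pow_one, one_mul]; linarith [abs_nonneg (k.1:ℝ), abs_nonneg (k.2:ℝ)]

lemma UB.sum {I d} (h : UB I d) : ∃ u : ℤ × ℤ → ℝ, Summable u ∧ ∀ t ∈ I, ∀ k, |d t k| ≤ u k := by
  obtain ⟨A, hA⟩ := h 4
  refine ⟨fun k => A * (br k ^ 4)⁻¹, summable_br4.mul_left A, fun t ht k => ?_⟩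
  show |d t k| ≤ A * (br k ^ 4)⁻¹
  rw [← div_eq_mul_inv, le_div_iff₀ (pow_pos (br_pos k) _)]
  exact hA t ht k

/-- first coordinate -/
noncomputable def l1 : ℝ × ℝ × ℝ →L[ℝ] ℝ := ContinuousLinearMap.fst ℝ ℝ (ℝ × ℝ)
/-- second coordinate -/
noncomputable def l2 : ℝ × ℝ × ℝ →L[ℝ] ℝ := (ContinuousLinearMap.fst ℝ ℝ ℝ).comp (ContinuousLinearMap.snd ℝ ℝ (ℝ × ℝ))
/-- third coordinate -/
noncomputable def l3 : ℝ × ℝ × ℝ →L[ℝ] ℝ := (ContinuousLinearMap.snd ℝ ℝ ℝ).comp (ContinuousLinearMap.snd ℝ ℝ (ℝ × ℝ))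

lemma Fs_hasFDerivAt {I : Set ℝ} (hI : IsOpen I) (hI' : IsPreconnected I) (φ : ℝ) {d d' : ℝ → ℤ × ℤ → ℝ}
    (hd : UB I d) (hd' : UB I d') (h : ∀ t ∈ I, ∀ k, HasDerivAt (fun u => d u k) (d' t k) t) (p : ℝ × ℝ × ℝ) (hp : p.2.2 ∈ I) :
    HasFDerivAt (fun p : ℝ × ℝ × ℝ => Fs φ (d p.2.2) p.1 p.2.1)
      (Fs (φ + π / 2) (fun k => k.1 * d p.2.2 k) p.1 p.2.1 • l1 + Fs (φ + π / 2) (fun k => k.2 * d p.2.2 k) p.1 p.2.1 • l2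
        + Fs φ (d' p.2.2) p.1 p.2.1 • l3) p := by
  obtain ⟨u1, su1, hu1⟩ := (hd.wt k1_le).sum
  obtain ⟨u2, su2, hu2⟩ := (hd.wt k2_le).sum
  obtain ⟨u3, su3, hu3⟩ := hd'.sum
  have hr := hd.rapid hp
  have hr' := hd'.rapid hp
  set g' : ℤ × ℤ → ℝ × ℝ × ℝ → (ℝ × ℝ × ℝ →L[ℝ] ℝ) := fun k p =>
    (k.1 * d p.2.2 k * cos (k.1 * p.1 + k.2 * p.2.1 + (φ + π / 2))) • l1 + (k.2 * d p.2.2 k * cos (k.1 * p.1 + k.2 * p.2.1 + (φ + π / 2))) • l2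
      + (d' p.2.2 k * cos (k.1 * p.1 + k.2 * p.2.1 + φ)) • l3 with hg'
  have e : (Fs (φ + π / 2) (fun k => k.1 * d p.2.2 k) p.1 p.2.1 • l1 + Fs (φ + π / 2) (fun k => k.2 * d p.2.2 k) p.1 p.2.1 • l2
        + Fs φ (d' p.2.2) p.1 p.2.1 • l3) = ∑' k, g' k p := by
    have s1 := hr.k1.Fs_summable (φ + π / 2) p.1 p.2.1
    have s2 := hr.k2.Fs_summable (φ + π / 2) p.1 p.2.1
    have s3 := hr'.Fs_summable φ p.1 p.2.1
    simp only [hg']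
    rw [((s1.smul_const l1).add (s2.smul_const l2)).tsum_add (s3.smul_const l3),
      (s1.smul_const l1).tsum_add (s2.smul_const l2), s1.tsum_smul_const, s2.tsum_smul_const, s3.tsum_smul_const]
    rfl
  rw [e]
  refine hasFDerivAt_tsum_of_isPreconnected (u := fun k => u1 k * ‖l1‖ + u2 k * ‖l2‖ + u3 k * ‖l3‖) (s := {p : ℝ × ℝ × ℝ | p.2.2 ∈ I}) ?_ ?_ ?_ ?_ ?_ hp ?_ hp
  · exact ((su1.mul_right _).add (su2.mul_right _)).add (su3.mul_right _)
  · exact hI.preimage (by fun_prop)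
  · have : {p : ℝ × ℝ × ℝ | p.2.2 ∈ I} = univ ×ˢ (univ ×ˢ I) := by ext; simp
    rw [this]
    exact isPreconnected_univ.prod (isPreconnected_univ.prod hI')
  · intro k q hq
    have h1 : HasFDerivAt (fun q : ℝ × ℝ × ℝ => d q.2.2 k) (d' q.2.2 k • l3) q := by
      have := (h q.2.2 hq k).comp_hasFDerivAt q (f := fun q : ℝ × ℝ × ℝ => l3 q) l3.hasFDerivAt
      exact this
    have h2 : HasFDerivAt (fun q : ℝ × ℝ × ℝ => (k.1:ℝ) * q.1 + k.2 * q.2.1 + φ) ((k.1:ℝ) • l1 + (k.2:ℝ) • l2) q := by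
      have := ((l1.hasFDerivAt (x := q)).const_mul (k.1:ℝ)).add ((l2.hasFDerivAt (x := q)).const_mul (k.2:ℝ))
      exact this.add_const φ
    have h3 := h1.mul h2.cos
    refine h3.congr_fderiv ?_
    simp only [hg']
    rw [← add_assoc, Real.cos_add_pi_div_two]
    ext <;> simp <;> ring
  · intro k q hq
    refine (norm_add_le _ _).trans (add_le_add ((norm_add_le _ _).trans (add_le_add ?_ ?_)) ?_)
    · rw [norm_smul]; gcongr; exact (norm_mul_cos_le _ _).trans (hu1 _ hq k)
    · rw [norm_smul]; gcongr; exact (norm_mul_cos_le _ _).trans (hu2 _ hq k)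
    · rw [norm_smul]; gcongr; exact (norm_mul_cos_le _ _).trans (hu3 _ hq k)
  · exact hr.Fs_summable φ p.1 p.2.1

lemma Sm.contDiffOn {I : Set ℝ} (hI : IsOpen I) (hI' : IsPreconnected I) {n : ℕ} (φ : ℝ) {d} (h : Sm I n d) :
    ContDiffOn ℝ n (fun p : ℝ × ℝ × ℝ => Fs φ (d p.2.2) p.1 p.2.1) {p : ℝ × ℝ × ℝ | p.2.2 ∈ I} := by
  have hO : IsOpen {p : ℝ × ℝ × ℝ | p.2.2 ∈ I} := hI.preimage (by fun_prop)
  induction n generalizing d φ with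
  | zero =>
    simp only [CharP.cast_eq_zero, contDiffOn_zero]
    obtain ⟨u, su, hu⟩ := h.ub.sum
    unfold Fs
    refine continuousOn_tsum (fun k => ?_) su fun k p hp => (norm_mul_cos_le _ _).trans (hu _ hp k)
    refine ContinuousOn.mul ((h.2 k).comp (by fun_prop) fun p hp => hp) (by fun_prop)
  | succ n ih =>
    have h0 := h.pred
    obtain ⟨h1, d', h2, h3⟩ := h
    have hF := Fs_hasFDerivAt hI hI' φ h1 h2.ub h3
    push_cast
    rw [contDiffOn_succ_iff_fderiv_of_isOpen hO]
    refine ⟨fun p hp => (hF p hp).differentiableAt.differentiableWithinAt, by simp, ?_⟩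
    have : ContDiffOn ℝ n (fun p : ℝ × ℝ × ℝ => (Fs (φ + π / 2) (fun k => k.1 * d p.2.2 k) p.1 p.2.1 • l1 + Fs (φ + π / 2) (fun k => k.2 * d p.2.2 k) p.1 p.2.1 • l2
        + Fs φ (d' p.2.2) p.1 p.2.1 • l3)) {p : ℝ × ℝ × ℝ | p.2.2 ∈ I} := by
      refine ((ContDiffOn.smul (ih (φ + π / 2) (h0.wt k1_le)) contDiffOn_const).add
        (ContDiffOn.smul (ih (φ + π / 2) (h0.wt k2_le)) contDiffOn_const)).add (ContDiffOn.smul (ih φ h2) contDiffOn_const)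
    exact this.congr fun p hp => (hF p hp).fderiv

/-- time derivative of a series -/
lemma Sol.dt {b c} (h : Sol b c) {w : ℤ × ℤ → ℝ} {m : ℕ} {C : ℝ} (hw : ∀ k, |w k| ≤ C * br k ^ m) (φ x y : ℝ) {t} (ht : t ∈ Ioo 0 b) :
    HasDerivAt (fun t => Fs φ (fun k => w k * c t k) x y) (Fs φ (fun k => w k * nl (c t) k) x y) t := by
  have hU := h.ub.mono (Ioo_subset_Icc_self (a := 0) (b := b))
  obtain ⟨u, su, hu⟩ := ((hU.bil hU).wt hw).sum
  unfold Fs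
  refine hasDerivAt_tsum_of_isPreconnected (t := Ioo 0 b) su isOpen_Ioo isPreconnected_Ioo
    (g' := fun k t => w k * nl (c t) k * cos (k.1 * x + k.2 * y + φ)) ?_ ?_ ht ?_ ht
  · intro k t ht
    exact ((h.hasDerivAt ht k).const_mul (w k)).mul_const _
  · intro k t ht
    exact (norm_mul_cos_le _ _).trans (hu t ht k)
  · exact ((hU.rapid ht).mul_wt hw).Fs_summable _ _ _

end EU

end

section
open Real MeasureTheory Set Filter Topology

namespace EU

/-- `x`-derivative of the vorticity -/
noncomputable def gx (d : ℤ × ℤ → ℝ) (x y : ℝ) : ℝ := Fs (0 + π / 2) (fun k => k.1 * d k) x y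
/-- `y`-derivative of the vorticity -/
noncomputable def gy (d : ℤ × ℤ → ℝ) (x y : ℝ) : ℝ := Fs (0 + π / 2) (fun k => k.2 * d k) x y
/-- length of the gradient -/
noncomputable def gr (d : ℤ × ℤ → ℝ) (x y : ℝ) : ℝ := √(gx d x y ^ 2 + gy d x y ^ 2)

/-- the claim of the theorem -/
def Claim (T M : ℝ) : Prop := ∃ θ ψ : ℝ → ℝ → ℝ → ℝ, IsEulerOnTorus T θ ψ ∧
    supNorm (fun x y => θ x y 0) < 2 ∧ 0 < gradSupNorm θ 0 ∧
    ∃ t ∈ Icc 0 T, gradSupNorm θ t > M * gradSupNorm θ 0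

lemma Rapid.gxd {d} (h : Rapid d) (x y : ℝ) : HasDerivAt (fun x => Fs 0 d x y) (gx d x y) x := h.dx 0 x y
lemma Rapid.gyd {d} (h : Rapid d) (x y : ℝ) : HasDerivAt (fun y => Fs 0 d x y) (gy d x y) y := h.dy 0 x y

lemma Sol.rapid {b c} (h : Sol b c) {t} (ht : t ∈ Icc 0 b) : Rapid (c t) := h.ub.rapid ht

lemma laplace {d} (hs : Sym d) (h : Rapid d) (x y : ℝ) :
    Fs (0 + π / 2 + π / 2) (fun k => k.1 * (k.1 * (-(nsq k)⁻¹ * d k))) x y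
     + Fs (0 + π / 2 + π / 2) (fun k => k.2 * (k.2 * (-(nsq k)⁻¹ * d k))) x y = Fs 0 d x y := by
  rw [Fs_pi, Fs_pi]
  have h1 := h.psi.k1.k1.Fs_summable 0 x y
  have h2 := h.psi.k2.k2.Fs_summable 0 x y
  unfold Fs
  rw [← tsum_neg, ← tsum_neg, ← h1.neg.tsum_add h2.neg]
  congr 1; ext k
  by_cases hk : k = 0
  · subst hk; rw [hs.zero]; simp
  · have := nsq_one hk
    have h0 : nsq k ≠ 0 := by linarith
    have h3 : (k.1:ℝ)^2 + (k.2:ℝ)^2 = nsq k := rfl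
    field_simp
    rw [← h3]; ring

lemma Sol.euler {b c} (h : Sol b c) {T s μ : ℝ} (hs : 0 < s) (hμ : 0 < μ) (hT : 0 < T) (hb : s + μ * T < b) :
    IsEulerOnTorus T (fun x y τ => μ * Fs 0 (c (s + μ * τ)) x y)
      (fun x y τ => μ * Fs 0 (fun k => -(nsq k)⁻¹ * c (s + μ * τ) k) x y) := by
  have hI : ∀ τ ∈ Icc 0 T, s + μ * τ ∈ Ioo 0 b := fun τ hτ =>
    ⟨by have := mul_nonneg hμ.le hτ.1; linarith, by have := mul_le_mul_of_nonneg_left hτ.2 hμ.le; linarith⟩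
  have hR : ∀ τ ∈ Icc 0 T, Rapid (c (s + μ * τ)) := fun τ hτ => h.rapid (Ioo_subset_Icc_self (hI τ hτ))
  have hS : ∀ τ ∈ Icc 0 T, Sym (c (s + μ * τ)) := fun τ hτ => h.sym _ (Ioo_subset_Icc_self (hI τ hτ))
  have cd : ∀ (d : ℝ → ℤ × ℤ → ℝ), (∀ n, Sm (Ioo 0 b) n d) → ContDiffOn ℝ (⊤ : ℕ∞)
      (fun p : ℝ × ℝ × ℝ => μ * Fs 0 (d (s + μ * p.2.2)) p.1 p.2.1) {p : ℝ × ℝ × ℝ | p.2.2 ∈ Icc 0 T} := by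
    intro d hd
    rw [contDiffOn_infty]
    intro n
    refine contDiffOn_const.mul ?_
    have h1 := (hd n).contDiffOn isOpen_Ioo isPreconnected_Ioo 0
    have h2 : ContDiffOn ℝ n (fun p : ℝ × ℝ × ℝ => (p.1, p.2.1, s + μ * p.2.2)) {p : ℝ × ℝ × ℝ | p.2.2 ∈ Icc 0 T} :=
      ContDiff.contDiffOn (by fun_prop)
    exact h1.comp h2 fun p hp => hI _ hp
  refine ⟨cd _ h.sm, cd (fun t k => -(nsq k)⁻¹ * c t k) fun n => (h.sm n).wt (m := 0) (C := 1) fun k => ?_, ?_, ?_, ?_, ?_, ?_⟩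
  · rw [abs_neg]; simpa using nsq_inv_le k
  · intro x y t
    simp only [(Fs_per _ _ _ _).1, (Fs_per _ _ _ _).2, and_self]
  · intro x y t
    simp only [(Fs_per _ _ _ _).1, (Fs_per _ _ _ _).2, and_self]
  · intro t ht
    simp [(hS t ht).mean]
  · intro x y t ht
    have hr := (hR t ht).psi
    have e1 : ∀ x', pX (fun x y τ => μ * Fs 0 (fun k => -(nsq k)⁻¹ * c (s + μ * τ) k) x y) x' y t
        = μ * Fs (0 + π / 2) (fun k => k.1 * (-(nsq k)⁻¹ * c (s + μ * t) k)) x' y := fun x' =>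
      ((hr.dx 0 x' y).const_mul μ).deriv
    have e2 : ∀ y', pY (fun x y τ => μ * Fs 0 (fun k => -(nsq k)⁻¹ * c (s + μ * τ) k) x y) x y' t
        = μ * Fs (0 + π / 2) (fun k => k.2 * (-(nsq k)⁻¹ * c (s + μ * t) k)) x y' := fun y' =>
      ((hr.dy 0 x y').const_mul μ).deriv
    unfold pXX pYY
    simp only [e1, e2]
    rw [((hr.k1.dx _ x y).const_mul μ).deriv, ((hr.k2.dy _ x y).const_mul μ).deriv, ← laplace (hS t ht) (hR t ht)]
    ring
  · intro x y t ht
    have hr := hR t ht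
    have e1 : pX (fun x y τ => μ * Fs 0 (fun k => -(nsq k)⁻¹ * c (s + μ * τ) k) x y) x y t
        = μ * Fs (0 + π / 2) (fun k => k.1 * (-(nsq k)⁻¹ * c (s + μ * t) k)) x y :=
      ((hr.psi.dx 0 x y).const_mul μ).deriv
    have e2 : pY (fun x y τ => μ * Fs 0 (fun k => -(nsq k)⁻¹ * c (s + μ * τ) k) x y) x y t
        = μ * Fs (0 + π / 2) (fun k => k.2 * (-(nsq k)⁻¹ * c (s + μ * t) k)) x y :=
      ((hr.psi.dy 0 x y).const_mul μ).deriv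
    have e3 : pX (fun x y τ => μ * Fs 0 (c (s + μ * τ)) x y) x y t = μ * gx (c (s + μ * t)) x y :=
      ((hr.gxd x y).const_mul μ).deriv
    have e4 : pY (fun x y τ => μ * Fs 0 (c (s + μ * τ)) x y) x y t = μ * gy (c (s + μ * t)) x y :=
      ((hr.gyd x y).const_mul μ).deriv
    rw [e1, e2, e3, e4]
    have hd := h.dt (w := fun _ => 1) (m := 0) (C := 1) (by simp) 0 x y (hI t ht)
    simp only [one_mul] at hd
    have ha : HasDerivAt (fun τ : ℝ => s + μ * τ) (μ * 1) t := ((hasDerivAt_id t).const_mul μ).const_add s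
    have hc := ((hd.comp t ha).const_mul μ)
    have := hc.hasDerivWithinAt (s := Icc 0 T)
    have := this.derivWithin (uniqueDiffOn_Icc hT t ht)
    simp only [Function.comp_def] at this
    rw [this, show Fs 0 (fun k => nl (c (s + μ * t)) k) x y = Fs 0 (nl (c (s + μ * t))) x y from rfl, Fs_nl hr (hS t ht).even]
    unfold gx gy
    ring

lemma Rapid.br1 {d} (h : Rapid d) : Summable fun k => br k * |d k| := by
  simpa using (h.abs.br_mul 1).summable
lemma Rapid.gx_le {d} (h : Rapid d) (x y : ℝ) : |gx d x y| ≤ ∑' k, br k * |d k| := by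
  refine (h.k1.Fs_le _ _ _).trans ?_
  refine Summable.tsum_le_tsum (fun k => ?_) h.k1.abs.summable ?_
  · rw [abs_mul]; have := k1_le k; simp only [one_mul, pow_one] at this; gcongr
  · exact h.br1
lemma Rapid.gy_le {d} (h : Rapid d) (x y : ℝ) : |gy d x y| ≤ ∑' k, br k * |d k| := by
  refine (h.k2.Fs_le _ _ _).trans ?_
  refine Summable.tsum_le_tsum (fun k => ?_) h.k2.abs.summable ?_
  · rw [abs_mul]; have := k2_le k; simp only [one_mul, pow_one] at this; gcongr
  · exact h.br1
lemma Rapid.gr_le {d} (h : Rapid d) (x y : ℝ) : gr d x y ≤ 2 * ∑' k, br k * |d k| := by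
  have h1 := h.gx_le x y
  have h2 := h.gy_le x y
  have h0 := abs_nonneg (gx d x y)
  unfold gr
  refine Real.sqrt_le_iff.2 ⟨by linarith, ?_⟩
  have := sq_le_sq' (by linarith [abs_nonneg (gx d x y)]) h1
  have := sq_le_sq' (by linarith [abs_nonneg (gy d x y)]) h2
  rw [sq_abs] at *
  nlinarith
lemma Fs_sub {c d} (hc : Rapid c) (hd : Rapid d) (φ x y) : Fs φ (fun k => c k - d k) x y = Fs φ c x y - Fs φ d x y := by
  unfold Fs
  rw [← (hc.Fs_summable φ x y).tsum_sub (hd.Fs_summable φ x y)]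
  congr 1; ext k; ring
lemma Rapid.sub {c d} (hc : Rapid c) (hd : Rapid d) : Rapid fun k => c k - d k := by
  have : Rapid fun k => -1 * d k := hd.mul_bd (A := 1) (d := fun _ => -1) (by simp)
  simpa [sub_eq_add_neg] using hc.add this
lemma gx_sub {c d} (hc : Rapid c) (hd : Rapid d) (x y) : gx (fun k => c k - d k) x y = gx c x y - gx d x y := by
  unfold gx; rw [← Fs_sub hc.k1 hd.k1]; congr 1; ext k; ring
lemma gy_sub {c d} (hc : Rapid c) (hd : Rapid d) (x y) : gy (fun k => c k - d k) x y = gy c x y - gy d x y := by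
  unfold gy; rw [← Fs_sub hc.k2 hd.k2]; congr 1; ext k; ring
lemma sqrt_tri (a b c d : ℝ) : √(a^2+b^2) ≤ √(c^2+d^2) + √((a-c)^2+(b-d)^2) := by
  have h := norm_add_le (⟨c, d⟩ : ℂ) ⟨a - c, b - d⟩
  simp only [Complex.norm_def, Complex.normSq_apply, Complex.add_re, Complex.add_im] at h
  rw [show a^2+b^2 = (c + (a - c)) * (c + (a - c)) + (d + (b - d)) * (d + (b - d)) by ring, show c^2+d^2 = c*c+d*d by ring,
    show (a-c)^2+(b-d)^2 = (a - c) * (a - c) + (b - d) * (b - d) by ring]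
  exact h
lemma gr_tri {c d} (hc : Rapid c) (hd : Rapid d) (x y) : gr c x y ≤ gr d x y + 2 * ∑' k, br k * |c k - d k| := by
  refine le_trans ?_ (add_le_add_right ((hc.sub hd).gr_le x y) _)
  unfold gr
  rw [gx_sub hc hd, gy_sub hc hd]
  exact sqrt_tri _ _ _ _

lemma Sol.cont {b c} (h : Sol b c) (k) : ContinuousOn (fun t => c t k) (Icc 0 b) :=
  fun t ht => (h.der t ht k).continuousWithinAt

/-- weighted distance is continuous -/
lemma Sol.dist_cont {b c} (h : Sol b c) (s : ℕ) (t0 : ℝ) (ht0 : t0 ∈ Icc 0 b) :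
    ContinuousOn (fun t => ∑' k, br k ^ s * |c t k - c t0 k|) (Icc 0 b) := by
  obtain ⟨u, su, hu⟩ := (h.ub.wt (w := fun k => br k ^ s) (m := s) (C := 1) fun k => by
    rw [abs_of_pos (pow_pos (br_pos k) s), one_mul]).sum
  refine continuousOn_tsum (u := fun k => u k + u k) (fun k => ?_) (su.add su) ?_
  · exact continuousOn_const.mul ((h.cont k).sub continuousOn_const).abs
  · intro k t ht
    have h1 := hu t ht k
    have h2 := hu t0 ht0 k
    have hp := pow_pos (br_pos k) s
    rw [abs_mul, abs_of_pos hp] at h1 h2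
    rw [norm_mul, norm_of_nonneg hp.le, norm_of_nonneg (abs_nonneg _)]
    have := abs_sub (c t k) (c t0 k)
    nlinarith

lemma Sol.gr_cont {b c} (h : Sol b c) (x y : ℝ) : ContinuousOn (fun t => gr (c t) x y) (Icc 0 b) := by
  have key : ∀ w : ℤ × ℤ → ℝ, (∀ k, |w k| ≤ 1 * br k ^ 1) → ContinuousOn (fun t => Fs (0 + π / 2) (fun k => w k * c t k) x y) (Icc 0 b) := by
    intro w hw
    obtain ⟨u, su, hu⟩ := (h.ub.wt hw).sum
    exact continuousOn_tsum (fun k => ((h.cont k).const_mul (w k)).mul_const _) su fun k t ht => (norm_mul_cos_le _ _).trans (hu t ht k)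
  unfold gr
  exact (((key _ k1_le).pow 2).add ((key _ k2_le).pow 2)).sqrt

lemma neg_interior {T M : ℝ} (hT : 0 < T) (hM : 0 ≤ M) (hneg : ¬ Claim T M) {b c} (h : Sol b c) (hb : b ≤ T) {s t : ℝ}
    (hs : 0 < s) (hst : s < t) (ht : t < b) {B G : ℝ} (hB : B < 2) (hB1 : ∀ x y, |Fs 0 (c s) x y| ≤ B)
    (hG : ∀ x y, gr (c s) x y ≤ G) (h0 : ∃ x y, 0 < gr (c s) x y) (x y : ℝ) : gr (c t) x y ≤ M * G := by
  by_contra hcon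
  push Not at hcon
  apply hneg
  set μ := (t - s) / T with hμ
  have hμ0 : 0 < μ := div_pos (by linarith) hT
  have hμ1 : μ ≤ 1 := by rw [hμ, div_le_one hT]; linarith
  have hμT : s + μ * T = t := by rw [hμ]; field_simp; ring
  refine ⟨_, _, h.euler hs hμ0 hT (by rw [hμT]; exact ht), ?_, ?_, T, ⟨hT.le, le_rfl⟩, ?_⟩
  all_goals
    have rs : Rapid (c s) := h.rapid ⟨hs.le, by linarith⟩
    have rt : Rapid (c t) := h.rapid ⟨by linarith, ht.le⟩
    have gs : ∀ τ, Rapid (c (s + μ * τ)) → gradSupNorm (fun x y τ => μ * Fs 0 (c (s + μ * τ)) x y) τ = ⨆ p : ℝ × ℝ, μ * gr (c (s + μ * τ)) p.1 p.2 := by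
      intro τ hr
      unfold gradSupNorm
      congr 1; ext p
      have e3 : pX (fun x y τ => μ * Fs 0 (c (s + μ * τ)) x y) p.1 p.2 τ = μ * gx (c (s + μ * τ)) p.1 p.2 :=
        ((hr.gxd _ _).const_mul μ).deriv
      have e4 : pY (fun x y τ => μ * Fs 0 (c (s + μ * τ)) x y) p.1 p.2 τ = μ * gy (c (s + μ * τ)) p.1 p.2 :=
        ((hr.gyd _ _).const_mul μ).deriv
      rw [e3, e4, gr, ← Real.sqrt_sq hμ0.le, ← Real.sqrt_mul (by positivity), Real.sqrt_sq hμ0.le]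
      congr 1; ring
    have bdd : ∀ d, Rapid d → BddAbove (range fun p : ℝ × ℝ => μ * gr d p.1 p.2) := by
      intro d hd
      refine ⟨μ * (2 * ∑' k, br k * |d k|), ?_⟩
      rintro _ ⟨p, rfl⟩
      exact mul_le_mul_of_nonneg_left (hd.gr_le _ _) hμ0.le
  · refine lt_of_le_of_lt (ciSup_le fun p => ?_) hB
    simp only [mul_zero, add_zero, abs_mul, abs_of_pos hμ0]
    have := hB1 p.1 p.2
    have h3 := abs_nonneg (Fs 0 (c s) p.1 p.2)
    nlinarith
  · obtain ⟨x0, y0, h0⟩ := h0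
    rw [gs 0 (by simpa using rs)]
    simp only [mul_zero, add_zero]
    exact lt_of_lt_of_le (mul_pos hμ0 h0) (le_ciSup (bdd _ rs) (x0, y0))
  · rw [gs 0 (by simpa using rs), gs T (by rw [hμT]; exact rt)]
    simp only [mul_zero, add_zero, hμT]
    have h1 : (⨆ p : ℝ × ℝ, μ * gr (c s) p.1 p.2) ≤ μ * G := ciSup_le fun p => mul_le_mul_of_nonneg_left (hG _ _) hμ0.le
    have h2 := le_ciSup (bdd _ rt) (x, y)
    simp only at h2
    have h3 := mul_lt_mul_of_pos_left hcon hμ0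
    have h4 := mul_le_mul_of_nonneg_left h1 hM
    nlinarith

/-- consequence of the failure of the claim -/
lemma neg_bound {T M : ℝ} (hT : 0 < T) (hM : 1 ≤ M) (hneg : ¬ Claim T M) {b c} (h : Sol b c) (hb0 : 0 < b) (hb : b ≤ T) 
    {G : ℝ} (hB1 : ∀ x y, |Fs 0 (c 0) x y| ≤ 1)
    (hG : ∀ x y, gr (c 0) x y ≤ G) (h0 : ∃ x y, 0 < gr (c 0) x y) {t} (ht : t ∈ Icc 0 b) (x y : ℝ) : gr (c t) x y ≤ M * G := by
  have z : (0:ℝ) ∈ Icc 0 b := ⟨le_rfl, hb0.le⟩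
  have hG0 : 0 ≤ G := (Real.sqrt_nonneg _).trans (hG 0 0)
  set N : ℝ → ℝ := fun s => ∑' k, br k ^ 1 * |c s k - c 0 k| with hN
  have hNc := h.dist_cont 1 0 z
  have hN0 : N 0 = 0 := by simp [hN]
  have hNt : Tendsto N (𝓝[>] 0) (𝓝 0) := by
    have := (hNc 0 z).tendsto
    rw [show (∑' k, br k ^ 1 * |c 0 k - c 0 k|) = 0 by simp] at this
    exact this.mono_left (nhdsWithin_le_of_mem (by
      exact mem_of_superset (Ioo_mem_nhdsGT hb0) Ioo_subset_Icc_self))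
  have interior : ∀ t ∈ Ioo 0 b, gr (c t) x y ≤ M * G := by
    intro t ht
    obtain ⟨x0, y0, h0⟩ := h0
    have hlim : Tendsto (fun s => M * (G + 2 * N s)) (𝓝[>] 0) (𝓝 (M * G)) := by
      have := (((hNt.const_mul 2).const_add G).const_mul M)
      simpa using this
    refine ge_of_tendsto hlim ?_
    have e1 : ∀ᶠ s in 𝓝[>] (0:ℝ), N s < 1/2 := hNt.eventually_lt_const (by norm_num)
    have e2 : ∀ᶠ s in 𝓝[>] (0:ℝ), N s < gr (c 0) x0 y0 / 2 := hNt.eventually_lt_const (by linarith)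
    filter_upwards [e1, e2, Ioo_mem_nhdsGT ht.1] with s h1 h2 hs
    have rs : Rapid (c s) := h.rapid ⟨hs.1.le, by linarith [hs.2, ht.2]⟩
    have r0 : Rapid (c 0) := h.rapid z
    have hNs : N s = ∑' k, br k * |c s k - c 0 k| := by simp [hN]
    have hNs' : N s = ∑' k, br k * |c 0 k - c s k| := by simp only [hNs, abs_sub_comm]
    refine neg_interior hT (by linarith) hneg h hb hs.1 hs.2 ht.2 (B := 3/2) (by norm_num) ?_ ?_ ⟨x0, y0, ?_⟩ x y
    · intro x y
      have a1 := (rs.sub r0).Fs_le 0 x y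
      rw [Fs_sub rs r0] at a1
      have a2 : (∑' k, |c s k - c 0 k|) ≤ N s := by
        rw [hNs]
        refine Summable.tsum_le_tsum (fun k => ?_) (rs.sub r0).abs.summable (rs.sub r0).br1
        exact le_mul_of_one_le_left (abs_nonneg _) (br_one k)
      have a3 := hB1 x y
      have a4 := abs_sub_abs_le_abs_sub (Fs 0 (c s) x y) (Fs 0 (c 0) x y)
      linarith
    · intro x y
      have := gr_tri rs r0 x y
      have := hG x y
      rw [hNs]; linarith
    · have := gr_tri r0 rs x0 y0
      rw [← hNs'] at this; linarith
  have hcl : closure (Ioo 0 b) = Icc 0 b := closure_Ioo hb0.ne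
  have : ∀ t ∈ closure (Ioo 0 b), gr (c t) x y ≤ M * G := by
    intro t ht'
    refine ContinuousWithinAt.closure_le (f := fun t => gr (c t) x y) (s := Ioo 0 b) ht' ?_ (g := fun _ => M * G) continuousWithinAt_const interior
    exact ((h.gr_cont x y) t (hcl ▸ ht')).mono Ioo_subset_Icc_self
  exact this t (by rwa [hcl])

end EU

end

section
open Real MeasureTheory Set Filter Topology

namespace EU

/-- one-dimensional period measure -/
noncomputable def nu : Measure ℝ := volume.restrict (Ioc 0 (2 * π))
instance : IsFiniteMeasure nu := by unfold nu; infer_instance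
lemma nu_real : nu.real univ = 2 * π := by
  have : (0:ℝ) ≤ 2 * π := by positivity
  simp [nu, Measure.real, pi_pos.le]

lemma nu_cos (m : ℤ) (α : ℝ) : ∫ x, cos (m * x + α) ∂nu = if m = 0 then 2 * π * cos α else 0 := by
  have h0 : (0:ℝ) ≤ 2 * π := by positivity
  rw [nu, ← intervalIntegral.integral_of_le h0]
  split_ifs with hm
  · subst hm; simp
  · have hm' : (m:ℝ) ≠ 0 := by exact_mod_cast hm
    rw [intervalIntegral.integral_comp_mul_add (fun x => cos x) hm' α, integral_cos]
    rw [show (m:ℝ) * (2 * π) + α = α + m * (2 * π) by ring, Real.sin_add_int_mul_two_pi]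
    simp

/-- two-dimensional period measure -/
noncomputable def mu2 : Measure (ℝ × ℝ) := nu.prod nu
instance : IsFiniteMeasure mu2 := by unfold mu2; infer_instance
lemma mu2_real : mu2.real univ = 4 * π ^ 2 := by
  have : mu2.real univ = nu.real univ * nu.real univ := by
    rw [mu2, ← univ_prod_univ]; exact measureReal_prod_prod _ _
  rw [this, nu_real]; ring

lemma mu2_cos (m : ℤ × ℤ) (α : ℝ) : ∫ z, cos (m.1 * z.1 + m.2 * z.2 + α) ∂mu2 = if m = 0 then 4 * π ^ 2 * cos α else 0 := by
  have e : ∀ z : ℝ × ℝ, cos (m.1 * z.1 + m.2 * z.2 + α) = cos (m.1 * z.1 + 0) * cos (m.2 * z.2 + α)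
      - cos (m.1 * z.1 + π / 2) * cos (m.2 * z.2 + (α + π / 2)) := fun z => by
    rw [add_zero, ← add_assoc, Real.cos_add_pi_div_two, Real.cos_add_pi_div_two, add_assoc, Real.cos_add]; ring
  have bdi : ∀ f : ℝ × ℝ → ℝ, Continuous f → (∀ z, |f z| ≤ 1) → Integrable f mu2 := fun f hf hb =>
    Integrable.of_bound hf.aestronglyMeasurable 1 (ae_of_all _ hb)
  have cc : ∀ a b : ℝ, |cos a * cos b| ≤ 1 := fun a b => by
    rw [abs_mul]; exact mul_le_one₀ (abs_cos_le_one _) (abs_nonneg _) (abs_cos_le_one _)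
  simp only [e]
  rw [integral_sub (bdi _ (by fun_prop) fun z => cc _ _) (bdi _ (by fun_prop) fun z => cc _ _)]
  rw [mu2, integral_prod_mul (fun x => cos (m.1 * x + 0)) (fun y => cos (m.2 * y + α)),
    integral_prod_mul (fun x => cos (m.1 * x + π / 2)) (fun y => cos (m.2 * y + (α + π / 2)))]
  simp only [nu_cos]
  obtain ⟨a, b⟩ := m
  simp only [Prod.mk_eq_zero, cos_pi_div_two, cos_zero]
  by_cases ha : a = 0 <;> by_cases hb : b = 0 <;> simp [ha, hb]
  ring

lemma mu2_int {f : ℝ × ℝ → ℝ} (hf : Continuous f) {A : ℝ} (hb : ∀ z, |f z| ≤ A) : Integrable f mu2 :=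
    Integrable.of_bound hf.aestronglyMeasurable A (ae_of_all _ hb)

lemma Rapid.Fs_cont {d} (h : Rapid d) (φ : ℝ) : Continuous fun z : ℝ × ℝ => Fs φ d z.1 z.2 := by
  unfold Fs
  exact continuous_tsum (fun k => by fun_prop) h.abs.summable fun k z => norm_mul_cos_le _ _

/-- integrate a series against a bounded function -/
lemma Rapid.int_mul {d} (h : Rapid d) (φ : ℝ) {g : ℝ × ℝ → ℝ} (hg : Continuous g) {A : ℝ} (hA : ∀ z, |g z| ≤ A) :
    ∫ z, Fs φ d z.1 z.2 * g z ∂mu2 = ∑' k, d k * ∫ z, cos (k.1 * z.1 + k.2 * z.2 + φ) * g z ∂mu2 := by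
  have hbd : ∀ (k : ℤ × ℤ) (z : ℝ × ℝ), |d k * (cos (k.1 * z.1 + k.2 * z.2 + φ) * g z)| ≤ |d k| * A := fun k z => by
    rw [abs_mul, abs_mul]
    have := abs_cos_le_one (k.1 * z.1 + k.2 * z.2 + φ)
    have := hA z
    have := abs_nonneg (g z)
    gcongr
    nlinarith
  have hi : ∀ k : ℤ × ℤ, Integrable (fun z : ℝ × ℝ => d k * (cos (k.1 * z.1 + k.2 * z.2 + φ) * g z)) mu2 := fun k =>
    mu2_int (by fun_prop) (hbd k)
  have := hasSum_integral_of_summable_integral_norm hi (by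
    refine Summable.of_nonneg_of_le (fun k => by positivity) (fun k => ?_) ((h.abs.summable.mul_right A).mul_right (mu2.real univ))
    have := integral_mono (hi k).norm (integrable_const (|d k| * A)) (hbd k)
    rw [integral_const, smul_eq_mul, mul_comm] at this
    exact this)
  have h2 := this.tsum_eq
  simp only [integral_const_mul] at h2
  rw [h2]
  congr 1; ext z
  rw [Fs, ← tsum_mul_right]
  congr 1; ext k; ring

lemma parseval {d} (h : Rapid d) (ho : ∀ k, d (-k) = - d k) :
    ∫ z, Fs (0 + π / 2) d z.1 z.2 * Fs (0 + π / 2) d z.1 z.2 ∂mu2 = 4 * π ^ 2 * ∑' k, d k ^ 2 := by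
  rw [h.int_mul _ (h.Fs_cont _) (A := ∑' k, |d k|) fun z => h.Fs_le _ _ _, ← tsum_mul_left]
  congr 1; ext k
  simp only [mul_comm (cos _) (Fs _ _ _ _)]
  rw [h.int_mul _ (by fun_prop) (A := 1) fun z => abs_cos_le_one _]
  have key : ∀ j : ℤ × ℤ, ∫ z : ℝ × ℝ, cos (j.1 * z.1 + j.2 * z.2 + (0 + π / 2)) * cos (k.1 * z.1 + k.2 * z.2 + (0 + π / 2)) ∂mu2
      = 2 * π ^ 2 * ((if j = k then 1 else 0) - (if j = -k then 1 else 0)) := by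
    intro j
    have e : ∀ z : ℝ × ℝ, cos (j.1 * z.1 + j.2 * z.2 + (0 + π / 2)) * cos (k.1 * z.1 + k.2 * z.2 + (0 + π / 2))
       = (1/2) * cos ((j - k).1 * z.1 + (j - k).2 * z.2 + 0) + (1/2) * cos ((j + k).1 * z.1 + (j + k).2 * z.2 + π) := fun z => by
      have e1 : ((j - k).1 : ℝ) * z.1 + (j - k).2 * z.2 + 0 = (j.1 * z.1 + j.2 * z.2 + (0 + π / 2)) - (k.1 * z.1 + k.2 * z.2 + (0 + π / 2)) := by
        push_cast [Prod.fst_sub, Prod.snd_sub]; ring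
      have e2 : ((j + k).1 : ℝ) * z.1 + (j + k).2 * z.2 + π = (j.1 * z.1 + j.2 * z.2 + (0 + π / 2)) + (k.1 * z.1 + k.2 * z.2 + (0 + π / 2)) := by
        push_cast [Prod.fst_add, Prod.snd_add]; ring
      rw [e1, e2]
      generalize ((j.1:ℝ) * z.1 + j.2 * z.2 + (0 + π / 2)) = A
      generalize ((k.1:ℝ) * z.1 + k.2 * z.2 + (0 + π / 2)) = B
      rw [cos_sub, cos_add]; ring
    simp only [e]
    rw [integral_add (mu2_int (by fun_prop) (A := 1/2) fun z => ?_) (mu2_int (by fun_prop) (A := 1/2) fun z => ?_),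
      integral_const_mul, integral_const_mul, mu2_cos, mu2_cos]
    · simp only [sub_eq_zero, add_eq_zero_iff_eq_neg, cos_zero, cos_pi]
      split_ifs <;> ring
    all_goals
      rw [abs_mul, abs_of_pos (by norm_num : (0:ℝ) < 1/2)]
      have := abs_cos_le_one
      linarith [abs_cos_le_one (((j - k).1 : ℝ) * z.1 + (j - k).2 * z.2 + 0), abs_cos_le_one (((j + k).1 : ℝ) * z.1 + (j + k).2 * z.2 + π)]
  simp only [key]
  have e : ∀ j, d j * (2 * π ^ 2 * ((if j = k then 1 else 0) - (if j = -k then 1 else 0)))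
     = (if j = k then 2 * π ^ 2 * d k else 0) + (if j = -k then 2 * π ^ 2 * d k else 0) := by
    intro j
    by_cases h1 : j = k <;> by_cases h2 : j = -k
    · have := ho k; rw [← h2, h1] at this
      have h0 : d k = 0 := by linarith
      simp [h1, h0]
    · rw [if_pos h1, if_neg h2, if_pos h1, if_neg h2, h1]; ring
    · rw [if_neg h1, if_pos h2, if_neg h1, if_pos h2, h2, ho]; ring
    · simp [h1, h2]
  simp only [e]
  rw [Summable.tsum_add, tsum_ite_eq, tsum_ite_eq]
  · ring
  · exact (hasSum_ite_eq k _).summable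
  · exact (hasSum_ite_eq (-k) _).summable

/-- gradient bound controls the Dirichlet sum -/
lemma dirichlet {d} (h : Rapid d) (he : ∀ k, d (-k) = d k) {G : ℝ} (hG : ∀ x y, gr d x y ≤ G) :
    Summable (fun k => nsq k * d k ^ 2) ∧ ∑' k, nsq k * d k ^ 2 ≤ G ^ 2 := by
  have p1 := parseval h.k1 fun k => by simp [he]
  have p2 := parseval h.k2 fun k => by simp [he]
  have s1 : Summable fun k : ℤ × ℤ => ((k.1:ℝ) * d k) ^ 2 := by simpa using h.k1.sq_summable 0
  have s2 : Summable fun k : ℤ × ℤ => ((k.2:ℝ) * d k) ^ 2 := by simpa using h.k2.sq_summable 0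
  have e : (fun k => nsq k * d k ^ 2) = fun k : ℤ × ℤ => ((k.1:ℝ) * d k) ^ 2 + ((k.2:ℝ) * d k) ^ 2 := by
    ext k; unfold nsq; ring
  rw [e]
  refine ⟨s1.add s2, ?_⟩
  rw [s1.tsum_add s2]
  have G0 : 0 ≤ G := (Real.sqrt_nonneg _).trans (hG 0 0)
  have hb : ∀ z : ℝ × ℝ, gx d z.1 z.2 * gx d z.1 z.2 + gy d z.1 z.2 * gy d z.1 z.2 ≤ G ^ 2 := fun z => by
    have := (Real.sqrt_le_left G0).1 (hG z.1 z.2)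
    nlinarith
  have i1 : Integrable (fun z : ℝ × ℝ => gx d z.1 z.2 * gx d z.1 z.2) mu2 :=
    mu2_int ((h.k1.Fs_cont _).mul (h.k1.Fs_cont _)) (A := G ^ 2) fun z => by
      rw [abs_of_nonneg (mul_self_nonneg _)]; linarith [hb z, mul_self_nonneg (gy d z.1 z.2)]
  have i2 : Integrable (fun z : ℝ × ℝ => gy d z.1 z.2 * gy d z.1 z.2) mu2 :=
    mu2_int ((h.k2.Fs_cont _).mul (h.k2.Fs_cont _)) (A := G ^ 2) fun z => by
      rw [abs_of_nonneg (mul_self_nonneg _)]; linarith [hb z, mul_self_nonneg (gx d z.1 z.2)]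
  have := integral_mono (i1.add i2) (integrable_const (G ^ 2)) hb
  rw [integral_const, smul_eq_mul, mu2_real] at this
  simp only [Pi.add_apply] at this
  rw [integral_add i1 i2] at this
  unfold gx gy at this
  rw [p1, p2, ← mul_add] at this
  exact le_of_mul_le_mul_left this (by positivity)

end EU

end

section
open Real MeasureTheory Set Filter Topology

namespace EU

/-- harmonic numbers -/
noncomputable def har (n : ℕ) : ℝ := ∑ i ∈ Finset.range n, ((i:ℝ) + 1)⁻¹
lemma har_le (n : ℕ) : har n ≤ 1 + log n := by
  have := harmonic_le_one_add_log n
  unfold harmonic at this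
  push_cast at this
  exact this
lemma har_mono : Monotone har := fun m n h =>
  Finset.sum_le_sum_of_subset_of_nonneg (Finset.range_mono h) fun i _ _ => by positivity

/-- one-dimensional weight -/
noncomputable def gw (N : ℕ) (x : ℝ) : ℝ := ((1 + |x|) * (1 + (1 + |x|) / N))⁻¹
lemma gw_nonneg (N x) : 0 ≤ gw N x := by unfold gw; positivity
lemma gw_sum {N : ℕ} (hN : 1 ≤ N) (P : ℕ) : ∑ n ∈ Finset.range P, gw N n = har N + har P - har (P + N) := by
  induction P with
  | zero => simp [har]
  | succ P ih =>
    rw [Finset.sum_range_succ, ih]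
    have : P + 1 + N = (P + N) + 1 := by ring
    rw [this]
    unfold har gw
    rw [Finset.sum_range_succ _ P, Finset.sum_range_succ _ (P + N), Nat.abs_cast]
    have h1 : (0:ℝ) < N := by exact_mod_cast hN
    push_cast
    have h2 : (0:ℝ) < P + 1 := by positivity
    have e : ((1 + (P:ℝ)) * (1 + (1 + P) / N))⁻¹ = ((P:ℝ) + 1)⁻¹ - ((P:ℝ) + N + 1)⁻¹ := by
      field_simp; ring
    rw [e]; ring
lemma gw_partial {N : ℕ} (hN : 1 ≤ N) (P : ℕ) : ∑ n ∈ Finset.range P, gw N n ≤ har N := by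
  rw [gw_sum hN]
  linarith [har_mono (Nat.le_add_right P N)]
lemma gw_summ_nat {N : ℕ} (hN : 1 ≤ N) : Summable fun n : ℕ => gw N n :=
  summable_of_sum_range_le (fun n => gw_nonneg N n) (gw_partial hN)
lemma gw_tsum_nat {N : ℕ} (hN : 1 ≤ N) : ∑' n : ℕ, gw N n ≤ har N :=
  Real.tsum_le_of_sum_range_le (fun n => gw_nonneg N n) (gw_partial hN)
lemma gw_int {N : ℕ} (hN : 1 ≤ N) : Summable (fun n : ℤ => gw N n) ∧ ∑' n : ℤ, gw N n ≤ 2 * har N := by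
  have h1 : HasSum (fun n : ℕ => gw N ((n:ℤ):ℝ)) (∑' n : ℕ, gw N n) := by simpa using (gw_summ_nat hN).hasSum
  have h2 : HasSum (fun n : ℕ => gw N (((-((n:ℤ) + 1) : ℤ)):ℝ)) (∑' n : ℕ, gw N ((n + 1 : ℕ):ℝ)) := by
    have := ((summable_nat_add_iff 1).2 (gw_summ_nat hN)).hasSum
    have e : ∀ n : ℕ, gw N (((-((n:ℤ) + 1) : ℤ)):ℝ) = gw N ((n + 1 : ℕ):ℝ) := fun n => by
      unfold gw; push_cast; rw [abs_neg]
    simp only [e]; exact this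
  have h3 := HasSum.of_nat_of_neg_add_one (f := fun n : ℤ => gw N n) h1 h2
  refine ⟨h3.summable, ?_⟩
  rw [h3.tsum_eq]
  have h4 := gw_tsum_nat hN
  have h5 := (gw_summ_nat hN).tsum_eq_zero_add
  have := gw_nonneg N ((0:ℕ):ℝ)
  linarith

/-- the two-dimensional logarithmic sum -/
lemma log_S {N : ℕ} (hN : 1 ≤ N) : Summable (fun k : ℤ × ℤ => ((br k * (1 + br k / N))⁻¹) ^ 2) ∧
    ∑' k : ℤ × ℤ, ((br k * (1 + br k / N))⁻¹) ^ 2 ≤ 4 * (1 + log N) ^ 2 := by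
  obtain ⟨s, hs⟩ := gw_int hN
  have sp : Summable fun k : ℤ × ℤ => gw N k.1 * gw N k.2 := s.mul_of_nonneg s (fun n => gw_nonneg N n) (fun n => gw_nonneg N n)
  have h1 : (0:ℝ) < N := by exact_mod_cast hN
  have le : ∀ k : ℤ × ℤ, ((br k * (1 + br k / N))⁻¹) ^ 2 ≤ gw N k.1 * gw N k.2 := by
    intro k
    have key : ∀ u : ℝ, 0 ≤ u → 1 + u ≤ br k → (br k * (1 + br k / N))⁻¹ ≤ ((1 + u) * (1 + (1 + u) / N))⁻¹ := by
      intro u hu h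
      apply inv_anti₀ (by positivity)
      have := br_pos k
      gcongr
    rw [sq]
    have hb := br_pos k
    refine mul_le_mul (key _ (abs_nonneg _) ?_) (key _ (abs_nonneg _) ?_) (by positivity) (gw_nonneg _ _)
    · unfold br; linarith [abs_nonneg (k.2:ℝ)]
    · unfold br; linarith [abs_nonneg (k.1:ℝ)]
  have ss := Summable.of_nonneg_of_le (fun k => by positivity) le sp
  refine ⟨ss, (ss.tsum_le_tsum le sp).trans ?_⟩
  rw [← s.tsum_mul_tsum s sp]
  have := har_le N
  have h0 : 0 ≤ ∑' n : ℤ, gw N n := tsum_nonneg fun n => gw_nonneg N n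
  nlinarith

lemma log_sum {d} (hd : Rapid d) {N : ℕ} (hN : 1 ≤ N) :
    (∑' k, |d k| / br k) ^ 2 ≤ (2 * ∑' k, d k ^ 2 + 2 / N ^ 2 * ∑' k, br k ^ 2 * d k ^ 2) * (4 * (1 + log N) ^ 2) := by
  have h1 : (0:ℝ) < N := by exact_mod_cast hN
  have s0 : Summable fun k => d k ^ 2 := by simpa using hd.sq_summable 0
  have s2 := hd.sq_summable 2
  have le : ∀ k, (|d k| * (1 + br k / N)) ^ 2 ≤ 2 * d k ^ 2 + 2 / N ^ 2 * (br k ^ 2 * d k ^ 2) := by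
    intro k
    rw [mul_pow, sq_abs]
    have : (1 + br k / N) ^ 2 ≤ 2 + 2 * (br k / N) ^ 2 := by nlinarith [sq_nonneg (1 - br k / N)]
    calc _ ≤ d k ^ 2 * (2 + 2 * (br k / N) ^ 2) := by gcongr
      _ = _ := by field_simp
  have sR : Summable fun k => 2 * d k ^ 2 + 2 / N ^ 2 * (br k ^ 2 * d k ^ 2) := (s0.mul_left 2).add (s2.mul_left _)
  have sf : Summable fun k => (|d k| * (1 + br k / N)) ^ 2 := Summable.of_nonneg_of_le (fun k => by positivity) le sR
  obtain ⟨sg, hg⟩ := log_S hN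
  obtain ⟨-, h⟩ := cs sf sg
  have e : ∀ k, |d k| * (1 + br k / N) * (br k * (1 + br k / N))⁻¹ = |d k| / br k := by
    intro k
    have := br_pos k
    field_simp
  simp only [e] at h
  refine h.trans ?_
  have h2 := sf.tsum_le_tsum le sR
  rw [(s0.mul_left 2).tsum_add (s2.mul_left _), tsum_mul_left, tsum_mul_left] at h2
  exact mul_le_mul h2 hg (tsum_nonneg fun k => by positivity) ((tsum_nonneg fun k => by positivity).trans h2)

lemma Sol.En_cont {b c} (h : Sol b c) (s : ℕ) : ContinuousOn (fun t => En s (c t)) (Icc 0 b) := by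
  obtain ⟨u, su, hu⟩ := (h.ub.wt (w := fun k => br k ^ s) (m := s) (C := 1) fun k => by
    rw [abs_of_pos (pow_pos (br_pos k) s), one_mul]).sum
  obtain ⟨A, hA⟩ := h.ub s
  refine continuousOn_tsum (u := fun k => A * u k) (fun k => ?_) (su.mul_left A) ?_
  · exact continuousOn_const.mul ((h.cont k).pow 2)
  · intro k t ht
    have h1 := hu t ht k
    have h2 := hA t ht k
    have hp := pow_pos (br_pos k) s
    rw [abs_mul, abs_of_pos hp] at h1
    rw [norm_of_nonneg (mul_nonneg (pow_pos (br_pos k) _).le (sq_nonneg _)), show br k ^ (2 * s) * c t k ^ 2 = (|c t k| * br k ^ s) * (br k ^ s * |c t k|) by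
      rw [← sq_abs (c t k)]; ring]
    have := abs_nonneg (c t k)
    have hA0 : 0 ≤ A := le_trans (mul_nonneg (abs_nonneg _) hp.le) h2
    gcongr

lemma Sol.En_der {b c} (h : Sol b c) (s : ℕ) {t} (ht : t ∈ Ioo 0 b) :
    HasDerivAt (fun t => En s (c t)) (2 * ∑' k, br k ^ (2 * s) * (c t k * nl (c t) k)) t := by
  have hU := h.ub.mono (Ioo_subset_Icc_self (a := 0) (b := b))
  obtain ⟨u, su, hu⟩ := ((hU.bil hU).wt (w := fun k => br k ^ s) (m := s) (C := 1) fun k => by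
    rw [abs_of_pos (pow_pos (br_pos k) s), one_mul]).sum
  obtain ⟨A, hA⟩ := hU s
  rw [← tsum_mul_left]
  refine hasDerivAt_tsum_of_isPreconnected (t := Ioo 0 b) (su.mul_left (2 * A)) isOpen_Ioo isPreconnected_Ioo
    (g' := fun k t => 2 * (br k ^ (2 * s) * (c t k * nl (c t) k))) ?_ ?_ ht ?_ ht
  · intro k t ht
    refine (((h.hasDerivAt ht k).fun_pow 2).const_mul (br k ^ (2 * s))).congr_deriv ?_
    push_cast; ring
  · intro k t ht
    have h1 := hu t ht k
    have h2 := hA t ht k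
    have hp := pow_pos (br_pos k) s
    rw [abs_mul, abs_of_pos hp] at h1
    rw [Real.norm_eq_abs, show 2 * (br k ^ (2 * s) * (c t k * nl (c t) k)) = 2 * ((c t k * br k ^ s) * (br k ^ s * nl (c t) k)) by ring,
      abs_mul, abs_mul, abs_mul, abs_mul, abs_of_pos hp, abs_two, ← mul_assoc 2 (_ * _)]
    change br k ^ s * |nl (c t) k| ≤ u k at h1
    have := abs_nonneg (nl (c t) k)
    have hA0 : 0 ≤ A := le_trans (mul_nonneg (abs_nonneg _) hp.le) h2
    gcongr
  · exact (hU.rapid ht).sq_summable _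

/-- log bound for the `ℓ¹` norm -/
lemma N1_log {d} (hd : Rapid d) (h0 : d 0 = 0) {H : ℝ} (hH : ∑' k, nsq k * d k ^ 2 ≤ H ^ 2) (hs : Summable fun k => nsq k * d k ^ 2) :
    ∑' k, |d k| ≤ √(16 * H ^ 2 + 2) * 2 * (1 + log (2 + En 2 d)) := by
  have hE := En_nonneg 2 d
  set N := ⌈1 + En 2 d⌉₊ with hN
  have hN1 : 1 ≤ N := Nat.one_le_ceil_iff.2 (by linarith)
  have hNr : (1:ℝ) ≤ N := by exact_mod_cast hN1
  have hNl : 1 + En 2 d ≤ N := Nat.le_ceil _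
  have hNu : (N:ℝ) ≤ 2 + En 2 d := by have := Nat.ceil_lt_add_one (a := 1 + En 2 d) (by linarith); linarith
  have h1 := log_sum (hd.br_mul 1) hN1
  have e1 : ∀ k, |br k ^ 1 * d k| / br k = |d k| := fun k => by
    have := br_pos k
    rw [pow_one, abs_mul, abs_of_pos this]; field_simp
  have e2 : ∑' k, (br k ^ 1 * d k) ^ 2 ≤ 8 * H ^ 2 := by
    refine le_trans ?_ (mul_le_mul_of_nonneg_left hH (by norm_num))
    rw [← tsum_mul_left]
    refine Summable.tsum_le_tsum (fun k => ?_) (by simpa using (hd.br_mul 1).sq_summable 0) (hs.mul_left 8)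
    by_cases hk : k = 0
    · subst hk; simp [h0]
    · have := br_sq_le hk
      have h3 := sq_nonneg (d k)
      nlinarith
  have e3 : ∑' k, br k ^ 2 * (br k ^ 1 * d k) ^ 2 = En 2 d := by
    unfold En; congr 1; ext k; ring
  simp only [e1, e3] at h1
  have e4 : 2 / (N:ℝ) ^ 2 * En 2 d ≤ 2 := by
    rw [div_mul_eq_mul_div, div_le_iff₀ (by positivity)]; nlinarith
  have hl : 0 ≤ log N := log_nonneg hNr
  have hl2 : log N ≤ log (2 + En 2 d) := log_le_log (by linarith) hNu
  have h5 : (∑' k, |d k|) ^ 2 ≤ (√(16 * H ^ 2 + 2) * 2 * (1 + log (2 + En 2 d))) ^ 2 := by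
    refine h1.trans ?_
    rw [mul_pow, mul_pow, Real.sq_sqrt (by positivity)]
    calc _ ≤ (16 * H ^ 2 + 2) * (4 * (1 + log (2 + En 2 d)) ^ 2) := by
          apply mul_le_mul
          · linarith
          · gcongr
          · positivity
          · positivity
      _ = _ := by ring
  exact le_of_sq_le_sq h5 (mul_nonneg (by positivity) (by linarith))

/-- the a priori growth exponent -/
noncomputable def KH (H : ℝ) : ℝ := 128 * √(16 * H ^ 2 + 2)

lemma apriori {b c} (h : Sol b c) {H : ℝ} (hH : ∀ t ∈ Icc 0 b, ∑' k, nsq k * c t k ^ 2 ≤ H ^ 2) :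
    ∀ t ∈ Icc 0 b, En 2 (c t) ≤ exp ((1 + log (2 + En 2 (c 0))) * exp (KH H * t)) := by
  intro t ht
  have hE := fun t => En_nonneg 2 (c t)
  have h1 := gronw (f := fun t => 1 + log (2 + En 2 (c t))) (b := b) (K := KH H)
    (f' := fun t => (2 * ∑' k, br k ^ (2 * 2) * (c t k * nl (c t) k)) / (2 + En 2 (c t))) ?_ ?_ ?_ t ht
  · have h2 : log (2 + En 2 (c t)) ≤ (1 + log (2 + En 2 (c 0))) * exp (KH H * t) := by linarith
    have := (log_le_iff_le_exp (by linarith [hE t])).1 h2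
    linarith
  · refine continuousOn_const.add (ContinuousOn.log (continuousOn_const.add (h.En_cont 2)) fun t ht => ?_)
    linarith [hE t]
  · intro t ht
    exact (((h.En_der 2 ht).const_add 2).log (by linarith [hE t])).const_add 1
  · intro t ht
    have ht' := Ioo_subset_Icc_self ht
    have hr := h.rapid ht'
    have hsym := h.sym t ht'
    rw [div_le_iff₀ (by linarith [hE t])]
    have e1 := (le_abs_self _).trans (energy hr hsym.even 2)
    have e2 := N1_log hr hsym.zero (hH t ht') (by
      refine Summable.of_nonneg_of_le (fun k => mul_nonneg (nsq_nonneg k) (sq_nonneg _)) (fun k => ?_) (hr.sq_summable 2)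
      exact mul_le_mul_of_nonneg_right (nsq_le_br k) (sq_nonneg _))
    have hN0 : 0 ≤ ∑' k, |c t k| := tsum_nonneg fun k => abs_nonneg _
    unfold KH
    set Z := √(16 * H ^ 2 + 2)
    set L := 1 + log (2 + En 2 (c t))
    have := hE t
    calc _ ≤ 2 * ((2:ℕ) * 2 ^ (2 + 2) * (∑' k, |c t k|) * En 2 (c t)) := mul_le_mul_of_nonneg_left e1 (by norm_num)
      _ ≤ 2 * ((2:ℕ) * 2 ^ (2 + 2) * (Z * 2 * L) * En 2 (c t)) := by gcongr
      _ = 128 * Z * L * En 2 (c t) := by push_cast; ring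
      _ ≤ 128 * Z * L * (2 + En 2 (c t)) := by
        have : 0 ≤ 128 * Z * L := by
          have : 0 ≤ Z * 2 * L := hN0.trans e2
          linarith
        nlinarith

/-- global existence under an a priori bound -/
lemma continuation {t0 H : ℝ} (ht0 : 0 < t0) {c0} (hs : Sym c0) (hr : Rapid c0)
    (hyp : ∀ t1 c, 0 < t1 → t1 ≤ t0 → Sol t1 c → c 0 = c0 → ∀ t ∈ Icc 0 t1, ∑' k, nsq k * c t k ^ 2 ≤ H ^ 2) :
    ∃ c, Sol t0 c ∧ c 0 = c0 := by
  set R := max (En 2 c0) (exp ((1 + log (2 + En 2 c0)) * exp (KH H * t0))) with hR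
  have hE0 := En_nonneg 2 c0
  obtain ⟨τ, hτ, hloc⟩ := local_exist R (hE0.trans (le_max_left _ _))
  have hK : 0 ≤ KH H := by unfold KH; positivity
  have ind : ∀ n : ℕ, ∀ t1, 0 < t1 → t1 ≤ t0 → t1 ≤ n * τ → ∃ c, Sol t1 c ∧ c 0 = c0 := by
    intro n
    induction n with
    | zero => intro t1 h1 h2 h3; simp at h3; linarith
    | succ n ih =>
      intro t1 h1 h2 h3
      push_cast at h3
      by_cases hle : t1 ≤ τ
      · obtain ⟨c, hc, hc0⟩ := hloc c0 hs hr (le_max_left _ _)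
        exact ⟨c, hc.mono hle, hc0⟩
      push Not at hle
      obtain ⟨c, hc, hc0⟩ := ih (t1 - τ) (by linarith) (by linarith) (by linarith)
      have ha : t1 - τ ∈ Icc 0 (t1 - τ) := ⟨by linarith, le_rfl⟩
      have hb := apriori hc (hyp _ c (by linarith) (by linarith) hc hc0) _ ha
      rw [hc0] at hb
      have hl : 0 ≤ 1 + log (2 + En 2 c0) := by have := log_nonneg (x := 2 + En 2 c0) (by linarith); linarith
      obtain ⟨d, hd, hd0⟩ := hloc (c (t1 - τ)) (hc.sym _ ha) (hc.rapid ha) (by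
        refine hb.trans (le_trans ?_ (le_max_right _ _))
        gcongr; linarith)
      have := hc.glue (by linarith) hτ.le hd hd0
      rw [sub_add_cancel] at this
      refine ⟨_, this, ?_⟩
      rw [if_pos (by linarith)]; exact hc0
  obtain ⟨n, hn⟩ := exists_nat_ge (t0 / τ)
  exact ind n t0 ht0 le_rfl (by rwa [div_le_iff₀ hτ] at hn)

/-- global solution and gradient bound, if the claim fails -/
lemma global {T M : ℝ} (hT : 0 < T) (hM : 1 ≤ M) (hneg : ¬ Claim T M) {t0 G : ℝ} (ht0 : 0 < t0) (ht0T : t0 ≤ T)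
    {c0} (hs : Sym c0) (hr : Rapid c0) (hB1 : ∀ x y, |Fs 0 c0 x y| ≤ 1)
    (hG : ∀ x y, gr c0 x y ≤ G) (h0 : ∃ x y, 0 < gr c0 x y) :
    ∃ c, Sol t0 c ∧ c 0 = c0 ∧ (∀ t ∈ Icc 0 t0, ∀ x y, gr (c t) x y ≤ M * G) ∧
      ∀ t ∈ Icc 0 t0, ∑' k, nsq k * c t k ^ 2 ≤ (M * G) ^ 2 := by
  have A : ∀ t1 c, 0 < t1 → t1 ≤ t0 → Sol t1 c → c 0 = c0 → ∀ t ∈ Icc 0 t1, ∀ x y, gr (c t) x y ≤ M * G := by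
    intro t1 c h1 h2 hc hc0 t ht x y
    exact neg_bound hT hM hneg hc h1 (by linarith) (by rwa [hc0]) (by rwa [hc0]) (by rwa [hc0]) ht x y
  have B : ∀ t1 c, 0 < t1 → t1 ≤ t0 → Sol t1 c → c 0 = c0 → ∀ t ∈ Icc 0 t1, ∑' k, nsq k * c t k ^ 2 ≤ (M * G) ^ 2 := by
    intro t1 c h1 h2 hc hc0 t ht
    exact (dirichlet (hc.rapid ht) (hc.sym t ht).even (A t1 c h1 h2 hc hc0 t ht)).2
  obtain ⟨c, hc, hc0⟩ := continuation ht0 hs hr B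
  exact ⟨c, hc, hc0, A t0 c ht0 le_rfl hc hc0, B t0 c ht0 le_rfl hc hc0⟩

end EU

end

section
open Real MeasureTheory Set Filter Topology

namespace EU

lemma const_int {f : ℝ → ℝ} {b : ℝ} (hc : ContinuousOn f (Icc 0 b)) (hd : ∀ t ∈ Ioo 0 b, HasDerivAt f 0 t) :
    ∀ t ∈ Icc 0 b, f t = f 0 := by
  intro t ht
  have z : (0:ℝ) ∈ Icc 0 b := ⟨le_rfl, ht.1.trans ht.2⟩
  have h1 := mono_Icc hc (f' := fun _ => 0) hd (fun _ _ => le_rfl) z ht ht.1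
  have h2 := mono_Icc hc.neg (f' := fun _ => -0) (fun t ht => (hd t ht).neg) (fun _ _ => by simp) z ht ht.1
  simp only [Pi.neg_apply] at h2
  linarith

lemma Sol.Fs_cont {b c} (h : Sol b c) {w : ℤ × ℤ → ℝ} {m : ℕ} {C : ℝ} (hw : ∀ k, |w k| ≤ C * br k ^ m) (φ x y : ℝ) :
    ContinuousOn (fun t => Fs φ (fun k => w k * c t k) x y) (Icc 0 b) := by
  obtain ⟨u, su, hu⟩ := (h.ub.wt hw).sum
  exact continuousOn_tsum (fun k => ((h.cont k).const_mul (w k)).mul_const _) su fun k t ht => (norm_mul_cos_le _ _).trans (hu t ht k)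

/-- one-dimensional profile coefficients -/
noncomputable def pp (a : ℝ) (n : ℤ) : ℝ := if Odd n then exp (-(a * |(n:ℝ)|)) / n else 0
lemma pp_neg (a n) : pp a (-n) = - pp a n := by
  unfold pp
  simp only [odd_neg, Int.cast_neg, abs_neg]
  split_ifs
  · rw [div_neg]
  · simp
lemma odd_one_le {n : ℤ} (hn : Odd n) : (1:ℝ) ≤ |(n:ℝ)| := by
  have : n ≠ 0 := by rintro rfl; simp at hn
  exact_mod_cast Int.one_le_abs this
lemma pp_le {a : ℝ} (n) : |pp a n| ≤ exp (-(a * |(n:ℝ)|)) := by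
  unfold pp
  split_ifs with h
  · rw [abs_div, abs_of_pos (exp_pos _)]
    exact div_le_self (exp_pos _).le (odd_one_le h)
  · simp [(exp_pos _).le]
/-- initial coefficients -/
noncomputable def c0 (a : ℝ) (k : ℤ × ℤ) : ℝ := -(4 / π ^ 2) * (pp a k.1 * pp a k.2)
lemma c0_sym (a) : Sym (c0 a) := by
  intro k1 k2
  simp only [c0, pp_neg]
  constructor <;> ring
lemma four_pi : 4 / π ^ 2 ≤ 1 := by
  rw [div_le_one (by positivity)]; nlinarith [pi_gt_three]
lemma c0_le (a : ℝ) (k) : |c0 a k| ≤ exp (-(a * (|(k.1:ℝ)| + |(k.2:ℝ)|))) := by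
  rw [c0, abs_mul, abs_mul, abs_neg, abs_of_nonneg (by positivity : (0:ℝ) ≤ 4 / π ^ 2)]
  have h1 := pp_le (a := a) k.1
  have h2 := pp_le (a := a) k.2
  calc _ ≤ 1 * (exp (-(a * |(k.1:ℝ)|)) * exp (-(a * |(k.2:ℝ)|))) := by
        gcongr
        exact four_pi
    _ = _ := by rw [one_mul, ← exp_add]; congr 1; ring
lemma c0_rapid {a : ℝ} (ha : 0 < a) : Rapid (c0 a) := by
  intro s
  refine ⟨exp a * (s.factorial / a ^ s), fun k => ?_⟩
  have h1 := c0_le a k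
  have h2 := Real.pow_div_factorial_le_exp (a * br k) (by have := br_pos k; positivity) s
  have hb := br_pos k
  have h3 : br k ^ s ≤ s.factorial / a ^ s * exp (a * br k) := by
    rw [div_le_iff₀ (by positivity)] at h2
    rw [div_mul_eq_mul_div, le_div_iff₀ (by positivity)]
    rw [mul_pow] at h2; linarith
  calc _ ≤ exp (-(a * (|(k.1:ℝ)| + |(k.2:ℝ)|))) * (s.factorial / a ^ s * exp (a * br k)) := by gcongr
    _ = exp (-(a * (|(k.1:ℝ)| + |(k.2:ℝ)|))) * exp (a * br k) * (s.factorial / a ^ s) := by ring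
    _ = _ := by rw [← exp_add]; congr 2; unfold br; ring

/-- the pairing with the steady state vanishes on the nonlinearity -/
lemma flip_id (j l : ℤ × ℤ) : c0 0 (j + l) * (j.2 * l.1 - j.1 * l.2) - c0 0 (j + fl1 l) * (j.2 * (fl1 l).1 - j.1 * (fl1 l).2)
    - c0 0 (j + fl2 l) * (j.2 * (fl2 l).1 - j.1 * (fl2 l).2)
    + c0 0 (j + fl1 (fl2 l)) * (j.2 * (fl1 (fl2 l)).1 - j.1 * (fl1 (fl2 l)).2) = 0 := by
  simp only [fl1_apply, fl2_apply, c0, pp, Prod.fst_add, Prod.snd_add, zero_mul, neg_zero, exp_zero]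
  obtain ⟨a, b⟩ := j
  obtain ⟨m, n⟩ := l
  simp only
  have p1 : Odd (a + -m) ↔ Odd (a + m) := by simp [Int.odd_add, parity_simps]
  have p2 : Odd (b + -n) ↔ Odd (b + n) := by simp [Int.odd_add, parity_simps]
  simp only [p1, p2]
  by_cases h1 : Odd (a + m)
  swap; · simp [h1]
  by_cases h2 : Odd (b + n)
  swap; · simp [h2]
  have nz : ∀ u : ℤ, Odd u → (u:ℝ) ≠ 0 := fun u hu h => by
    have := odd_one_le hu
    rw [h] at this; norm_num at this
  have n1 := nz _ h1
  have n2 := nz _ h2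
  have n3 := nz _ (p1.2 h1)
  have n4 := nz _ (p2.2 h2)
  simp only [if_pos h1, if_pos h2]
  push_cast at *
  field_simp
  ring

lemma c00_le (k) : |c0 0 k| ≤ 1 * br k ^ 0 := by simpa using c0_le 0 k

lemma flip_sum {g : ℤ × ℤ → ℝ} (sg : Summable g) (z : ∀ l, g l + g (fl1 l) + g (fl2 l) + g (fl1 (fl2 l)) = 0) : ∑' l, g l = 0 := by
  have s1 : Summable (fun l => g (fl1 l)) := fl1.summable_iff.2 sg
  have s2 : Summable (fun l => g (fl2 l)) := fl2.summable_iff.2 sg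
  have s3 : Summable (fun l => g (fl1 (fl2 l))) := fl2.summable_iff.2 s1
  have t1 : ∑' l, g (fl1 l) = ∑' l, g l := fl1.tsum_eq g
  have t2 : ∑' l, g (fl2 l) = ∑' l, g l := fl2.tsum_eq g
  have t3 : ∑' l, g (fl1 (fl2 l)) = ∑' l, g (fl1 l) := fl2.tsum_eq (fun l => g (fl1 l))
  have := ((sg.add s1).add s2).tsum_add s3
  rw [tsum_congr z, tsum_zero, (sg.add s1).tsum_add s2, sg.tsum_add s1] at this
  linarith

lemma flip_id' {c} (hs : Sym c) (j l : ℤ × ℤ) : c0 0 (j + l) * (ker j l * c j * c l) + c0 0 (j + fl1 l) * (ker j (fl1 l) * c j * c (fl1 l))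
   + c0 0 (j + fl2 l) * (ker j (fl2 l) * c j * c (fl2 l)) + c0 0 (j + fl1 (fl2 l)) * (ker j (fl1 (fl2 l)) * c j * c (fl1 (fl2 l))) = 0 := by
  have := flip_id j l
  rw [hs.f1, hs.f2, hs.f1, hs.f2]
  unfold ker
  generalize c0 0 (j + l) = A at *
  generalize c0 0 (j + fl1 l) = B at *
  generalize c0 0 (j + fl2 l) = C at *
  generalize c0 0 (j + fl1 (fl2 l)) = D at *
  linear_combination (c j * c l / nsq j) * this

lemma J_summ {c} (hr : Rapid c) : Summable (fun p : (ℤ × ℤ) × (ℤ × ℤ) => c0 0 p.1 * (ker p.2 p.1 * c p.2 * c (p.1 - p.2))) := by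
  refine summable_conv (c := fun j => |c j|) (d := fun l => 2 * (br l * |c l|)) hr.abs.summable (hr.br1.mul_left 2) ?_
  intro k j
  have h1 := c00_le k
  have h2 := ker_le' j k
  rw [abs_mul, abs_mul, abs_mul]
  simp only [pow_zero, mul_one] at h1
  have h3 : |ker j k| * |c j| * |c (k - j)| ≤ 2 * br (k - j) * |c j| * |c (k - j)| := by gcongr
  calc _ ≤ 1 * (2 * br (k - j) * |c j| * |c (k - j)|) := by gcongr
    _ = _ := by ring

lemma J_j {c} (hs : Sym c) (hr : Rapid c) (j : ℤ × ℤ) : ∑' k : ℤ × ℤ, c0 0 k * (ker j k * c j * c (k - j)) = 0 := by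
  rw [← (Equiv.addLeft j).tsum_eq (fun k => c0 0 k * (ker j k * c j * c (k - j)))]
  have e : ∀ l, c0 0 (Equiv.addLeft j l) * (ker j (Equiv.addLeft j l) * c j * c (Equiv.addLeft j l - j)) = c0 0 (j + l) * (ker j l * c j * c l) := by
    intro l
    rw [Equiv.coe_addLeft, add_sub_cancel_left, ker_add]
  rw [tsum_congr e]
  refine flip_sum ?_ (fun l => flip_id' hs j l)
  have h1 : Summable fun k => c0 0 k * (ker j k * c j * c (k - j)) := (J_summ hr).prod_symm.prod_factor j
  exact ((Equiv.addLeft j).summable_iff.2 h1).congr e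

lemma J_nl {c} (hs : Sym c) (hr : Rapid c) : ∑' k, c0 0 k * nl c k = 0 := by
  have e1 : ∀ k, c0 0 k * nl c k = ∑' j, c0 0 k * (ker j k * c j * c (k - j)) := fun k => by
    rw [nl, bil, tsum_mul_left]
  rw [tsum_congr e1]
  have h := Summable.tsum_comm (f := fun (k j : ℤ × ℤ) => c0 0 k * (ker j k * c j * c (k - j))) (J_summ hr)
  refine h.symm.trans ?_
  rw [tsum_congr (fun j => J_j hs hr j), tsum_zero]

lemma Fs00 (d) : Fs 0 d 0 0 = ∑' k, d k := by simp [Fs]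

lemma Sol.J {b c} (h : Sol b c) {t} (ht : t ∈ Icc 0 b) : ∑' k, c0 0 k * c t k = ∑' k, c0 0 k * c 0 k := by
  rw [← Fs00, ← Fs00]
  refine const_int (h.Fs_cont c00_le 0 0 0) (fun t ht => ?_) t ht
  refine (h.dt c00_le 0 0 0 ht).congr_deriv ?_
  have ht' := Ioo_subset_Icc_self ht
  rw [Fs00]; exact J_nl (h.sym t ht') (h.rapid ht')

lemma Sol.L2 {b c} (h : Sol b c) {t} (ht : t ∈ Icc 0 b) : ∑' k, c t k ^ 2 = ∑' k, c 0 k ^ 2 := by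
  have e : ∀ t, ∑' k, c t k ^ 2 = En 0 (c t) := fun t => by simp [En]
  rw [e, e]
  refine const_int (h.En_cont 0) (fun t ht => ?_) t ht
  refine (h.En_der 0 ht).congr_deriv ?_
  have ht' := Ioo_subset_Icc_self ht
  have := energy (h.rapid ht') (h.sym t ht').even 0
  simp only [Nat.cast_zero, zero_mul] at this
  rw [abs_nonpos_iff.1 this, mul_zero]

lemma pp0_sq : Summable fun n : ℤ => pp 0 n ^ 2 := by
  refine Summable.of_nonneg_of_le (fun n => sq_nonneg _) (fun n => ?_) (Real.summable_one_div_int_pow.2 (by norm_num : 1 < 2))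
  unfold pp
  split_ifs
  · simp
  · simp; positivity

lemma c00_sq : Summable fun k => c0 0 k ^ 2 := by
  have := pp0_sq.mul_of_nonneg pp0_sq (fun n => sq_nonneg _) (fun n => sq_nonneg _)
  refine (this.mul_left ((4 / π ^ 2) ^ 2)).congr fun k => ?_
  unfold c0; ring

/-- constant -/
noncomputable def Zc : ℝ := ∑' n : ℤ, √|(n:ℝ)| / (n:ℝ) ^ 2
lemma Zc_summ : Summable fun n : ℤ => √|(n:ℝ)| / (n:ℝ) ^ 2 := by
  have h := Real.summable_abs_int_rpow (b := 3/2) (by norm_num)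
  refine h.congr fun n => ?_
  by_cases hn : n = 0
  · subst hn; simp
  have : (0:ℝ) < |(n:ℝ)| := by positivity
  rw [Real.sqrt_eq_rpow, ← sq_abs (n:ℝ), ← Real.rpow_natCast, ← Real.rpow_sub this]
  norm_num

lemma c0_diff {a : ℝ} (ha : 0 < a) : Summable (fun k => (c0 a k - c0 0 k) ^ 2) ∧ ∑' k, (c0 a k - c0 0 k) ^ 2 ≤ √(2 * a) * Zc ^ 2 := by
  have sp := Zc_summ.mul_of_nonneg Zc_summ (fun n => by positivity) (fun n => by positivity)
  have le : ∀ k : ℤ × ℤ, (c0 a k - c0 0 k) ^ 2 ≤ √(2 * a) * (√|(k.1:ℝ)| / (k.1:ℝ) ^ 2 * (√|(k.2:ℝ)| / (k.2:ℝ) ^ 2)) := by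
    intro k
    by_cases h1 : Odd k.1
    swap; · simp only [c0, pp, if_neg h1]; simp; positivity
    by_cases h2 : Odd k.2
    swap; · simp only [c0, pp, if_neg h2]; simp; positivity
    have n1 := odd_one_le h1
    have n2 := odd_one_le h2
    set X := a * (|(k.1:ℝ)| + |(k.2:ℝ)|) with hX
    have hX0 : 0 ≤ X := by positivity
    have z1 : (k.1:ℝ) ≠ 0 := fun h => by rw [h] at n1; norm_num at n1
    have z2 : (k.2:ℝ) ≠ 0 := fun h => by rw [h] at n2; norm_num at n2
    have e : c0 a k - c0 0 k = (4 / π ^ 2) * ((1 - exp (-X)) / (k.1 * k.2)) := by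
      have : exp (-X) = exp (-(a * |(k.1:ℝ)|)) * exp (-(a * |(k.2:ℝ)|)) := by rw [← exp_add, hX]; congr 1; ring
      simp only [c0, pp, if_pos h1, if_pos h2, this, zero_mul, neg_zero, exp_zero]
      field_simp; ring
    have b1 : (1 - exp (-X)) ^ 2 ≤ √X := by
      have u1 : 0 ≤ 1 - exp (-X) := by linarith [exp_le_one_iff.2 (neg_nonpos.2 hX0)]
      have u2 : 1 - exp (-X) ≤ 1 := by linarith [exp_pos (-X)]
      have u3 : 1 - exp (-X) ≤ X := by linarith [add_one_le_exp (-X)]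
      apply Real.le_sqrt_of_sq_le
      calc ((1 - exp (-X)) ^ 2) ^ 2 = (1 - exp (-X)) * (1 - exp (-X)) ^ 3 := by ring
        _ ≤ X * 1 := by gcongr; exact pow_le_one₀ u1 u2
        _ = X := mul_one X
    have b2 : √X ≤ √(2 * a) * (√|(k.1:ℝ)| * √|(k.2:ℝ)|) := by
      rw [← Real.sqrt_mul (abs_nonneg _), ← Real.sqrt_mul (by positivity)]
      apply Real.sqrt_le_sqrt
      rw [hX, mul_comm 2 a, mul_assoc]
      gcongr
      nlinarith
    rw [e, mul_pow, div_pow (1 - exp (-X)), mul_pow (k.1:ℝ)]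
    have b3 : (4 / π ^ 2) ^ 2 ≤ 1 := pow_le_one₀ (by positivity) four_pi
    calc _ ≤ 1 * ((√(2 * a) * (√|(k.1:ℝ)| * √|(k.2:ℝ)|)) / (k.1 ^ 2 * k.2 ^ 2)) := by
          gcongr; exact b1.trans b2
      _ = _ := by field_simp
  have ss := Summable.of_nonneg_of_le (fun k => sq_nonneg _) le (sp.mul_left _)
  refine ⟨ss, (ss.tsum_le_tsum le (sp.mul_left _)).trans ?_⟩
  rw [tsum_mul_left, ← Zc_summ.tsum_mul_tsum Zc_summ sp, sq]
  rfl

/-- `L²` stability -/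
lemma Sol.rigid {b c a} (h : Sol b c) (ha : 0 < a) (h0 : c 0 = c0 a) {t} (ht : t ∈ Icc 0 b) :
    ∑' k, (c t k - c0 a k) ^ 2 ≤ 4 * (√(2 * a) * Zc ^ 2) := by
  have z : (0:ℝ) ∈ Icc 0 b := ⟨le_rfl, ht.1.trans ht.2⟩
  have rt := h.rapid ht
  have r0 := c0_rapid ha
  obtain ⟨sd, hd⟩ := c0_diff ha
  have s1 : Summable fun k => c t k ^ 2 := by simpa using rt.sq_summable 0
  have s1' : Summable fun k => c 0 k ^ 2 := by simpa using (h.rapid z).sq_summable 0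
  have s2 : Summable fun k => c0 0 k * c t k := (rt.mul_wt c00_le).summable
  have s2' : Summable fun k => c0 0 k * c 0 k := ((h.rapid z).mul_wt c00_le).summable
  have key : ∀ u, Summable (fun k => c u k ^ 2) → Summable (fun k => c0 0 k * c u k) → Summable (fun k => (c u k - c0 0 k) ^ 2) ∧
      ∑' k, (c u k - c0 0 k) ^ 2 = ∑' k, c u k ^ 2 - 2 * ∑' k, c0 0 k * c u k + ∑' k, c0 0 k ^ 2 := by
    intro u a1 a2
    have e : (fun k => (c u k - c0 0 k) ^ 2) = fun k => c u k ^ 2 - 2 * (c0 0 k * c u k) + c0 0 k ^ 2 := by ext k; ring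
    rw [e]
    refine ⟨(a1.sub (a2.mul_left 2)).add c00_sq, ?_⟩
    rw [(a1.sub (a2.mul_left 2)).tsum_add c00_sq, a1.tsum_sub (a2.mul_left 2), tsum_mul_left]
  obtain ⟨k1, k1'⟩ := key t s1 s2
  obtain ⟨k2, k2'⟩ := key 0 s1' s2'
  rw [h.L2 ht, h.J ht, ← k2', h0] at k1'
  have le : ∀ k, (c t k - c0 a k) ^ 2 ≤ 2 * (c t k - c0 0 k) ^ 2 + 2 * (c0 a k - c0 0 k) ^ 2 := fun k => by
    nlinarith [sq_nonneg ((c t k - c0 0 k) + (c0 a k - c0 0 k))]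
  have sl : Summable fun k => (c t k - c0 a k) ^ 2 := by simpa using (rt.sub r0).sq_summable 0
  have := sl.tsum_le_tsum le ((k1.mul_left 2).add (sd.mul_left 2))
  rw [(k1.mul_left 2).tsum_add (sd.mul_left 2), tsum_mul_left, tsum_mul_left, k1'] at this
  linarith

end EU

end

section
open Real MeasureTheory Set Filter Topology

namespace EU

lemma hasSum_odd {f : ℤ → ℝ} {s : ℝ} (he : ∀ n, f (-n) = f n) (hz : ∀ n, ¬ Odd n → f n = 0)
    (h : HasSum (fun m : ℕ => f (2 * m + 1)) s) : HasSum f (2 * s) := by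
  have h1 : HasSum (fun n : ℕ => f n) (0 + s) := by
    refine HasSum.even_add_odd ?_ ?_
    · have e : (fun k : ℕ => f ((2 * k : ℕ) : ℤ)) = fun _ => 0 := by
        ext k; exact hz _ (by push_cast; simp)
      rw [e]; exact hasSum_zero
    · exact_mod_cast h
  rw [zero_add] at h1
  have h2 : HasSum (fun n : ℕ => f (-(n + 1 : ℤ))) s := by
    have := (hasSum_nat_add_iff' 1).2 h1
    simp only [Finset.sum_range_one, Nat.cast_zero, hz 0 (by simp), sub_zero] at this
    simp only [he]
    exact_mod_cast this
  rw [two_mul]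
  exact HasSum.of_nat_of_neg_add_one h1 h2

lemma geo_cos {a : ℝ} (ha : 0 < a) (x : ℝ) :
    HasSum (fun m : ℕ => exp (-(a * (2 * m + 1))) * cos ((2 * m + 1) * x)) (sinh a * cos x / (sinh a ^ 2 + sin x ^ 2) / 2) := by
  set w : ℂ := Complex.exp (⟨-a, x⟩) with hw
  have nw : ‖w ^ 2‖ < 1 := by
    rw [norm_pow, hw, Complex.norm_exp]
    exact pow_lt_one₀ (exp_pos _).le (Real.exp_lt_one_iff.2 (by simpa using ha)) two_ne_zero
  have h := (hasSum_geometric_of_norm_lt_one nw).mul_left w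
  have h2 := Complex.hasSum_re h
  have hS : 0 < sinh a := Real.sinh_pos_iff.2 ha
  convert h2 using 1
  · ext m
    have : w * (w ^ 2) ^ m = Complex.exp ((2 * m + 1 : ℕ) * ⟨-a, x⟩) := by
      rw [Complex.exp_nat_mul]; ring
    rw [this, Complex.exp_re]
    have e1 : (((2 * m + 1 : ℕ) : ℂ) * ⟨-a, x⟩).re = -(a * (2 * m + 1)) := by
      rw [← Complex.ofReal_natCast, Complex.re_ofReal_mul]; push_cast; ring
    have e2 : (((2 * m + 1 : ℕ) : ℂ) * ⟨-a, x⟩).im = (2 * m + 1) * x := by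
      rw [← Complex.ofReal_natCast, Complex.im_ofReal_mul]; push_cast; ring
    rw [e1, e2]
  · have w0 : w ≠ 0 := Complex.exp_ne_zero _
    have e : w * (1 - w ^ 2)⁻¹ = (w⁻¹ - w)⁻¹ := by
      rw [← div_eq_mul_inv]
      have h1 : (1:ℂ) - w ^ 2 ≠ 0 := fun h => by
        rw [sub_eq_zero] at h; rw [← h] at nw; simp at nw
      have h3 : w⁻¹ - w = (1 - w ^ 2) / w := by field_simp
      rw [h3, inv_div]
    rw [e, Complex.inv_re]
    have er : (w⁻¹ - w).re = 2 * sinh a * cos x := by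
      rw [hw, ← Complex.exp_neg, Complex.sub_re, Complex.exp_re, Complex.exp_re, Real.sinh_eq]
      simp; ring
    have ei : (w⁻¹ - w).im = - (2 * cosh a * sin x) := by
      rw [hw, ← Complex.exp_neg, Complex.sub_im, Complex.exp_im, Complex.exp_im, Real.cosh_eq]
      simp; ring
    rw [Complex.normSq_apply, er, ei]
    have e3 : 2 * sinh a * cos x * (2 * sinh a * cos x) + -(2 * cosh a * sin x) * -(2 * cosh a * sin x) = 4 * (sinh a ^ 2 + sin x ^ 2) := by
      have := Real.cosh_sq a
      have h4 := sin_sq_add_cos_sq x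
      linear_combination (4 * sin x ^ 2) * this + 4 * sinh a ^ 2 * h4
    rw [e3]
    have : 0 < sinh a ^ 2 + sin x ^ 2 := by positivity
    field_simp; ring

lemma exp_abs_summ {a : ℝ} (ha : 0 < a) : Summable fun n : ℤ => exp (-(a * |(n:ℝ)|)) := by
  have h : Summable fun n : ℕ => exp (-(a * (n:ℝ))) := by
    refine (summable_geometric_of_lt_one (exp_pos (-a)).le (Real.exp_lt_one_iff.2 (by linarith))).congr fun n => ?_
    rw [← exp_nat_mul]; congr 1; ring
  refine Summable.of_nat_of_neg ?_ ?_ <;> simpa using h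

lemma A'_sum {a : ℝ} (ha : 0 < a) (x : ℝ) : HasSum (fun n : ℤ => pp a n * (cos (n * x) * n)) (sinh a * cos x / (sinh a ^ 2 + sin x ^ 2)) := by
  rw [show sinh a * cos x / (sinh a ^ 2 + sin x ^ 2) = 2 * (sinh a * cos x / (sinh a ^ 2 + sin x ^ 2) / 2) by ring]
  refine hasSum_odd (fun n => ?_) (fun n hn => by simp [pp, hn]) ?_
  · rw [pp_neg]; push_cast; rw [neg_mul (n:ℝ) x, cos_neg]; ring
  · have e : (fun m : ℕ => pp a (2 * m + 1) * (cos ((2 * m + 1 : ℤ) * x) * (2 * m + 1 : ℤ))) = 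
        fun m : ℕ => exp (-(a * (2 * m + 1))) * cos ((2 * m + 1) * x) := by
      ext m
      have ho : Odd (2 * (m:ℤ) + 1) := ⟨m, rfl⟩
      unfold pp
      rw [if_pos ho]
      push_cast
      have p : (0:ℝ) < 2 * m + 1 := by positivity
      rw [abs_of_pos p]; field_simp
    exact e ▸ geo_cos ha x

lemma A_term_le {a : ℝ} (n : ℤ) (y : ℝ) : ‖pp a n * (cos (n * y) * n)‖ ≤ exp (-(a * |(n:ℝ)|)) := by
  rw [norm_mul, norm_mul, Real.norm_eq_abs, Real.norm_eq_abs, Real.norm_eq_abs]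
  unfold pp
  split_ifs with h
  · have h1 := odd_one_le h
    rw [abs_div, abs_of_pos (exp_pos _)]
    have h2 := abs_cos_le_one (n * y)
    calc _ ≤ exp (-(a * |(n:ℝ)|)) / |(n:ℝ)| * (1 * |(n:ℝ)|) := by gcongr
      _ = _ := by field_simp
  · simp [(exp_pos _).le]

lemma A_sum {a : ℝ} (ha : 0 < a) (x : ℝ) : HasSum (fun n : ℤ => pp a n * sin (n * x)) (arctan (sin x / sinh a)) := by
  have hS : 0 < sinh a := Real.sinh_pos_iff.2 ha
  have su := exp_abs_summ ha
  have ss : ∀ x, Summable fun n : ℤ => pp a n * sin (n * x) := fun x => by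
    refine Summable.of_norm_bounded su fun n => ?_
    rw [norm_mul, Real.norm_eq_abs, Real.norm_eq_abs]
    have h2 := abs_sin_le_one (n * x)
    calc _ ≤ |pp a n| * 1 := by gcongr
      _ ≤ _ := by simpa using pp_le n
  have hD : ∀ x, HasDerivAt (fun x => ∑' n : ℤ, pp a n * sin (n * x)) (sinh a * cos x / (sinh a ^ 2 + sin x ^ 2)) x := by
    intro x
    have hg : ∀ (n : ℤ) y, HasDerivAt (fun x : ℝ => pp a n * sin (n * x)) (pp a n * (cos (n * y) * n)) y := fun n y => by
      have h1 : HasDerivAt (fun x : ℝ => (n:ℝ) * x) n y := by simpa using (hasDerivAt_id y).const_mul (n:ℝ)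
      exact h1.sin.const_mul (pp a n)
    exact (hasDerivAt_tsum su hg A_term_le (ss 0) x).congr_deriv (A'_sum ha x).tsum_eq
  have hE : ∀ x, HasDerivAt (fun x => arctan (sin x / sinh a)) (sinh a * cos x / (sinh a ^ 2 + sin x ^ 2)) x := by
    intro x
    refine (((hasDerivAt_sin x).div_const (sinh a)).arctan).congr_deriv ?_
    have : 0 < sinh a ^ 2 + sin x ^ 2 := by positivity
    field_simp
  have hc := is_const_of_deriv_eq_zero (f := fun x => (∑' n : ℤ, pp a n * sin (n * x)) - arctan (sin x / sinh a))
    (fun x => ((hD x).fun_sub (hE x)).differentiableAt) (fun x => by rw [((hD x).fun_sub (hE x)).deriv, sub_self]) x 0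
  simp at hc
  have := (ss x).hasSum
  rwa [sub_eq_zero.1 hc] at this

lemma B_sum {a : ℝ} (ha : 0 < a) (x : ℝ) : HasSum (fun n : ℤ => pp a n * cos (n * x)) 0 := by
  have ss : Summable fun n : ℤ => pp a n * cos (n * x) := by
    refine Summable.of_norm_bounded (exp_abs_summ ha) fun n => ?_
    rw [norm_mul, Real.norm_eq_abs, Real.norm_eq_abs]
    calc _ ≤ |pp a n| * 1 := by gcongr; exact abs_cos_le_one _
      _ ≤ _ := by simpa using pp_le n
  have h1 := (Equiv.neg ℤ).tsum_eq fun n : ℤ => pp a n * cos (n * x)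
  have h2 : ∀ n : ℤ, pp a (Equiv.neg ℤ n) * cos ((Equiv.neg ℤ n : ℤ) * x) = - (pp a n * cos (n * x)) := fun n => by
    rw [Equiv.neg_apply, pp_neg]; push_cast; rw [neg_mul (n:ℝ) x, cos_neg]; ring
  rw [tsum_congr h2, tsum_neg] at h1
  have := ss.hasSum
  rwa [show ∑' n : ℤ, pp a n * cos (n * x) = 0 by linarith] at this

lemma hasSum_mul2 {f g : ℤ → ℝ} {s t : ℝ} (hf : HasSum f s) (hg : HasSum g t) : HasSum (fun k : ℤ × ℤ => f k.1 * g k.2) (s * t) :=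
  hf.mul hg (summable_mul_of_summable_norm hf.summable.norm hg.summable.norm)

lemma theta0 {a : ℝ} (ha : 0 < a) (x y : ℝ) : Fs 0 (c0 a) x y = 4 / π ^ 2 * (arctan (sin x / sinh a) * arctan (sin y / sinh a)) := by
  have h1 := hasSum_mul2 (A_sum ha x) (A_sum ha y)
  have h2 := hasSum_mul2 (B_sum ha x) (B_sum ha y)
  have h3 := (h1.sub h2).mul_left (4 / π ^ 2)
  unfold Fs
  rw [mul_zero, sub_zero] at h3
  rw [← h3.tsum_eq]
  refine tsum_congr fun k => ?_
  rw [add_zero, cos_add, c0]; ring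

lemma A_der {a : ℝ} (ha : 0 < a) (x : ℝ) : HasDerivAt (fun x => arctan (sin x / sinh a)) (sinh a * cos x / (sinh a ^ 2 + sin x ^ 2)) x := by
  have hS : 0 < sinh a := Real.sinh_pos_iff.2 ha
  refine (((hasDerivAt_sin x).div_const (sinh a)).arctan).congr_deriv ?_
  have : 0 < sinh a ^ 2 + sin x ^ 2 := by positivity
  field_simp

lemma gx0 {a : ℝ} (ha : 0 < a) (x y : ℝ) : gx (c0 a) x y = 4 / π ^ 2 * (sinh a * cos x / (sinh a ^ 2 + sin x ^ 2) * arctan (sin y / sinh a)) := by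
  refine ((c0_rapid ha).gxd x y).unique ?_
  simp only [theta0 ha]
  exact ((A_der ha x).mul_const _).const_mul _
lemma gy0 {a : ℝ} (ha : 0 < a) (x y : ℝ) : gy (c0 a) x y = 4 / π ^ 2 * (arctan (sin x / sinh a) * (sinh a * cos y / (sinh a ^ 2 + sin y ^ 2))) := by
  refine ((c0_rapid ha).gyd x y).unique ?_
  simp only [theta0 ha]
  exact ((A_der ha y).const_mul _).const_mul _

lemma A_abs (z : ℝ) : |arctan z| ≤ π / 2 := abs_le.2 ⟨(neg_pi_div_two_lt_arctan z).le, (arctan_lt_pi_div_two z).le⟩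

lemma A'_abs {a : ℝ} (ha : 0 < a) (x : ℝ) : |sinh a * cos x / (sinh a ^ 2 + sin x ^ 2)| ≤ 1 / sinh a := by
  have hS : 0 < sinh a := Real.sinh_pos_iff.2 ha
  rw [abs_div, abs_mul, abs_of_pos hS, abs_of_pos (a := sinh a ^ 2 + sin x ^ 2) (by positivity), div_le_div_iff₀ (by positivity) hS]
  nlinarith [abs_cos_le_one x, sq_nonneg (sin x), sq_nonneg (sinh a)]

lemma c0_B1 {a : ℝ} (ha : 0 < a) (x y : ℝ) : |Fs 0 (c0 a) x y| ≤ 1 := by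
  rw [theta0 ha, abs_mul, abs_mul, abs_of_pos (by positivity : 0 < 4 / π ^ 2)]
  calc _ ≤ 4 / π ^ 2 * (π / 2 * (π / 2)) := by gcongr <;> exact A_abs _
    _ = 1 := by field_simp; norm_num

lemma c0_gr {a : ℝ} (ha : 0 < a) (x y : ℝ) : gr (c0 a) x y ≤ 1 / sinh a := by
  have hS : 0 < sinh a := Real.sinh_pos_iff.2 ha
  have h1 : |gx (c0 a) x y| ≤ 4 / π ^ 2 * (1 / sinh a * (π / 2)) := by
    rw [gx0 ha, abs_mul, abs_mul, abs_of_pos (by positivity : 0 < 4 / π ^ 2)]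
    gcongr
    · exact A'_abs ha x
    · exact A_abs _
  have h2 : |gy (c0 a) x y| ≤ 4 / π ^ 2 * (1 / sinh a * (π / 2)) := by
    rw [gy0 ha, abs_mul, abs_mul, abs_of_pos (by positivity : 0 < 4 / π ^ 2), mul_comm (1 / sinh a)]
    gcongr
    · exact A_abs _
    · exact A'_abs ha y
  have e : 4 / π ^ 2 * (1 / sinh a * (π / 2)) = 2 / π * (1 / sinh a) := by field_simp; norm_num
  rw [e] at h1 h2
  have h3 : 2 / π ≤ 2 / 3 := by gcongr; exact pi_gt_three.le
  have h4 : 2 / π * (1 / sinh a) ≤ 2 / 3 * (1 / sinh a) := by gcongr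
  have k1 := h1.trans h4
  have k2 := h2.trans h4
  unfold gr
  have p : 0 < 1 / sinh a := by positivity
  refine Real.sqrt_le_iff.2 ⟨p.le, ?_⟩
  rw [← sq_abs (gx _ _ _), ← sq_abs (gy _ _ _)]
  nlinarith [abs_nonneg (gx (c0 a) x y), abs_nonneg (gy (c0 a) x y)]

lemma c0_q {a : ℝ} (ha : 0 < a) {x : ℝ} (hx : sinh a ≤ sin x) : 1 / sinh a / 4 ≤ gy (c0 a) x 0 := by
  have hS : 0 < sinh a := Real.sinh_pos_iff.2 ha
  rw [gy0 ha]
  have h1 : π / 4 ≤ arctan (sin x / sinh a) := by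
    rw [← arctan_one]; exact arctan_mono ((one_le_div hS).2 hx)
  have e : sinh a * cos 0 / (sinh a ^ 2 + sin 0 ^ 2) = 1 / sinh a := by simp; field_simp
  rw [e]
  calc _ ≤ 1 / π * (1 / sinh a) := by
        rw [div_eq_mul_one_div, mul_comm]; gcongr; exact pi_le_four
    _ = 4 / π ^ 2 * (π / 4 * (1 / sinh a)) := by field_simp
    _ ≤ _ := by gcongr

lemma c0_pos {a : ℝ} (ha : 0 < a) : ∃ x y, 0 < gr (c0 a) x y := by
  have hS : 0 < sinh a := Real.sinh_pos_iff.2 ha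
  refine ⟨π / 2, 0, ?_⟩
  have : 0 < gy (c0 a) (π / 2) 0 := by
    rw [gy0 ha]; simp
    have := arctan_pos.2 (inv_pos.2 hS)
    positivity
  unfold gr; positivity

end EU

end

section
open Real MeasureTheory Set Filter Topology

namespace EU

lemma tsum_odd {f : ℤ → ℝ} (he : ∀ n, f (-n) = f n) (hz : ∀ n, ¬ Odd n → f n = 0) (h : Summable f) :
    Summable (fun m : ℕ => f (2 * m + 1)) ∧ ∑' n, f n = 2 * ∑' m : ℕ, f (2 * m + 1) := by
  have h1 : Summable (fun m : ℕ => f (2 * m + 1)) := by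
    refine h.comp_injective (i := fun m : ℕ => 2 * (m:ℤ) + 1) fun m n hmn => ?_
    simp only at hmn; omega
  exact ⟨h1, (hasSum_odd he hz h1.hasSum).tsum_eq⟩

/-- odd exponential weight -/
noncomputable def ee (a : ℝ) (n : ℤ) : ℝ := if Odd n then exp (-(a * |(n:ℝ)|)) else 0
lemma ee_nonneg (a n) : 0 ≤ ee a n := by unfold ee; split_ifs <;> positivity
lemma ee_neg (a n) : ee a (-n) = ee a n := by simp [ee, odd_neg]
lemma ee_le (a : ℝ) (n) : ee a n ≤ exp (-(a * |(n:ℝ)|)) := by unfold ee; split_ifs <;> simp [(exp_pos _).le]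
lemma ee_summ {a : ℝ} (ha : 0 < a) : Summable (ee a) := Summable.of_nonneg_of_le (ee_nonneg a) (ee_le a) (exp_abs_summ ha)
lemma ee_even {a : ℝ} {n : ℤ} (h : ¬ Odd n) : ee a n = 0 := by simp [ee, h]
lemma ee_odd (a : ℝ) (m : ℕ) : ee a (2 * m + 1) = exp (-(a * (2 * m + 1))) := by
  unfold ee
  rw [if_pos ⟨(m:ℤ), rfl⟩]
  push_cast
  rw [abs_of_pos (by positivity : (0:ℝ) < 2 * m + 1)]

/-- inner sum -/
noncomputable def Wf (a s : ℝ) : ℝ := ∑' i : ℕ, exp (-(a * (2 * i + 1))) / (s ^ 2 + (2 * i + 1) ^ 2)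

lemma Wf_summ {a : ℝ} (ha : 0 < a) (s : ℝ) : Summable fun i : ℕ => exp (-(a * (2 * i + 1))) / (s ^ 2 + (2 * i + 1) ^ 2) := by
  have h := (tsum_odd (ee_neg a) (fun n => ee_even) (ee_summ ha)).1
  simp only [ee_odd] at h
  refine Summable.of_nonneg_of_le (fun i => by positivity) (fun i => ?_) h
  refine div_le_self (exp_pos _).le ?_
  have : (0:ℝ) ≤ i := by positivity
  nlinarith [sq_nonneg s]

lemma Wf_nonneg (a s : ℝ) : 0 ≤ Wf a s := tsum_nonneg fun i => by positivity

lemma Wf_anti {a : ℝ} (ha : 0 < a) {s t : ℝ} (hs : 0 ≤ s) (hst : s ≤ t) : Wf a t ≤ Wf a s := by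
  refine (Wf_summ ha t).tsum_le_tsum (fun i => ?_) (Wf_summ ha s)
  gcongr

lemma Wf_le {a : ℝ} (ha : 0 < a) {s : ℝ} (hs : 0 < s) : Wf a s ≤ 1 / s := by
  refine (Wf_summ ha s).tsum_le_of_sum_range_le fun n => ?_
  have key : ∑ i ∈ Finset.range n, exp (-(a * (2 * i + 1))) / (s ^ 2 + (2 * i + 1) ^ 2) ≤ 1 / s - 1 / (s + 2 * n) := by
    induction n with
    | zero => simp
    | succ n ih =>
      rw [Finset.sum_range_succ]
      have h1 : exp (-(a * (2 * n + 1))) / (s ^ 2 + (2 * n + 1) ^ 2) ≤ 1 / (s + 2 * n) - 1 / (s + 2 * (n + 1 : ℕ)) := by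
        have e : 1 / (s + 2 * n) - 1 / (s + 2 * (n + 1 : ℕ)) = 2 / ((s + 2 * n) * (s + 2 * n + 2)) := by
          push_cast; field_simp; ring
        rw [e, div_le_div_iff₀ (by positivity) (by positivity)]
        have h2 : exp (-(a * (2 * n + 1))) ≤ 1 := exp_le_one_iff.2 (by simp; positivity)
        have h3 : (s + 2 * n) * (s + 2 * n + 2) ≤ 2 * (s ^ 2 + (2 * n + 1) ^ 2) := by
          nlinarith [sq_nonneg (s - (2 * n + 1))]
        have h4 : 0 ≤ (s + 2 * n) * (s + 2 * n + 2) := by positivity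
        nlinarith
      linarith
  have : 0 ≤ 1 / (s + 2 * n) := by positivity
  linarith

lemma Wf_ge {a : ℝ} (ha : 0 < a) (m : ℕ) (hm : a * (2 * m + 1) ≤ 1) : exp (-1) / (4 * (2 * m + 1)) ≤ Wf a (2 * m + 1) := by
  have h := (Wf_summ ha (2 * m + 1)).sum_le_tsum (Finset.range (m + 1)) (fun i _ => by positivity)
  refine le_trans ?_ h
  have h1 : ∀ i ∈ Finset.range (m + 1), exp (-1) / (2 * (2 * m + 1) ^ 2) ≤ exp (-(a * (2 * i + 1))) / ((2 * m + 1) ^ 2 + (2 * i + 1 : ℝ) ^ 2) := by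
    intro i hi
    have hi' : (i:ℝ) ≤ m := by exact_mod_cast Nat.lt_succ_iff.1 (Finset.mem_range.1 hi)
    have h2 : a * (2 * i + 1) ≤ 1 := le_trans (by gcongr) hm
    gcongr
    have : (2 * i + 1 : ℝ) ^ 2 ≤ (2 * m + 1) ^ 2 := by gcongr
    linarith
  refine le_trans ?_ (Finset.sum_le_sum h1)
  rw [Finset.sum_const, Finset.card_range, nsmul_eq_mul, mul_div_assoc', div_le_div_iff₀ (by positivity) (by positivity)]
  push_cast
  have : 0 < exp (-1) := exp_pos _
  have hm0 : (0:ℝ) ≤ m := by positivity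
  nlinarith [mul_nonneg this.le hm0, mul_nonneg (mul_nonneg this.le hm0) hm0]

/-- velocity weight -/
noncomputable def wv (k : ℤ × ℤ) : ℝ := k.2 * (nsq k)⁻¹
/-- velocity on the axis -/
noncomputable def Vf (d : ℤ × ℤ → ℝ) (x : ℝ) : ℝ := Fs (0 + π / 2) (fun k => wv k * d k) x 0
/-- its derivative -/
noncomputable def Vx (d : ℤ × ℤ → ℝ) (x : ℝ) : ℝ := Fs (0 + π / 2 + π / 2) (fun k => k.1 * (wv k * d k)) x 0

/-- outer coefficients -/
noncomputable def bb (a : ℝ) (m : ℕ) : ℝ := exp (-(a * (2 * m + 1))) * Wf a (2 * m + 1)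

lemma V0_aux (a x : ℝ) (sO : Summable fun n : ℤ => ee a n * cos (n * x) * (2 * Wf a n)) :
    Summable (fun m : ℕ => bb a m * cos ((2 * m + 1) * x)) ∧
    ∑' n : ℤ, ee a n * cos (n * x) * (2 * Wf a n) = 4 * ∑' m : ℕ, bb a m * cos ((2 * m + 1) * x) := by
  have h1 : ∀ n : ℤ, ee a (-n) * cos ((-n : ℤ) * x) * (2 * Wf a ((-n : ℤ):ℝ)) = ee a n * cos (n * x) * (2 * Wf a n) := fun n => by
    have h2 : Wf a ((-n : ℤ):ℝ) = Wf a n := by unfold Wf; push_cast; simp only [neg_sq]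
    have h3 : cos ((-n : ℤ) * x) = cos (n * x) := by push_cast; rw [neg_mul (n:ℝ) x, cos_neg]
    rw [h2, h3, ee_neg]
  obtain ⟨s3, e3⟩ := tsum_odd h1 (fun n hn => by rw [ee_even hn, zero_mul, zero_mul]) sO
  have e4 : ∀ m : ℕ, ee a (2 * m + 1) * cos ((2 * m + 1 : ℤ) * x) * (2 * Wf a ((2 * m + 1 : ℤ):ℝ)) = 2 * (bb a m * cos ((2 * m + 1) * x)) := by
    intro m
    rw [ee_odd, bb]; push_cast; ring
  rw [e3, tsum_congr e4, tsum_mul_left]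
  refine ⟨(s3.mul_left (1/2)).congr fun m => ?_, by ring⟩
  rw [e4]; ring

lemma V0_sum {a : ℝ} (ha : 0 < a) (x : ℝ) : Summable (fun m : ℕ => bb a m * cos ((2 * m + 1) * x)) ∧
    Vx (c0 a) x = 16 / π ^ 2 * ∑' m : ℕ, bb a m * cos ((2 * m + 1) * x) := by
  set F : ℤ × ℤ → ℝ := fun k => ee a k.1 * cos (k.1 * x) * (ee a k.2 / nsq k) with hF
  have e1 : Vx (c0 a) x = 4 / π ^ 2 * ∑' k, F k := by
    unfold Vx
    rw [Fs_pi, ← tsum_mul_left]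
    unfold Fs
    rw [← tsum_neg]
    refine tsum_congr fun k => ?_
    simp only [hF, wv, c0, pp, ee, add_zero, mul_zero]
    by_cases h1 : Odd k.1
    swap; · simp [h1]
    by_cases h2 : Odd k.2
    swap; · simp [h2]
    have n1 := odd_one_le h1
    have n2 := odd_one_le h2
    have z1 : (k.1:ℝ) ≠ 0 := fun h => by rw [h] at n1; norm_num at n1
    have z2 : (k.2:ℝ) ≠ 0 := fun h => by rw [h] at n2; norm_num at n2
    simp only [if_pos h1, if_pos h2]
    field_simp
  have sF : Summable F := by
    have := summable_mul_of_summable_norm (ee_summ ha).norm (ee_summ ha).norm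
    refine Summable.of_norm_bounded this fun k => ?_
    simp only [hF, norm_mul, div_eq_mul_inv, Real.norm_eq_abs, abs_of_nonneg (ee_nonneg _ _)]
    have h1 := nsq_inv_le k
    have h2 := abs_cos_le_one (k.1 * x)
    have := ee_nonneg a k.1
    have := ee_nonneg a k.2
    calc _ ≤ ee a k.1 * 1 * (ee a k.2 * 1) := by gcongr
      _ = _ := by ring
  have hin : ∀ n : ℤ, Odd n → ∑' m, ee a m / nsq (n, m) = 2 * Wf a n := by
    intro n hn
    have hs : Summable fun m => ee a m / nsq (n, m) := by
      refine Summable.of_nonneg_of_le (fun m => div_nonneg (ee_nonneg _ _) (nsq_nonneg _)) (fun m => ?_) (ee_summ ha)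
      refine div_le_self (ee_nonneg _ _) ?_
      apply nsq_one
      intro h; rw [Prod.mk_eq_zero] at h; rw [h.1] at hn; simp at hn
    rw [(tsum_odd (fun m => by simp [ee_neg, nsq]) (fun m hm => by rw [ee_even hm, zero_div]) hs).2]
    unfold Wf
    congr 1
    refine tsum_congr fun i => ?_
    rw [ee_odd, nsq]; push_cast; rfl
  have e2 : ∑' k, F k = ∑' n, ee a n * cos (n * x) * (2 * Wf a n) := by
    rw [sF.tsum_prod]
    refine tsum_congr fun n => ?_
    by_cases hn : Odd n
    · simp only [hF]; rw [tsum_mul_left, hin n hn]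
    · simp [hF, ee_even hn]
  have sO : Summable fun n : ℤ => ee a n * cos (n * x) * (2 * Wf a n) := by
    refine sF.prod.congr fun n => ?_
    by_cases hn : Odd n
    · simp only [hF]; rw [tsum_mul_left, hin n hn]
    · simp [hF, ee_even hn]
  obtain ⟨s3, e3⟩ := V0_aux a x sO
  exact ⟨s3, by rw [e1, e2, e3]; ring⟩

lemma bb_nonneg (a m) : 0 ≤ bb a m := mul_nonneg (exp_pos _).le (Wf_nonneg _ _)
lemma bb_anti {a : ℝ} (ha : 0 < a) : Antitone (bb a) := by
  refine antitone_nat_of_succ_le fun m => ?_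
  unfold bb
  have h1 := Wf_anti ha (s := 2 * m + 1) (t := 2 * (m + 1 : ℕ) + 1) (by positivity) (by push_cast; linarith)
  have := Wf_nonneg a (2 * (m + 1 : ℕ) + 1)
  gcongr
  simp
lemma bb_le {a : ℝ} (ha : 0 < a) (m) : bb a m ≤ exp (-(a * (2 * m + 1))) * (1 / (2 * m + 1)) := by
  unfold bb
  gcongr
  exact Wf_le ha (by positivity)
lemma bb_ge {a : ℝ} (ha : 0 < a) (m : ℕ) (hm : a * (2 * m + 1) ≤ 1) : 1 / 72 * (1 / (m + 1)) ≤ bb a m := by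
  unfold bb
  have h := Wf_ge ha m hm
  have h1 : exp (-1) ≤ exp (-(a * (2 * m + 1))) := by gcongr
  have h2 : (1:ℝ)/3 ≤ exp (-1) := by
    rw [exp_neg, one_div]; gcongr; exact exp_one_lt_three.le
  calc 1 / 72 * (1 / ((m:ℝ) + 1)) = 1 / 3 * ((1 / 3) / (4 * (2 * (m + 1)))) := by field_simp; norm_num
    _ ≤ exp (-(a * (2 * m + 1))) * (exp (-1) / (4 * (2 * m + 1))) := by
        gcongr
        · exact h2.trans h1
        · linarith
    _ ≤ _ := by gcongr

lemma V0_upper {a L : ℝ} (hL : 1 ≤ L) (haL : a = exp (-L)) (x : ℝ) : |Vx (c0 a) x| ≤ 6 * L := by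
  have ha : 0 < a := haL ▸ exp_pos _
  have ha1 : a ≤ 1 := by rw [haL]; exact exp_le_one_iff.2 (by linarith)
  obtain ⟨ss, e⟩ := V0_sum ha x
  have hl := Real.hasSum_log_sub_log_of_abs_lt_one (x := exp (-a)) (by rw [abs_of_pos (exp_pos _)]; exact exp_lt_one_iff.2 (by linarith))
  have hb : ∀ m : ℕ, |bb a m * cos ((2 * m + 1) * x)| ≤ 1 / 2 * (2 * (1 / (2 * m + 1)) * exp (-a) ^ (2 * m + 1)) := by
    intro m
    have h2 := abs_cos_le_one ((2 * m + 1) * x)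
    rw [abs_mul, abs_of_nonneg (bb_nonneg a m)]
    calc _ ≤ bb a m * 1 := by gcongr; exact bb_nonneg a m
      _ ≤ exp (-(a * (2 * m + 1))) * (1 / (2 * m + 1)) := by rw [mul_one]; exact bb_le ha m
      _ = _ := by rw [← exp_nat_mul]; push_cast; ring_nf
  have h3 := (abs_tsum_le ss.abs).trans (ss.abs.tsum_le_tsum hb (hl.summable.mul_left (1/2)))
  rw [tsum_mul_left, hl.tsum_eq] at h3
  have h4 : log (1 + exp (-a)) ≤ 1 := by
    rw [Real.log_le_iff_le_exp (by positivity)]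
    have : exp (-a) ≤ 1 := exp_le_one_iff.2 (by linarith)
    linarith [add_one_le_exp (1:ℝ)]
  have h5 : - log (1 - exp (-a)) ≤ L + 1 := by
    have h6 : a * exp (-1) ≤ 1 - exp (-a) := by
      have e1 : exp (-1) ≤ exp (-a) := by gcongr
      have e2 : a + 1 ≤ exp a := add_one_le_exp a
      have e3 : exp (-a) * exp a = 1 := by rw [← exp_add]; simp
      nlinarith [exp_pos (-a)]
    have h7 := Real.log_le_log (by positivity) h6
    rw [haL, ← exp_add, log_exp, ← haL] at h7
    linarith
  have h8 : |∑' m : ℕ, bb a m * cos ((2 * m + 1) * x)| ≤ 3 / 2 * L := by linarith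
  rw [e, abs_mul, abs_of_pos (by positivity)]
  have : 16 / π ^ 2 ≤ 4 := by have := four_pi; linarith [show 16 / π^2 = 4 * (4 / π^2) by ring]
  calc _ ≤ 4 * (3 / 2 * L) := by gcongr
    _ = _ := by ring

lemma abel {b s : ℕ → ℝ} (hb : Antitone b) (h0 : ∀ m, 0 ≤ b m) (hs : ∀ m, |s m| ≤ 1) (K : ℕ) :
    - (2 * b 0) ≤ ∑ m ∈ Finset.range K, b m * (s (m + 1) - s m) := by
  have key : b K * (s K + 1) - b 0 * (s 0 + 1) ≤ ∑ m ∈ Finset.range K, b m * (s (m + 1) - s m) := by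
    induction K with
    | zero => simp
    | succ K ih =>
      rw [Finset.sum_range_succ]
      have h1 := hb (Nat.le_succ K)
      have h2 := abs_le.1 (hs (K + 1))
      have h3 : b (K + 1) * (s (K + 1) + 1) ≤ b K * (s (K + 1) + 1) := by gcongr; linarith
      linarith
  have h1 := abs_le.1 (hs K)
  have h2 := abs_le.1 (hs 0)
  have := h0 K
  have h4 : 0 ≤ b K * (s K + 1) := mul_nonneg this (by linarith)
  have h5 : b 0 * (s 0 + 1) ≤ b 0 * 2 := by gcongr; exact h0 0; linarith
  linarith

lemma V0_tail {a : ℝ} (ha : 0 < a) {x : ℝ} (hx0 : 0 < x) (hx1 : x ≤ 1) (N : ℕ) (hN : 1 ≤ 2 * x * (N + 1)) :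
    -8 ≤ ∑' m : ℕ, bb a (m + N) * cos ((2 * (m + N : ℕ) + 1) * x) := by
  have ss := (summable_nat_add_iff N).2 (V0_sum ha x).1
  have hsin : x / 2 ≤ sin x := by
    have := Real.mul_le_sin hx0.le (by linarith [pi_gt_three])
    have h4 : 1 / 2 ≤ 2 / π := by rw [div_le_div_iff₀ two_pos pi_pos]; linarith [pi_le_four]
    nlinarith
  have hs0 : 0 < sin x := by linarith
  have hbN : bb a N ≤ 2 * x := by
    have h1 := bb_le ha N
    have h2 : exp (-(a * (2 * N + 1))) ≤ 1 := exp_le_one_iff.2 (by simp; positivity)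
    have hN0 : (0:ℝ) ≤ N := by positivity
    have h3 : (1:ℝ) / (2 * N + 1) ≤ 2 * x := by
      rw [div_le_iff₀ (by positivity)]; nlinarith
    have h5 : (0:ℝ) ≤ 1 / (2 * N + 1) := by positivity
    nlinarith
  have key : - (2 * bb a N) ≤ 2 * sin x * ∑' m : ℕ, bb a (m + N) * cos ((2 * (m + N : ℕ) + 1) * x) := by
    rw [← tsum_mul_left]
    refine ge_of_tendsto' (ss.mul_left (2 * sin x)).hasSum.tendsto_sum_nat fun K => ?_
    have := abel (b := fun m => bb a (m + N)) (s := fun m => sin (2 * (m + N : ℕ) * x)) (fun i j hij => bb_anti ha (by omega)) 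
      (fun m => bb_nonneg _ _) (fun m => abs_sin_le_one _) K
    simp only [zero_add] at this
    refine this.trans (le_of_eq (Finset.sum_congr rfl fun m _ => ?_))
    have e1 : sin (2 * (m + 1 + N : ℕ) * x) - sin (2 * (m + N : ℕ) * x) = 2 * sin x * cos ((2 * (m + N : ℕ) + 1) * x) := by
      rw [sin_sub_sin]
      congr 2
      · congr 1; push_cast; ring
      · push_cast; ring
    rw [e1]; ring
  by_contra! hcon
  nlinarith

lemma V0_lower {a L : ℝ} (hL : 200000 ≤ L) (haL : a = exp (-L)) {x : ℝ} (hx0 : 0 < x) (hx : x ≤ exp (-(L / 32))) :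
    L / 10000 ≤ Vx (c0 a) x := by
  have ha : 0 < a := haL ▸ exp_pos _
  obtain ⟨ss, e⟩ := V0_sum ha x
  have hx1 : x ≤ 1 / 2 := by
    refine hx.trans ?_
    rw [exp_neg, one_div]; gcongr
    linarith [add_one_le_exp (L/32)]
  set N := ⌊1 / (2 * x)⌋₊ with hN
  set P := ⌊exp (L / 32) / 2⌋₊ with hP
  have hPN : P ≤ N := by
    apply Nat.floor_le_floor
    rw [exp_neg] at hx
    rw [div_le_div_iff₀ two_pos (by positivity)]
    have : x * exp (L/32) ≤ 1 := by rwa [← le_div_iff₀ (exp_pos _), one_div]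
    linarith
  have hN1 : (N:ℝ) * (2 * x) ≤ 1 := by
    have := Nat.floor_le (by positivity : 0 ≤ 1 / (2 * x)); rwa [le_div_iff₀ (by positivity)] at this
  have hN2 : 1 ≤ 2 * x * (N + 1) := by
    have := (Nat.lt_floor_add_one (1 / (2 * x))).le
    rw [div_le_iff₀ (by positivity)] at this; linarith
  have hP1 : (P:ℝ) ≤ exp (L / 32) / 2 := Nat.floor_le (by positivity)
  have hP2 : exp (L / 32) / 2 < P + 1 := Nat.lt_floor_add_one _
  have tail := V0_tail ha hx0 (by linarith) N hN2
  have hcos : ∀ m < N, 1 / 2 ≤ cos ((2 * m + 1) * x) := by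
    intro m hm
    have hm' : (m:ℝ) + 1 ≤ N := by exact_mod_cast hm
    have h0 : 0 ≤ (2 * m + 1) * x := by positivity
    have h1 : (2 * m + 1) * x ≤ 1 := by nlinarith
    have := Real.one_sub_sq_div_two_le_cos (x := (2 * m + 1) * x)
    nlinarith
  have head : 1 / 144 * (L / 32 - 1) ≤ ∑ m ∈ Finset.range N, bb a m * cos ((2 * m + 1) * x) := by
    have h1 : ∑ m ∈ Finset.range P, bb a m * cos ((2 * m + 1) * x) ≤ ∑ m ∈ Finset.range N, bb a m * cos ((2 * m + 1) * x) := by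
      refine Finset.sum_le_sum_of_subset_of_nonneg (Finset.range_mono hPN) fun m hm _ => ?_
      exact mul_nonneg (bb_nonneg _ _) (by linarith [hcos m (Finset.mem_range.1 hm)])
    refine le_trans ?_ h1
    have h2 : ∀ m ∈ Finset.range P, 1 / 144 * ((m:ℝ) + 1)⁻¹ ≤ bb a m * cos ((2 * m + 1) * x) := by
      intro m hm
      have hm := Finset.mem_range.1 hm
      have hm' : (m:ℝ) + 1 ≤ P := by exact_mod_cast hm
      have h3 : a * (2 * m + 1) ≤ 1 := by
        calc a * (2 * m + 1) ≤ exp (-L) * exp (L / 32) := by rw [haL]; gcongr; linarith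
          _ ≤ 1 := by rw [← exp_add]; exact exp_le_one_iff.2 (by linarith)
      have h4 := bb_ge ha m h3
      have h5 := hcos m (by omega)
      calc _ = 1 / 72 * (1 / ((m:ℝ) + 1)) * (1 / 2) := by ring
        _ ≤ _ := by gcongr; exact bb_nonneg _ _
    refine le_trans ?_ (Finset.sum_le_sum h2)
    rw [← Finset.mul_sum]
    gcongr
    have h6 := log_add_one_le_harmonic P
    have h7 : L / 32 - 1 ≤ log (P + 1) := by
      rw [Real.le_log_iff_exp_le (by positivity), sub_eq_add_neg, exp_add]
      have : exp (-1) ≤ 1 / 2 := by rw [exp_neg, one_div]; gcongr; linarith [add_one_le_exp (1:ℝ)]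
      have := exp_pos (L/32)
      push_cast at *
      nlinarith
    have h8 : ((harmonic P : ℚ) : ℝ) = ∑ m ∈ Finset.range P, ((m:ℝ) + 1)⁻¹ := by simp [harmonic]
    push_cast at h6
    linarith
  have tot := ss.sum_add_tsum_nat_add N
  have S : 1 / 144 * (L / 32 - 1) - 8 ≤ ∑' m : ℕ, bb a m * cos ((2 * m + 1) * x) := by
    rw [← tot]; linarith
  have h9 : 1 ≤ 16 / π ^ 2 := by
    rw [one_le_div (by positivity)]; nlinarith [pi_le_four, pi_pos]
  rw [e]
  nlinarith

end EU

end

section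
open Real MeasureTheory Set Filter Topology

namespace EU

lemma minsq_der (u : ℝ) : HasDerivAt (fun v : ℝ => (min v 0) ^ 2) (2 * min u 0) u := by
  rw [hasDerivAt_iff_isLittleO]
  have h2 : (fun v : ℝ => (min v 0) ^ 2 - (min u 0) ^ 2 - (v - u) • (2 * min u 0)) =O[𝓝 u] fun v => (v - u) ^ 2 := by
    refine Asymptotics.IsBigO.of_bound 1 (Eventually.of_forall fun v => ?_)
    rw [Real.norm_eq_abs, Real.norm_eq_abs, abs_of_nonneg (sq_nonneg (v - u)), one_mul, smul_eq_mul, abs_le]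
    rcases min_cases v 0 with ⟨h, h'⟩ | ⟨h, h'⟩ <;> rcases min_cases u 0 with ⟨g, g'⟩ | ⟨g, g'⟩ <;> rw [h, g] <;> constructor <;> nlinarith [sq_nonneg (v - u)]
  refine h2.trans_isLittleO ?_
  have h3 : Tendsto (fun v => v - u) (𝓝 u) (𝓝 0) := by
    have : Continuous fun v : ℝ => v - u := by fun_prop
    simpa using this.tendsto u
  exact (Asymptotics.isLittleO_pow_id one_lt_two).comp_tendsto h3

lemma comp_nonneg {f f' α : ℝ → ℝ} {b K : ℝ} (hc : ContinuousOn f (Icc 0 b)) (hd : ∀ t ∈ Ioo 0 b, HasDerivAt f (f' t) t)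
    (hα : ∀ t ∈ Ioo 0 b, |α t| ≤ K) (h : ∀ t ∈ Ioo 0 b, α t * f t ≤ f' t) (h0 : 0 ≤ f 0) : ∀ t ∈ Icc 0 b, 0 ≤ f t := by
  intro t ht
  have h1 := gronw (f := fun t => (min (f t) 0) ^ 2) (f' := fun t => 2 * min (f t) 0 * f' t) (K := 2 * K) (b := b) (by fun_prop)
    (fun t ht => (minsq_der (f t)).comp t (hd t ht)) (fun t ht => by
      have a1 := abs_le.1 (hα t ht)
      have a2 := h t ht
      have a3 : min (f t) 0 ≤ 0 := min_le_right _ _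
      have a4 : min (f t) 0 * f t = min (f t) 0 ^ 2 := by
        rcases min_cases (f t) 0 with ⟨h, h'⟩ | ⟨h, h'⟩ <;> rw [h] <;> ring
      calc 2 * min (f t) 0 * f' t ≤ 2 * min (f t) 0 * (α t * f t) := by nlinarith
        _ = 2 * (α t * min (f t) 0 ^ 2) := by rw [← a4]; ring
        _ ≤ 2 * (K * min (f t) 0 ^ 2) := by gcongr; exact a1.2
        _ = _ := by ring) t ht
  simp only [min_eq_right h0] at h1
  have h2 : min (f t) 0 = 0 := by
    have : (min (f t) 0) ^ 2 ≤ 0 := by simpa using h1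
    exact pow_eq_zero_iff two_ne_zero |>.1 (le_antisymm this (sq_nonneg _))
  exact min_eq_right_iff.1 h2

lemma lip_of_deriv {f f' : ℝ → ℝ} {K : ℝ} (h : ∀ x, HasDerivAt f (f' x) x) (hK : ∀ x, |f' x| ≤ K) (x y : ℝ) : |f x - f y| ≤ K * |x - y| :=
  convex_univ.norm_image_sub_le_of_norm_hasDerivWithin_le (fun x _ => (h x).hasDerivWithinAt) (fun x _ => hK x) (mem_univ y) (mem_univ x)

lemma wv_le (k) : |wv k| ≤ 1 * br k ^ 1 := by
  rw [wv, abs_mul]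
  have h1 := k2_le k
  have h2 := nsq_inv_le k
  have := br_pos k
  calc _ ≤ (1 * br k ^ 1) * 1 := by gcongr
    _ = _ := by ring
lemma Vf_der {d} (h : Rapid d) (x : ℝ) : HasDerivAt (Vf d) (Vx d x) x := (h.mul_wt wv_le).dx _ x 0

lemma Fs_sum_le {d u : ℤ × ℤ → ℝ} (su : Summable u) (hu : ∀ k, |d k| ≤ u k) (φ x y : ℝ) : |Fs φ d x y| ≤ ∑' k, u k := by
  have h1 : ∀ k, |d k * cos (k.1 * x + k.2 * y + φ)| ≤ u k := fun k => (norm_mul_cos_le _ _).trans (hu k)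
  have s1 : Summable fun k => |d k * cos (k.1 * x + k.2 * y + φ)| := Summable.of_nonneg_of_le (fun _ => abs_nonneg _) h1 su
  exact (abs_tsum_le s1).trans (s1.tsum_le_tsum h1 su)

lemma Sol.Vbd {b c} (h : Sol b c) : ∃ K : ℝ, 0 ≤ K ∧ ∀ t ∈ Icc 0 b, (∀ x, |Vf (c t) x| ≤ K) ∧ (∀ x, |Vx (c t) x| ≤ K) ∧
    ∀ x y, |Vx (c t) x - Vx (c t) y| ≤ K * |x - y| := by
  have w1 := h.ub.wt wv_le
  have w2 := w1.wt k1_le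
  have w3 := w2.wt k1_le
  obtain ⟨u1, s1, h1⟩ := w1.sum
  obtain ⟨u2, s2, h2⟩ := w2.sum
  obtain ⟨u3, s3, h3⟩ := w3.sum
  set K := max (|∑' k, u1 k|) (max (|∑' k, u2 k|) |∑' k, u3 k|) with hK
  have k1 : ∑' k, u1 k ≤ K := (le_abs_self _).trans (le_max_left _ _)
  have k2 : ∑' k, u2 k ≤ K := (le_abs_self _).trans ((le_max_left _ _).trans (le_max_right _ _))
  have k3 : ∑' k, u3 k ≤ K := (le_abs_self _).trans ((le_max_right _ _).trans (le_max_right _ _))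
  refine ⟨K, (abs_nonneg _).trans (le_max_left _ _), fun t ht => ⟨fun x => ?_, fun x => ?_, fun x y => ?_⟩⟩
  · exact (Fs_sum_le s1 (h1 t ht) _ _ _).trans k1
  · exact (Fs_sum_le s2 (h2 t ht) _ _ _).trans k2
  · exact lip_of_deriv (fun x => (((h.rapid ht).mul_wt wv_le).mul_wt k1_le).dx (0 + π/2 + π/2) x 0)
      (fun x => (Fs_sum_le s3 (h3 t ht) _ _ _).trans k3) x y

lemma Sol.traj {b c} (h : Sol b c) (hb : 0 ≤ b) (x : ℝ) : ∃ X : ℝ → ℝ, X 0 = x ∧ ∀ t ∈ Icc 0 b, HasDerivWithinAt X (Vf (c t) (X t)) (Icc 0 b) t := by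
  obtain ⟨K, hK0, hK⟩ := h.Vbd
  have PL : IsPicardLindelof (fun t x => Vf (c t) x) (⟨0, le_rfl, hb⟩ : Icc (0:ℝ) b) x ⟨K * b, by positivity⟩ 0 ⟨K, hK0⟩ ⟨K, hK0⟩ :=
    { lipschitzOnWith := fun t ht => (LipschitzWith.of_dist_le_mul fun x y => by
        rw [Real.dist_eq, Real.dist_eq]
        exact lip_of_deriv (Vf_der (h.rapid ht)) (hK t ht).2.1 x y).lipschitzOnWith
      continuousOn := fun x _ => h.Fs_cont wv_le _ x 0
      norm_le := fun t ht x _ => (hK t ht).1 x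
      mul_max_le := by simp [hb]; exact le_rfl }
  obtain ⟨X, h0, hX⟩ := PL.exists_eq_forall_mem_Icc_hasDerivWithinAt₀
  exact ⟨X, h0, hX⟩

/-- equation for the normal derivative on the axis -/
lemma q_time {d} (hs : Sym d) (hr : Rapid d) (x : ℝ) :
    Fs (0 + π / 2) (fun k => k.2 * nl d k) x 0 = - Vf d x * Fs (0 + π / 2 + π / 2) (fun k => k.1 * (k.2 * d k)) x 0 + Vx d x * gy d x 0 := by
  have rn : Rapid (nl d) := hr.nl
  have h1 := rn.dy 0 x 0
  have e : (fun y => Fs 0 (nl d) x y) = fun y => Fs (0 + π / 2) (fun k => k.1 * d k) x y * Fs (0 + π / 2) (fun k => k.2 * (-(nsq k)⁻¹ * d k)) x y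
      - Fs (0 + π / 2) (fun k => k.2 * d k) x y * Fs (0 + π / 2) (fun k => k.1 * (-(nsq k)⁻¹ * d k)) x y := by
    ext y; exact Fs_nl hr hs.even x y
  rw [e] at h1
  have h2 := ((hr.k1.dy (0 + π / 2) x 0).mul (hr.psi.k2.dy (0 + π / 2) x 0)).sub ((hr.k2.dy (0 + π / 2) x 0).mul (hr.psi.k1.dy (0 + π / 2) x 0))
  have h3 := h1.unique h2
  have z1 : Fs (0 + π / 2) (fun k => k.1 * d k) x 0 = 0 := by
    refine (hr.gxd x 0).unique ?_
    simp only [hs.Fs_zero_y]; exact hasDerivAt_const x 0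
  have z2 : Fs (0 + π / 2) (fun k => k.1 * (-(nsq k)⁻¹ * d k)) x 0 = 0 := by
    refine (hr.psi.dx 0 x 0).unique ?_
    simp only [hs.psi.Fs_zero_y]; exact hasDerivAt_const x 0
  rw [h3, z1, z2]
  have e1 : Fs (0 + π / 2) (fun k => k.2 * (-(nsq k)⁻¹ * d k)) x 0 = - Vf d x := by
    unfold Vf Fs; rw [← tsum_neg]; congr 1; ext k; unfold wv; ring
  have e2 : Fs (0 + π / 2 + π / 2) (fun k => k.2 * (k.1 * (-(nsq k)⁻¹ * d k))) x 0 = - Vx d x := by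
    unfold Vx Fs; rw [← tsum_neg]; congr 1; ext k; unfold wv; ring
  have e3 : Fs (0 + π / 2 + π / 2) (fun k => k.2 * (k.1 * d k)) x 0 = Fs (0 + π / 2 + π / 2) (fun k => k.1 * (k.2 * d k)) x 0 := by
    congr 1; ext k; ring
  rw [e1, e2, e3, gy]; ring

lemma Sol.q_along {b c} (h : Sol b c) {X : ℝ → ℝ} {t : ℝ} (ht : t ∈ Ioo 0 b) (hX : HasDerivAt X (Vf (c t) (X t)) t) :
    HasDerivAt (fun u => gy (c u) (X u) 0) (Vx (c t) (X t) * gy (c t) (X t) 0) t := by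
  have hU := h.ub.mono (Ioo_subset_Icc_self (a := 0) (b := b))
  have hF := Fs_hasFDerivAt isOpen_Ioo isPreconnected_Ioo (0 + π / 2) (hU.wt k2_le) ((hU.bil hU).wt k2_le)
    (fun t ht k => (h.hasDerivAt ht k).const_mul (k.2:ℝ)) (X t, (0:ℝ), t) ht
  have hp : HasDerivAt (fun u => (X u, (0:ℝ), u)) (Vf (c t) (X t), (0:ℝ), (1:ℝ)) t := hX.prodMk ((hasDerivAt_const t 0).prodMk (hasDerivAt_id t))
  have ht' := Ioo_subset_Icc_self ht
  refine (hF.comp_hasDerivAt t hp).congr_deriv ?_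
  have := q_time (h.sym t ht') (h.rapid ht') (X t)
  unfold nl at this
  simp only [l1, l2, l3, add_apply, smul_apply, ContinuousLinearMap.comp_apply, ContinuousLinearMap.coe_fst', ContinuousLinearMap.coe_snd', smul_eq_mul, mul_zero, mul_one, add_zero]
  rw [this]; ring

lemma Sol.q_cont {b c} (h : Sol b c) {X : ℝ → ℝ} (hX : ContinuousOn X (Icc 0 b)) : ContinuousOn (fun u => gy (c u) (X u) 0) (Icc 0 b) := by
  obtain ⟨u, su, hu⟩ := (h.ub.wt k2_le).sum
  refine continuousOn_tsum (fun k => ContinuousOn.mul ((h.cont k).const_mul (k.2:ℝ)) ?_) su fun k t ht => (norm_mul_cos_le _ _).trans (hu t ht k)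
  fun_prop

/-- two nearby trajectories -/
lemma Sol.pair {b c} (h : Sol b c) (hb : 0 < b) {K Q G : ℝ} (hK : ∀ t ∈ Icc 0 b, (∀ x, |Vx (c t) x| ≤ K) ∧
      ∀ x y, |Vx (c t) x - Vx (c t) y| ≤ K * |x - y|) (hK0 : 0 ≤ K)
    (hQ : ∀ t ∈ Icc 0 b, ∀ x, gy (c t) x 0 ≤ Q) {X Y : ℝ → ℝ}
    (hX : ∀ t ∈ Icc 0 b, HasDerivWithinAt X (Vf (c t) (X t)) (Icc 0 b) t)
    (hY : ∀ t ∈ Icc 0 b, HasDerivWithinAt Y (Vf (c t) (Y t)) (Icc 0 b) t) (hXY : X 0 ≤ Y 0)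
    (hG : 0 < G) (hq : G ≤ gy (c 0) (X 0) 0) (hδ : K * ((Y 0 - X 0) * exp (K * b)) ≤ 1 / b) :
    (∀ t ∈ Icc 0 b, X t ≤ Y t) ∧ Y b - X b ≤ Q / G * exp 1 * (Y 0 - X 0) := by
  have bb : b ∈ Icc 0 b := ⟨hb.le, le_rfl⟩
  have cX : ContinuousOn X (Icc 0 b) := fun t ht => (hX t ht).continuousWithinAt
  have cY : ContinuousOn Y (Icc 0 b) := fun t ht => (hY t ht).continuousWithinAt
  have dX : ∀ t ∈ Ioo 0 b, HasDerivAt X (Vf (c t) (X t)) t := fun t ht => (hX t (Ioo_subset_Icc_self ht)).hasDerivAt (Icc_mem_nhds ht.1 ht.2)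
  have dY : ∀ t ∈ Ioo 0 b, HasDerivAt Y (Vf (c t) (Y t)) t := fun t ht => (hY t (Ioo_subset_Icc_self ht)).hasDerivAt (Icc_mem_nhds ht.1 ht.2)
  have lip : ∀ t ∈ Icc 0 b, ∀ x y, |Vf (c t) x - Vf (c t) y| ≤ K * |x - y| := fun t ht => lip_of_deriv (Vf_der (h.rapid ht)) (hK t ht).1
  have pos : ∀ t ∈ Icc 0 b, 0 ≤ Y t - X t := by
    refine comp_nonneg (f := fun t => Y t - X t) (f' := fun t => Vf (c t) (Y t) - Vf (c t) (X t)) (K := K)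
      (α := fun t => (Vf (c t) (Y t) - Vf (c t) (X t)) / (Y t - X t)) (cY.sub cX) (fun t ht => (dY t ht).sub (dX t ht)) (fun t ht => ?_) (fun t ht => ?_) (by simpa using hXY)
    · rw [abs_div]
      exact div_le_of_le_mul₀ (abs_nonneg _) hK0 (lip t (Ioo_subset_Icc_self ht) _ _)
    · by_cases hz : Y t - X t = 0
      · have : Y t = X t := by linarith
        simp [this]
      · rw [div_mul_cancel₀ _ hz]
  refine ⟨fun t ht => by linarith [pos t ht], ?_⟩
  have up : ∀ t ∈ Icc 0 b, Y t - X t ≤ (Y 0 - X 0) * exp (K * t) := by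
    refine gronw (f := fun t => Y t - X t) (f' := fun t => Vf (c t) (Y t) - Vf (c t) (X t)) (cY.sub cX) (fun t ht => (dY t ht).sub (dX t ht)) (fun t ht => ?_)
    have := lip t (Ioo_subset_Icc_self ht) (Y t) (X t)
    rw [abs_of_nonneg (pos t (Ioo_subset_Icc_self ht))] at this
    exact (le_abs_self _).trans this
  have sec : ∀ t ∈ Ioo 0 b, Vf (c t) (Y t) - Vf (c t) (X t) ≤ (Vx (c t) (X t) + 1 / b) * (Y t - X t) := by
    intro t ht
    have ht' := Ioo_subset_Icc_self ht
    have p := pos t ht'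
    rcases p.eq_or_lt with hz | hlt
    · have : Y t = X t := by linarith
      simp [this]
    obtain ⟨ξ, hξ, he⟩ := exists_hasDerivAt_eq_slope (Vf (c t)) (Vx (c t)) (sub_pos.1 hlt) (fun x _ => (Vf_der (h.rapid ht') x).continuousAt.continuousWithinAt) (fun x _ => Vf_der (h.rapid ht') x)
    rw [eq_div_iff hlt.ne'] at he
    rw [← he]
    gcongr
    have a1 := (hK t ht').2 ξ (X t)
    have a2 : |ξ - X t| ≤ (Y 0 - X 0) * exp (K * b) := by
      rw [abs_of_pos (by linarith [hξ.1])]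
      have := up t ht'
      have a3 : (Y 0 - X 0) * exp (K * t) ≤ (Y 0 - X 0) * exp (K * b) := by 
        have := exp_le_exp.2 (mul_le_mul_of_nonneg_left ht'.2 hK0)
        exact mul_le_mul_of_nonneg_left this (by linarith)
      linarith [hξ.2]
    have a4 : K * |ξ - X t| ≤ K * ((Y 0 - X 0) * exp (K * b)) := by gcongr
    linarith [le_abs_self (Vx (c t) ξ - Vx (c t) (X t))]
  set q0 := gy (c 0) (X 0) 0 with hq0
  have W : ∀ t ∈ Icc 0 b, 0 ≤ gy (c t) (X t) 0 * ((Y 0 - X 0) * exp (1 / b * t)) - q0 * (Y t - X t) := by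
    have cq := h.q_cont cX
    refine comp_nonneg (f := fun t => gy (c t) (X t) 0 * ((Y 0 - X 0) * exp (1 / b * t)) - q0 * (Y t - X t))
      (f' := fun t => Vx (c t) (X t) * gy (c t) (X t) 0 * ((Y 0 - X 0) * exp (1 / b * t)) + gy (c t) (X t) 0 * ((Y 0 - X 0) * (exp (1 / b * t) * (1 / b * 1))) - q0 * (Vf (c t) (Y t) - Vf (c t) (X t)))
      (α := fun t => Vx (c t) (X t) + 1 / b) (K := K + 1 / b) ?_ (fun t ht => ?_) (fun t ht => ?_) (fun t ht => ?_) ?_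
    · exact (cq.mul (by fun_prop)).sub ((cY.sub cX).const_mul q0)
    · have e1 : HasDerivAt (fun t => exp (1 / b * t)) (exp (1 / b * t) * (1 / b * 1)) t := ((hasDerivAt_id t).const_mul (1 / b)).exp
      exact ((h.q_along ht (dX t ht)).mul (e1.const_mul _)).sub (((dY t ht).sub (dX t ht)).const_mul q0)
    · refine (abs_add_le _ _).trans ?_
      rw [abs_of_pos (a := 1 / b) (by positivity)]
      gcongr; exact (hK t (Ioo_subset_Icc_self ht)).1 _
    · have := sec t ht
      have hq' : 0 ≤ q0 := by linarith
      have := mul_le_mul_of_nonneg_left this hq'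
      linarith
    · simp [← hq0]
  have h1 := W b bb
  rw [one_div_mul_cancel hb.ne'] at h1
  have h2 := hQ b bb (X b)
  have h3 : 0 ≤ (Y 0 - X 0) * exp 1 := mul_nonneg (by linarith) (exp_pos _).le
  have h4 : G * (Y b - X b) ≤ q0 * (Y b - X b) := mul_le_mul_of_nonneg_right hq (pos b bb)
  have h5 := mul_le_mul_of_nonneg_right h2 h3
  rw [div_mul_eq_mul_div, div_mul_eq_mul_div, le_div_iff₀ hG]
  linarith

/-- total stretching is bounded -/
lemma Sol.stretch {b c} (h : Sol b c) (hb : 0 < b) {Q G x1 x2 : ℝ} (hx : x1 < x2)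
    (hQ : ∀ t ∈ Icc 0 b, ∀ x, gy (c t) x 0 ≤ Q) (hG : 0 < G) (hq : ∀ x ∈ Icc x1 x2, G ≤ gy (c 0) x 0) :
    ∃ X Y : ℝ → ℝ, X 0 = x1 ∧ Y 0 = x2 ∧ (∀ t ∈ Icc 0 b, HasDerivWithinAt X (Vf (c t) (X t)) (Icc 0 b) t) ∧
     (∀ t ∈ Icc 0 b, HasDerivWithinAt Y (Vf (c t) (Y t)) (Icc 0 b) t) ∧ (∀ t ∈ Icc 0 b, X t ≤ Y t) ∧ Y b - X b ≤ Q / G * exp 1 * (x2 - x1) := by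
  obtain ⟨K, hK0, hK⟩ := h.Vbd
  choose F hF0 hF using h.traj hb.le
  obtain ⟨n, hn⟩ := exists_nat_gt (K * ((x2 - x1) * exp (K * b)) * b)
  have hn0 : (0:ℝ) < n := lt_of_le_of_lt (by have := sub_pos.2 hx; positivity) hn
  set p : ℕ → ℝ := fun i => x1 + i * ((x2 - x1) / n) with hp
  have hs : 0 < (x2 - x1) / n := div_pos (sub_pos.2 hx) hn0
  have p0 : p 0 = x1 := by simp [hp]
  have pn : p n = x2 := by simp only [hp]; field_simp; ring
  have step : ∀ i, p (i + 1) - p i = (x2 - x1) / n := fun i => by simp only [hp]; push_cast; ring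
  have key : ∀ i < n, (∀ t ∈ Icc 0 b, F (p i) t ≤ F (p (i + 1)) t) ∧ F (p (i + 1)) b - F (p i) b ≤ Q / G * exp 1 * ((x2 - x1) / n) := by
    intro i hi
    have := h.pair hb (K := K) (Q := Q) (G := G) (X := F (p i)) (Y := F (p (i+1))) (fun t ht => (hK t ht).2) hK0 hQ (hF _) (hF _)
      (by rw [hF0, hF0]; linarith [step i]) hG (by
        rw [hF0]; apply hq
        have hi' : (i:ℝ) ≤ n := by exact_mod_cast hi.le
        have h1 : (i:ℝ) * ((x2 - x1) / n) ≤ n * ((x2 - x1) / n) := by gcongr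
        have h2 : p n = x1 + n * ((x2 - x1) / n) := rfl
        have h3 : 0 ≤ (i:ℝ) * ((x2 - x1) / n) := by positivity
        exact ⟨by simp only [hp]; linarith, by simp only [hp]; linarith⟩) (by
        rw [hF0, hF0, step, le_div_iff₀ hb]
        have e : K * ((x2 - x1) / n * exp (K * b)) * b = K * ((x2 - x1) * exp (K * b)) * b / n := by ring
        rw [e, div_le_one hn0]; exact hn.le)
    rwa [hF0, hF0, step] at this
  refine ⟨F (p 0), F (p n), by rw [hF0, p0], by rw [hF0, pn], hF _, hF _, fun t ht => ?_, ?_⟩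
  · have h1 := Finset.sum_range_sub (fun i => F (p i) t) n
    have h2 : 0 ≤ ∑ i ∈ Finset.range n, (F (p (i + 1)) t - F (p i) t) := Finset.sum_nonneg fun i hi => by
      linarith [(key i (Finset.mem_range.1 hi)).1 t ht]
    linarith
  · have h1 := Finset.sum_range_sub (fun i => F (p i) b) n
    have h2 := Finset.sum_le_sum fun i hi => (key i (Finset.mem_range.1 hi)).2
    rw [h1, Finset.sum_const, Finset.card_range, nsmul_eq_mul] at h2
    refine h2.trans (le_of_eq ?_)
    field_simp

end EU

end

section
open Real MeasureTheory Set Filter Topology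
namespace EU

lemma wv_le' (k) : |wv k| ≤ 8 / br k := by
  have hb := br_pos k
  by_cases hk : k = 0
  · subst hk; simp [wv]; positivity
  have h1 := br_sq_le hk
  have h2 := k2_le k
  have h3 := nsq_one hk
  have h4 : 0 < nsq k := by linarith
  rw [wv, abs_mul, abs_of_pos (inv_pos.2 h4), ← div_eq_mul_inv, div_le_div_iff₀ h4 hb]
  calc _ ≤ (1 * br k ^ 1) * br k := by gcongr
    _ = br k ^ 2 := by ring
    _ ≤ _ := h1

/-- perturbation constant -/
noncomputable def Kc (M : ℝ) : ℝ := 64 * √(12 * Zc ^ 2 + 64 * M ^ 2)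
lemma Kc_nonneg (M) : 0 ≤ Kc M := by unfold Kc; positivity

lemma Vf_le {d} (hd : Rapid d) {E1 E2 R : ℝ} (h1 : ∑' k, d k ^ 2 ≤ E1) (h2 : ∑' k, br k ^ 2 * d k ^ 2 ≤ E2) (hE1 : 0 ≤ E1) (hE2 : 0 ≤ E2) (hR : 0 ≤ R) (x : ℝ) :
    |Vf d x| ≤ 8 * (√(2 * E1 + 2 * E2 * exp (-(2 * R))) * (2 * (2 + R))) := by
  set N := ⌈exp R⌉₊ with hN
  have hN1 : 1 ≤ N := Nat.one_le_ceil_iff.2 (exp_pos _)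
  have hNr : (1:ℝ) ≤ N := by exact_mod_cast hN1
  have hNl : exp R ≤ N := Nat.le_ceil _
  have hNu : (N:ℝ) ≤ exp (R + 1) := by
    have h3 := Nat.ceil_lt_add_one (exp_pos R).le
    have h4 := add_one_le_exp R
    have h5 := add_one_le_exp (1:ℝ)
    rw [exp_add]; rw [← hN] at h3; nlinarith
  have hl0 : 0 ≤ log N := log_nonneg hNr
  have hlu : log N ≤ R + 1 := (log_le_iff_le_exp (by linarith)).2 hNu
  have s1 : Summable fun k => |d k| / br k := by
    refine Summable.of_nonneg_of_le (fun k => by have := br_pos k; positivity) (fun k => ?_) hd.abs.summable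
    exact div_le_self (abs_nonneg _) (br_one k)
  have h3 := log_sum hd hN1
  have h4 : (∑' k, |d k| / br k) ^ 2 ≤ (√(2 * E1 + 2 * E2 * exp (-(2 * R))) * (2 * (2 + R))) ^ 2 := by
    refine h3.trans ?_
    rw [mul_pow, Real.sq_sqrt (by positivity)]
    have h5 : 2 / (N:ℝ) ^ 2 ≤ 2 * exp (-(2 * R)) := by
      rw [exp_neg, ← div_eq_mul_inv]
      have : exp (2 * R) = exp R ^ 2 := by rw [← exp_nat_mul]; simp
      rw [this]; gcongr
    have h6 : 0 ≤ ∑' k, br k ^ 2 * d k ^ 2 := tsum_nonneg fun k => by positivity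
    have h7 : 0 ≤ ∑' k, d k ^ 2 := tsum_nonneg fun k => by positivity
    have h8 : 2 / (N:ℝ) ^ 2 * ∑' k, br k ^ 2 * d k ^ 2 ≤ 2 * exp (-(2 * R)) * E2 := by gcongr
    have h9 : 4 * (1 + log N) ^ 2 ≤ (2 * (2 + R)) ^ 2 := by
      have h10 : 1 + log N ≤ 2 + R := by linarith
      calc _ ≤ 4 * (2 + R) ^ 2 := by gcongr
        _ = _ := by ring
    calc _ ≤ (2 * E1 + 2 * E2 * exp (-(2 * R))) * (2 * (2 + R)) ^ 2 := by
          apply mul_le_mul _ h9 (by positivity) (by positivity)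
          linarith
      _ = _ := by ring
  have h5 := abs_le_of_sq_le_sq h4 (by positivity)
  unfold Vf
  refine (Fs_sum_le (s1.mul_left 8) (fun k => ?_) _ _ _).trans ?_
  · rw [abs_mul]
    calc _ ≤ 8 / br k * |d k| := by gcongr; exact wv_le' k
      _ = _ := by ring
  · rw [tsum_mul_left]; linarith [le_abs_self (∑' k, |d k| / br k)]

lemma Vpert {b a L M : ℝ} {c : ℝ → ℤ × ℤ → ℝ} (h : Sol b c) (hL : 1 ≤ L) (haL : a = exp (-L)) (h0 : c 0 = c0 a) (hM : 1 ≤ M)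
    {t} (ht : t ∈ Icc 0 b) (hE : ∑' k, nsq k * c t k ^ 2 ≤ (M * (1 / sinh a)) ^ 2) (hg : ∀ x y, gr (c t) x y ≤ M * (1 / sinh a)) (x : ℝ) :
    |Vf (c t) x - Vf (c0 a) x| ≤ Kc M * L * exp (-(L / 4)) := by
  have ha : 0 < a := haL ▸ exp_pos _
  have rt := h.rapid ht
  have r0 := c0_rapid ha
  have e : Vf (c t) x - Vf (c0 a) x = Vf (fun k => c t k - c0 a k) x := by
    unfold Vf
    rw [← Fs_sub (rt.mul_wt wv_le) (r0.mul_wt wv_le)]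
    congr 1; ext k; ring
  set G := 1 / sinh a with hG
  have hS : 0 < sinh a := Real.sinh_pos_iff.2 ha
  have hG0 : 0 ≤ G := by positivity
  have hGe : G ≤ exp L := by
    rw [hG, div_le_iff₀ hS]
    have : a ≤ sinh a := self_le_sinh_iff.2 ha.le
    calc 1 = exp L * a := by rw [haL, ← exp_add]; simp
      _ ≤ _ := by gcongr
  obtain ⟨st, -⟩ := dirichlet rt (h.sym t ht).even hg
  obtain ⟨s0, e0⟩ := dirichlet r0 (c0_sym a).even (c0_gr ha)
  have hE2 : ∑' k, br k ^ 2 * (c t k - c0 a k) ^ 2 ≤ 32 * (M * exp L) ^ 2 := by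
    calc _ ≤ ∑' k, (16 * (nsq k * c t k ^ 2) + 16 * (nsq k * c0 a k ^ 2)) := by
          refine Summable.tsum_le_tsum (fun k => ?_) ((rt.sub r0).sq_summable 2) ((st.mul_left 16).add (s0.mul_left 16))
          by_cases hk : k = 0
          · subst hk; simp [(h.sym t ht).zero, (c0_sym a).zero]
          · have h1 := br_sq_le hk
            have h2 : (c t k - c0 a k) ^ 2 ≤ 2 * (c t k ^ 2 + c0 a k ^ 2) := by nlinarith [sq_nonneg (c t k + c0 a k)]
            calc _ ≤ (8 * nsq k) * (2 * (c t k ^ 2 + c0 a k ^ 2)) := by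
                  apply mul_le_mul h1 h2 (by positivity); have := nsq_nonneg k; positivity
              _ = _ := by ring
      _ ≤ 16 * (M * G) ^ 2 + 16 * G ^ 2 := by
          rw [(st.mul_left 16).tsum_add (s0.mul_left 16), tsum_mul_left, tsum_mul_left]; linarith
      _ ≤ 16 * (M * G) ^ 2 + 16 * (M * G) ^ 2 := by
          gcongr; nlinarith
      _ ≤ 16 * (M * exp L) ^ 2 + 16 * (M * exp L) ^ 2 := by gcongr
      _ = _ := by ring
  have h1 := h.rigid ha h0 ht
  have h2 := Vf_le (rt.sub r0) h1 hE2 (by positivity) (by positivity) (R := 5 / 4 * L) (by linarith) x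
  rw [e]
  refine h2.trans ?_
  have f1 : √(2 * a) ≤ 3 / 2 * exp (-(L / 2)) := by
    rw [Real.sqrt_le_left (by positivity), mul_pow, ← exp_nat_mul, haL]
    push_cast
    rw [show 2 * (-(L / 2)) = -L by ring]
    nlinarith [exp_pos (-L)]
  have f2 : (M * exp L) ^ 2 * exp (-(2 * (5 / 4 * L))) = M ^ 2 * exp (-(L / 2)) := by
    rw [mul_pow, ← exp_nat_mul, mul_assoc, ← exp_add]; congr 2; push_cast; ring
  have f3 : √(2 * (4 * (√(2 * a) * Zc ^ 2)) + 2 * (32 * (M * exp L) ^ 2) * exp (-(2 * (5 / 4 * L)))) ≤ √(12 * Zc ^ 2 + 64 * M ^ 2) * exp (-(L / 4)) := by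
    rw [Real.sqrt_le_left (by positivity), mul_pow (√_), Real.sq_sqrt (by positivity), ← exp_nat_mul]
    push_cast
    rw [show 2 * (-(L / 4)) = -(L / 2) by ring]
    have hz := sq_nonneg Zc
    calc _ = 8 * Zc ^ 2 * √(2 * a) + 64 * ((M * exp L) ^ 2 * exp (-(2 * (5 / 4 * L)))) := by ring
      _ ≤ 8 * Zc ^ 2 * (3 / 2 * exp (-(L / 2))) + 64 * (M ^ 2 * exp (-(L / 2))) := by rw [f2]; gcongr
      _ = _ := by ring
  calc _ ≤ 8 * ((√(12 * Zc ^ 2 + 64 * M ^ 2) * exp (-(L / 4))) * (2 * (4 * L))) := by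
        gcongr; linarith
    _ = _ := by unfold Kc; ring

end EU

end

section
open Real MeasureTheory Set Filter Topology
namespace EU

lemma Vf_zero (d) : Vf d 0 = 0 := by
  unfold Vf Fs
  simp

/-- separation of trajectories -/
lemma dyn {V : ℝ → ℝ → ℝ} {V0 V0' X Y : ℝ → ℝ} {b A K ε c r : ℝ} (hb : 0 < b) (hA : 0 < A) (hε : 0 ≤ ε) (hc : 0 < c)
    (hVz : ∀ t, V t 0 = 0) (hlip : ∀ t ∈ Icc 0 b, ∀ x y, |V t x - V t y| ≤ K * |x - y|)
    (hV0 : ∀ x, HasDerivAt V0 (V0' x) x) (h0z : V0 0 = 0) (hV0A : ∀ x, |V0' x| ≤ A) (hV0c : ∀ x, 0 < x → x ≤ r → c ≤ V0' x)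
    (hp : ∀ t ∈ Icc 0 b, ∀ x, |V t x - V0 x| ≤ ε)
    (hX : ∀ t ∈ Icc 0 b, HasDerivWithinAt X (V t (X t)) (Icc 0 b) t)
    (hY : ∀ t ∈ Icc 0 b, HasDerivWithinAt Y (V t (Y t)) (Icc 0 b) t)
    (hXY : ∀ t ∈ Icc 0 b, X t ≤ Y t) (hX0 : 0 ≤ X 0) (hr : (Y 0 + ε / A) * exp (A * b) ≤ r) :
    (Y 0 - X 0 - 2 * ε / c) * exp (c * b) ≤ Y b - X b := by
  have cX : ContinuousOn X (Icc 0 b) := fun t ht => (hX t ht).continuousWithinAt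
  have cY : ContinuousOn Y (Icc 0 b) := fun t ht => (hY t ht).continuousWithinAt
  have dX : ∀ t ∈ Ioo 0 b, HasDerivAt X (V t (X t)) t := fun t ht =>
    (hX t (Ioo_subset_Icc_self ht)).hasDerivAt (Icc_mem_nhds ht.1 ht.2)
  have dY : ∀ t ∈ Ioo 0 b, HasDerivAt Y (V t (Y t)) t := fun t ht =>
    (hY t (Ioo_subset_Icc_self ht)).hasDerivAt (Icc_mem_nhds ht.1 ht.2)
  have z : (0:ℝ) ∈ Icc 0 b := ⟨le_rfl, hb.le⟩
  have hK0 : 0 ≤ K := by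
    have := (abs_nonneg _).trans (hlip 0 z 1 0)
    simpa using this
  have pX : ∀ t ∈ Icc 0 b, 0 ≤ X t := by
    refine comp_nonneg (f := X) (f' := fun t => V t (X t)) (K := K) (α := fun t => V t (X t) / X t) cX dX (fun t ht => ?_) (fun t ht => ?_) hX0
    · rw [abs_div]
      have := hlip t (Ioo_subset_Icc_self ht) (X t) 0
      rw [hVz, sub_zero, sub_zero] at this
      exact div_le_of_le_mul₀ (abs_nonneg _) hK0 this
    · by_cases hz : X t = 0
      · simp [hz, hVz]
      · rw [div_mul_cancel₀ _ hz]
  have hY0 : 0 ≤ Y 0 := (pX 0 z).trans (hXY 0 z)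
  have uY : ∀ t ∈ Icc 0 b, Y t ≤ r := by
    intro t ht
    have h1 := gronw (f := fun t => Y t + ε / A) (f' := fun t => V t (Y t)) (K := A) (b := b) (cY.add continuousOn_const)
      (fun t ht => (dY t ht).add_const _) (fun t ht => by
        have ht' := Ioo_subset_Icc_self ht
        have a1 := abs_le.1 (hp t ht' (Y t))
        have a2 := lip_of_deriv hV0 hV0A (Y t) 0
        rw [h0z, sub_zero, sub_zero, abs_of_nonneg ((pX t ht').trans (hXY t ht'))] at a2
        have a3 := (abs_le.1 a2).2
        have a4 : A * (Y t + ε / A) = A * Y t + ε := by field_simp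
        linarith [a1.2]) t ht
    have h2 : exp (A * t) ≤ exp (A * b) := exp_le_exp.2 (by have := ht.2; gcongr)
    have h3 : 0 ≤ ε / A := by positivity
    have h4 : (Y 0 + ε / A) * exp (A * t) ≤ (Y 0 + ε / A) * exp (A * b) := by gcongr
    linarith
  have key := comp_nonneg (f := fun t => (Y t - X t - 2 * ε / c) - (Y 0 - X 0 - 2 * ε / c) * exp (c * t))
    (f' := fun t => (V t (Y t) - V t (X t)) - (Y 0 - X 0 - 2 * ε / c) * (exp (c * t) * (c * 1))) (b := b) (K := c) (α := fun _ => c)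
    (by fun_prop) (fun t ht => by
      have e1 : HasDerivAt (fun t => exp (c * t)) (exp (c * t) * (c * 1)) t := ((hasDerivAt_id t).const_mul c).exp
      exact (((dY t ht).sub (dX t ht)).sub_const _).sub (e1.const_mul _)) (fun t ht => by rw [abs_of_pos hc])
    (fun t ht => by
      have ht' := Ioo_subset_Icc_self ht
      have a1 := (abs_le.1 (hp t ht' (Y t))).1
      have a2 := (abs_le.1 (hp t ht' (X t))).2
      have a3 : c * (Y t - X t) ≤ V0 (Y t) - V0 (X t) := by
        refine Convex.mul_sub_le_image_sub_of_le_deriv (convex_Icc 0 r) (fun x _ => (hV0 x).continuousAt.continuousWithinAt)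
          (fun x _ => (hV0 x).differentiableAt.differentiableWithinAt) (fun x hx => ?_) (X t) ⟨pX t ht', (hXY t ht').trans (uY t ht')⟩
          (Y t) ⟨(pX t ht').trans (hXY t ht'), uY t ht'⟩ (hXY t ht')
        rw [interior_Icc] at hx
        rw [(hV0 x).deriv]
        exact hV0c x hx.1 hx.2.le
      have a4 : c * (2 * ε / c) = 2 * ε := by field_simp
      have a5 : c * (Y t - X t - 2 * ε / c - (Y 0 - X 0 - 2 * ε / c) * exp (c * t)) =
        c * (Y t - X t) - c * (2 * ε / c) - (Y 0 - X 0 - 2 * ε / c) * (exp (c * t) * (c * 1)) := by ring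
      rw [a5, a4]
      linarith) (by simp) b ⟨hb.le, le_rfl⟩
  have h1 : 0 ≤ 2 * ε / c := by positivity
  linarith

lemma sinh_le {a : ℝ} (ha : 0 < a) (ha1 : a ≤ 1) : sinh a ≤ 2 * a := by
  have h1 := (abs_le.1 (Real.abs_exp_sub_one_le (x := a) (by rwa [abs_of_pos ha]))).2
  rw [abs_of_pos ha] at h1
  have h2 := add_one_le_exp (-a)
  rw [sinh_eq]; linarith

theorem main {T M : ℝ} (hT : 0 < T) (hM : 1 ≤ M) : Claim T M := by
  by_contra hneg
  set τ := min T (1 / 384) with hτ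
  have τ0 : 0 < τ := lt_min hT (by norm_num)
  have τT : τ ≤ T := min_le_left _ _
  have τ1 : τ ≤ 1 / 384 := min_le_right _ _
  have hK := Kc_nonneg M
  set L := 200000 + 240000 * Kc M + 240000 * M / τ with hL
  have q1 : 0 ≤ 240000 * M / τ := by positivity
  have L1 : 200000 ≤ L := by linarith
  have L2 : 240000 * Kc M ≤ L := by linarith
  have L3 : 24 * M ≤ L / 10000 * τ := by
    have : 240000 * M / τ ≤ L := by linarith
    rw [div_le_iff₀ τ0] at this
    linarith
  have L0 : 0 < L := by linarith
  clear_value L τ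
  set a := exp (-L) with ha
  have a0 : 0 < a := exp_pos _
  have a1 : a ≤ 1 := exp_le_one_iff.2 (by linarith)
  have S0 : 0 < sinh a := Real.sinh_pos_iff.2 a0
  set G := 1 / sinh a with hG
  have G0 : 0 < G := by positivity
  obtain ⟨c, hs, hc0, hg, hE⟩ := global hT hM hneg τ0 τT (c0_sym a) (c0_rapid a0) (c0_B1 a0) (c0_gr a0) (c0_pos a0)
  set D := exp (-(L / 16)) with hD
  have D0 : 0 < D := exp_pos _
  -- numerical facts
  have n1 : D ≤ 1 / 2 := by
    have : 2 ≤ exp (L / 16) := by linarith [add_one_le_exp (L / 16)]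
    rw [hD, exp_neg, inv_eq_one_div]
    gcongr
  have n2 : 4 * a ≤ D := by
    have e1 : D = a * exp (15 / 16 * L) := by rw [hD, ha, ← exp_add]; congr 1; ring
    have : 4 ≤ exp (15 / 16 * L) := by linarith [add_one_le_exp (15 / 16 * L)]
    rw [e1]; nlinarith
  have n3 : 40000 * Kc M * exp (-(L / 4)) ≤ D := by
    have e1 : D = exp (-(L / 4)) * exp (3 / 16 * L) := by rw [hD, ← exp_add]; congr 1; ring
    have : 40000 * Kc M ≤ exp (3 / 16 * L) := by linarith [add_one_le_exp (3 / 16 * L)]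
    rw [e1, mul_comm]; gcongr
  obtain ⟨X, Y, hX0, hY0, hX, hY, hXY, hfin⟩ := hs.stretch τ0 (Q := M * G) (G := G / 4) (x1 := D) (x2 := 2 * D) (by linarith)
    (fun t ht x => by
      refine le_trans ?_ (hg t ht x 0)
      unfold gr
      exact Real.le_sqrt_of_sq_le (by nlinarith [sq_nonneg (gx (c t) x 0)])) (by positivity)
    (fun x hx => by
      rw [hc0]
      refine c0_q a0 ?_
      have h1 := Real.mul_le_sin (x := x) (by linarith [hx.1]) (by linarith [hx.2, pi_gt_three])
      have h2 : x / 2 ≤ 2 / π * x := by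
        have : 1 / 2 ≤ 2 / π := by rw [div_le_div_iff₀ (by norm_num) pi_pos]; linarith [pi_le_four]
        have := mul_le_mul_of_nonneg_right this (by linarith [hx.1] : 0 ≤ x)
        linarith
      linarith [sinh_le a0 a1, hx.1])
  obtain ⟨K, hK0, hKK⟩ := hs.Vbd
  set ε := Kc M * L * exp (-(L / 4)) with hε
  have e1 : ε / (6 * L) = Kc M * exp (-(L / 4)) / 6 := by rw [hε]; field_simp
  have e2 : 2 * ε / (L / 10000) = 20000 * Kc M * exp (-(L / 4)) := by rw [hε]; field_simp; ring
  have n4 : (2 * D + ε / (6 * L)) * exp (6 * L * τ) ≤ exp (-(L / 32)) := by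
    have h1 : 2 * D + ε / (6 * L) ≤ 3 * D := by
      have : 0 ≤ Kc M * exp (-(L / 4)) := by positivity
      rw [e1]; linarith
    have h2 : exp (6 * L * τ) ≤ exp (L / 64) := exp_le_exp.2 (by nlinarith)
    have h3 : exp (-(L / 32)) = D * exp (L / 64) * exp (L / 64) := by rw [hD, ← exp_add, ← exp_add]; congr 1; ring
    have h4 : 3 ≤ exp (L / 64) := by linarith [add_one_le_exp (L / 64)]
    calc _ ≤ (3 * D) * exp (L / 64) := by gcongr
      _ = D * exp (L / 64) * 3 := by ring
      _ ≤ D * exp (L / 64) * exp (L / 64) := by gcongr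
      _ = _ := h3.symm
  have hd := dyn (V := fun t => Vf (c t)) (V0 := Vf (c0 a)) (V0' := Vx (c0 a)) (X := X) (Y := Y) (b := τ) (A := 6 * L) (K := K) (ε := ε)
    (c := L / 10000) (r := exp (-(L / 32))) τ0 (by linarith) (by positivity) (by positivity) (fun t => Vf_zero _)
    (fun t ht => lip_of_deriv (Vf_der (hs.rapid ht)) (hKK t ht).2.1) (Vf_der (c0_rapid a0)) (Vf_zero _)
    (V0_upper (by linarith) rfl) (fun x hx hx' => V0_lower L1 rfl hx hx')
    (fun t ht x => Vpert hs (by linarith) rfl hc0 hM ht (hE t ht) (hg t ht) x) hX hY hXY (by rw [hX0]; exact D0.le)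
    (by rw [hY0]; exact n4)
  rw [hX0, hY0, e2] at hd
  have f1 : M * G / (G / 4) * exp 1 * (2 * D - D) = 4 * M * exp 1 * D := by field_simp; ring
  rw [f1] at hfin
  have f2 : 24 * M < exp (L / 10000 * τ) := by linarith [add_one_le_exp (L / 10000 * τ)]
  have f3 : D / 2 * (24 * M) < (2 * D - D - 20000 * Kc M * exp (-(L / 4))) * exp (L / 10000 * τ) := by
    calc _ < D / 2 * exp (L / 10000 * τ) := by gcongr
      _ ≤ _ := by gcongr; linarith
  have f4 : 4 * M * exp 1 * D ≤ 4 * M * 3 * D := by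
    have := exp_one_lt_d9
    gcongr; linarith
  linarith

end EU

end

/-- For every `T > 0` and every `λ ≥ 1` there is a smooth solution of the 2D Euler
equation on the torus with `‖θ(·,0)‖_∞ < 2`, `‖∇θ(·,0)‖_∞ > 0`, and
`max_{t ∈ [0,T]} ‖∇θ(·,t)‖_∞ > λ^{e^T − 1} ‖∇θ(·,0)‖_∞`. -/
theorem double_exponential_growth (T lam : ℝ) (hT : 0 < T) (hlam : 1 ≤ lam) :
    ∃ θ ψ : ℝ → ℝ → ℝ → ℝ, IsEulerOnTorus T θ ψ ∧
      supNorm (fun x y => θ x y 0) < 2 ∧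
      0 < gradSupNorm θ 0 ∧
      ∃ t ∈ Icc (0:ℝ) T,
        gradSupNorm θ t > lam ^ (Real.exp T - 1) * gradSupNorm θ 0 := by
  exact EU.main hT (Real.one_le_rpow hlam (by linarith [Real.add_one_le_exp T]))
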